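/- arXiv:2011.10791 — 5 statements merged into one kernel-verified Lean document; each statement's English description precedes it below -/
import Mathlib

section
/- Let C be a 4-cycle in a bipartite graph G and let P be a path on at least 6 vertices in G − C. If the number of edges between V(P) and V(C) is at least |V(P)| + 1, then the induced subgraph on V(C) ∪ V(P) contains two vertex-disjoint cycles. -/
open SimpleGraph

section

variable {V : Type*} {G : SimpleGraph V}

/-- Some cycle of `G` has all its vertices in `S`. -/
def SimpleGraph.HasCycleIn (G : SimpleGraph V) (S : Set V) : Prop :=
  ∃ (u : V) (c : G.Walk u u), c.IsCycle ∧ ∀ x ∈ c.support, x ∈ S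

theorem SimpleGraph.hasCycleIn_of_isPath {u v x : V} {S : Set V} (w : G.Walk u v)
    (hw : w.IsPath) (hS : ∀ y ∈ w.support, y ∈ S) (hx : x ∈ S) (hxw : x ∉ w.support)
    (hxu : G.Adj x u) (hvx : G.Adj v x) (huv : u ≠ v) : G.HasCycleIn S := by
  refine ⟨x, .cons hxu (w.concat hvx), ?_, ?_⟩
  · rw [Walk.cons_isCycle_iff]
    refine ⟨hw.concat hxw hvx, ?_⟩
    rw [Walk.edges_concat, List.concat_eq_append, List.mem_append, List.mem_singleton]
    rintro (h | h)
    · exact hxw (w.fst_mem_support_of_mem_edges h)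
    · rw [Sym2.eq_swap, Sym2.congr_left] at h
      exact huv h
  · simp only [Walk.support_cons, Walk.support_concat, List.mem_cons,
      List.mem_append, List.not_mem_nil, or_false]
    grind

/-- `G` has two vertex-disjoint cycles with all their vertices in `S`. -/
def SimpleGraph.HasDisjointCyclesIn (G : SimpleGraph V) (S : Set V) : Prop :=
  ∃ A B : Set V, Disjoint A B ∧ A ⊆ S ∧ B ⊆ S ∧ G.HasCycleIn A ∧ G.HasCycleIn B

theorem SimpleGraph.HasDisjointCyclesIn.mono {S T : Set V}
    (h : G.HasDisjointCyclesIn S) (hST : S ⊆ T) : G.HasDisjointCyclesIn T := by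
  obtain ⟨A, B, hAB, hA, hB, h⟩ := h
  exact ⟨A, B, hAB, hA.trans hST, hB.trans hST, h⟩

/-- `f 0, …, f (n - 1)` is a path in `G` and `c` lists the corners of a quadrilateral of `G`
off this path; the first argument of `c` is the colour class of the corner. -/
structure PathQuad (G : SimpleGraph V) (f : ℕ → V) (n : ℕ) (c : Bool → Bool → V) : Prop where
  injOn : Set.InjOn f (Set.Iio n)
  adj : ∀ i, i + 1 < n → G.Adj (f i) (f (i + 1))
  quad : ∀ s t u, G.Adj (c s t) (c (!s) u)
  corner_ne : ∀ s t, c s t ≠ c s (!t)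
  off : ∀ i < n, ∀ s t, f i ≠ c s t

/-- The links `e₀, …, e₅` of the vertices of a path on six vertices to the corners of a
quadrilateral contain none of seventeen patterns, each of which yields two disjoint cycles. -/
def NoCrossing (e₀ e₁ e₂ e₃ e₄ e₅ : Bool → Bool) : Prop :=
  ∀ t u : Bool,
    ¬(e₂ t ∧ e₄ t ∧ e₀ !t ∧ e₁ u) ∧ ¬(e₁ t ∧ e₃ t ∧ e₅ !t ∧ e₄ u) ∧
    ¬(e₀ t ∧ e₂ t ∧ e₄ !t ∧ e₅ u) ∧ ¬(e₃ t ∧ e₅ t ∧ e₁ !t ∧ e₂ u) ∧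
    ¬(e₀ t ∧ e₂ t ∧ e₄ !t ∧ e₃ u) ∧ ¬(e₃ t ∧ e₅ t ∧ e₁ !t ∧ e₀ u) ∧
    ¬(e₁ t ∧ e₅ t ∧ e₀ u ∧ e₀ !u) ∧ ¬(e₃ t ∧ e₅ t ∧ e₂ u ∧ e₂ !u) ∧
    ¬(e₀ t ∧ e₂ t ∧ e₃ u ∧ e₃ !u) ∧ ¬(e₂ t ∧ e₄ t ∧ e₁ u ∧ e₁ !u) ∧
    ¬(e₂ t ∧ e₄ t ∧ e₅ u ∧ e₅ !u) ∧ ¬(e₀ t ∧ e₄ t ∧ e₅ u ∧ e₅ !u) ∧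
    ¬(e₂ t ∧ e₁ u ∧ e₄ !t ∧ e₃ !u) ∧ ¬(e₀ t ∧ e₁ u ∧ e₂ !t ∧ e₅ !u) ∧
    ¬(e₀ t ∧ e₃ u ∧ e₄ !t ∧ e₅ !u) ∧ ¬(e₀ t ∧ e₁ u ∧ e₄ !t ∧ e₃ !u) ∧
    ¬(e₀ t ∧ e₁ u ∧ e₂ !t ∧ e₃ !u)

set_option synthInstance.maxSize 2000 in
set_option synthInstance.maxHeartbeats 400000 in
instance (e₀ e₁ e₂ e₃ e₄ e₅ : Bool → Bool) : Decidable (NoCrossing e₀ e₁ e₂ e₃ e₄ e₅) := by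
  unfold NoCrossing
  infer_instance

theorem exists_eq_cond (e : Bool → Bool) : ∃ a b, e = fun t => cond t b a :=
  ⟨e false, e true, by funext t; cases t <;> rfl⟩

theorem sum_le_six_of_noCrossing {e₀ e₁ e₂ e₃ e₄ e₅ : Bool → Bool}
    (h : NoCrossing e₀ e₁ e₂ e₃ e₄ e₅) :
    (e₀ false).toNat + (e₀ true).toNat + ((e₁ false).toNat + (e₁ true).toNat) +
    ((e₂ false).toNat + (e₂ true).toNat) + ((e₃ false).toNat + (e₃ true).toNat) +
    ((e₄ false).toNat + (e₄ true).toNat) + ((e₅ false).toNat + (e₅ true).toNat) ≤ 6 := by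
  obtain ⟨a₀, b₀, rfl⟩ := exists_eq_cond e₀
  obtain ⟨a₁, b₁, rfl⟩ := exists_eq_cond e₁
  obtain ⟨a₂, b₂, rfl⟩ := exists_eq_cond e₂
  obtain ⟨a₃, b₃, rfl⟩ := exists_eq_cond e₃
  obtain ⟨a₄, b₄, rfl⟩ := exists_eq_cond e₄
  obtain ⟨a₅, b₅, rfl⟩ := exists_eq_cond e₅
  refine not_lt.mp fun hlt => absurd h ?_
  clear h
  revert a₀ b₀ a₁ b₁ a₂ b₂ a₃ b₃ a₄ b₄ a₅ b₅
  simp only [cond_true, cond_false]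
  decide +kernel

set_option synthInstance.maxSize 2000 in
/-- Link bound for the inner vertices of a path on seven vertices whose ends are linked to all
corners of their colour class, in the absence of patterns yielding two disjoint cycles. -/
theorem sum_le_three_of_noCrossing : ∀ e₁ e₂ e₃ e₄ e₅ : Bool → Bool,
    (∀ t u : Bool,
      ¬(e₂ t ∧ e₄ !t) ∧ ¬(e₄ t ∧ e₅ u) ∧ ¬(e₂ t ∧ e₁ u) ∧ ¬(e₂ t ∧ e₃ u) ∧ ¬(e₄ t ∧ e₃ u) ∧
      ¬(e₂ t ∧ e₅ u) ∧ ¬(e₄ t ∧ e₁ u) ∧ ¬(e₁ t ∧ e₃ t) ∧ ¬(e₃ t ∧ e₅ t) ∧ ¬(e₁ u ∧ e₅ !u)) →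
    (e₁ false).toNat + (e₁ true).toNat + ((e₂ false).toNat + (e₂ true).toNat) +
    ((e₃ false).toNat + (e₃ true).toNat) + ((e₄ false).toNat + (e₄ true).toNat) +
    ((e₅ false).toNat + (e₅ true).toNat) ≤ 3 := by
  decide +kernel

namespace PathQuad

variable {f : ℕ → V} {n : ℕ} {c : Bool → Bool → V}

/-- The path vertices with index in `I` together with the corners with index in `J`. -/
def region (f : ℕ → V) (c : Bool → Bool → V) (I : Set ℕ) (J : Set (Bool × Bool)) : Set V :=
  f '' I ∪ Function.uncurry c '' J

theorem corner_injective (H : PathQuad G f n c) : Function.Injective (Function.uncurry c) := by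
  rintro ⟨s, t⟩ ⟨s', t'⟩ h
  simp only [Function.uncurry_apply_pair] at h
  by_cases hs : s' = s
  · subst hs
    by_cases ht : t' = t
    · rw [ht]
    · rw [Bool.eq_not_of_ne ht] at h
      exact absurd h (H.corner_ne _ _)
  · rw [Bool.eq_not_of_ne hs] at h
    exact absurd h (H.quad _ _ _).ne

theorem disjoint_region (H : PathQuad G f n c) {I I' : Set ℕ} {J J' : Set (Bool × Bool)}
    (hI : I ⊆ Set.Iio n) (hI' : I' ⊆ Set.Iio n) (hII : Disjoint I I') (hJJ : Disjoint J J') :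
    Disjoint (region f c I J) (region f c I' J') := by
  rw [Set.disjoint_left] at *
  rintro _ (⟨i, hi, rfl⟩ | ⟨a, ha, rfl⟩) (⟨j, hj, h⟩ | ⟨b, hb, h⟩)
  · exact hII hi (H.injOn (hI' hj) (hI hi) h ▸ hj)
  · exact H.off i (hI hi) _ _ h.symm
  · exact H.off j (hI' hj) _ _ h
  · exact hJJ ha (H.corner_injective h ▸ hb)

theorem exists_segment (H : PathQuad G f n c) {i j : ℕ} (hij : i ≤ j) (hj : j < n) :
    ∃ w : G.Walk (f i) (f j), w.IsPath ∧ ∀ x ∈ w.support, x ∈ f '' Set.Icc i j := by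
  induction j, hij using Nat.le_induction with
  | base => exact ⟨.nil, .nil, by simp⟩
  | succ j hij ih =>
    obtain ⟨w, hw, hS⟩ := ih (by omega)
    have hlast : f (j + 1) ∉ w.support := by
      intro h
      obtain ⟨k, hk, hkj⟩ := hS _ h
      have := H.injOn (show k < n by grind) hj hkj
      grind
    refine ⟨w.concat (H.adj j hj), hw.concat hlast _, ?_⟩
    intro x hx
    rw [Walk.support_concat, List.mem_append, List.mem_singleton] at hx
    rcases hx with hx | rfl
    · exact Set.image_mono (Set.Icc_subset_Icc_right (by omega)) (hS x hx)
    · exact ⟨j + 1, by grind, rfl⟩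

theorem corner_notMem_of_segment (H : PathQuad G f n c) {i j : ℕ} (hj : j < n) (s t : Bool) :
    c s t ∉ f '' Set.Icc i j := by
  rintro ⟨k, hk, h⟩
  exact H.off k (by grind) _ _ h

theorem mem_region_of_mem_segment {i j : ℕ} {J : Set (Bool × Bool)} {x : V}
    (hx : x ∈ f '' Set.Icc i j) (hij : i ≤ j) : x ∈ region f c (Set.uIcc i j) J := by
  rw [Set.uIcc_of_le hij]
  exact .inl hx

theorem mem_region_of_mem {I : Set ℕ} {J : Set (Bool × Bool)} {s t : Bool} (h : (s, t) ∈ J) :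
    c s t ∈ region f c I J :=
  .inr ⟨(s, t), h, rfl⟩

/-- Two path vertices adjacent to the same corner close a cycle. -/
theorem hasCycleIn_one (H : PathQuad G f n c) {i j : ℕ} {s t : Bool} (hi : i < n) (hj : j < n)
    (hij : i ≠ j) (hic : G.Adj (f i) (c s t)) (hjc : G.Adj (f j) (c s t)) :
    G.HasCycleIn (region f c (Set.uIcc i j) {(s, t)}) := by
  wlog hle : i ≤ j generalizing i j
  · rw [Set.uIcc_comm]
    exact this hj hi hij.symm hjc hic (by omega)
  obtain ⟨w, hw, hS⟩ := H.exists_segment hle hj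
  exact hasCycleIn_of_isPath w hw (fun y hy => mem_region_of_mem_segment (hS y hy) hle)
    (mem_region_of_mem rfl) (fun h => H.corner_notMem_of_segment hj s t (hS _ h)) hic.symm hjc
    (fun h => hij (H.injOn hi hj h))

/-- Path vertices adjacent to the two ends of an edge of the quadrilateral close a cycle. -/
theorem hasCycleIn_two (H : PathQuad G f n c) {i j : ℕ} {s t u : Bool} (hi : i < n) (hj : j < n)
    (hic : G.Adj (f i) (c s t)) (hjc : G.Adj (f j) (c (!s) u)) :
    G.HasCycleIn (region f c (Set.uIcc i j) {(s, t), (!s, u)}) := by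
  wlog hle : i ≤ j generalizing i j s t u
  · rw [Set.uIcc_comm, Set.pair_comm]
    simpa using this (t := u) (u := t) hj hi hjc (by simpa using hic) (by omega)
  obtain ⟨w, hw, hS⟩ := H.exists_segment hle hj
  have hlast := fun h => H.corner_notMem_of_segment (i := i) hj (!s) u (hS _ h)
  have hfirst := fun h => H.corner_notMem_of_segment (i := i) hj s t (hS _ h)
  refine hasCycleIn_of_isPath (w.concat hjc) (hw.concat hlast _) ?_
    (mem_region_of_mem (s := s) (t := t) (by simp)) ?_ hic.symm (H.quad s t u).symm
    (H.off i hi _ _)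
  · intro y hy
    rw [Walk.support_concat, List.mem_append, List.mem_singleton] at hy
    rcases hy with hy | rfl
    · exact mem_region_of_mem_segment (hS y hy) hle
    · exact mem_region_of_mem (by simp)
  · rw [Walk.support_concat, List.mem_append, List.mem_singleton]
    rintro (h | h)
    · exact hfirst h
    · exact (H.quad s t u).ne h

/-- Path vertices adjacent to two opposite corners close a cycle through a third corner. -/
theorem hasCycleIn_three (H : PathQuad G f n c) {i j : ℕ} {s t u : Bool} (hi : i < n)
    (hj : j < n) (hic : G.Adj (f i) (c s t)) (hjc : G.Adj (f j) (c s (!t))) :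
    G.HasCycleIn (region f c (Set.uIcc i j) {(s, t), (s, !t), (!s, u)}) := by
  wlog hle : i ≤ j generalizing i j t
  · rw [Set.uIcc_comm, Set.insert_comm]
    simpa using this (t := !t) hj hi hjc (by simpa using hic) (by omega)
  obtain ⟨w, hw, hS⟩ := H.exists_segment hle hj
  have hcorner := fun s t h => H.corner_notMem_of_segment (i := i) hj s t (hS _ h)
  have hquad := H.quad s
  have hpath : (Walk.cons hic.symm w).IsPath := hw.cons (hcorner s t)
  have hlast : c s (!t) ∉ (Walk.cons hic.symm w).support := by
    rw [Walk.support_cons, List.mem_cons]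
    rintro (h | h)
    · exact H.corner_ne s t h.symm
    · exact hcorner _ _ h
  refine hasCycleIn_of_isPath ((Walk.cons hic.symm w).concat hjc) (hpath.concat hlast _) ?_
    (mem_region_of_mem (s := !s) (t := u) (by simp)) ?_ (hquad t u).symm (hquad (!t) u)
    (H.corner_ne s t)
  · intro y hy
    rw [Walk.support_concat, Walk.support_cons, List.mem_append,
      List.mem_cons, List.mem_singleton] at hy
    rcases hy with (rfl | hy) | rfl
    · exact mem_region_of_mem (by simp)
    · exact mem_region_of_mem_segment (hS y hy) hle
    · exact mem_region_of_mem (by simp)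
  · rw [Walk.support_concat, Walk.support_cons, List.mem_append,
      List.mem_cons, List.mem_singleton]
    rintro ((h | h) | h)
    · exact (hquad t u).ne h.symm
    · exact hcorner _ _ h
    · exact (hquad (!t) u).ne h.symm


theorem region_mono {I I' : Set ℕ} {J J' : Set (Bool × Bool)} (hI : I ⊆ I') (hJ : J ⊆ J') :
    region f c I J ⊆ region f c I' J' :=
  Set.union_subset_union (Set.image_mono hI) (Set.image_mono hJ)

theorem hasDisjointCyclesIn_of_region (H : PathQuad G f n c) {i j k l : ℕ}
    {J J' : Set (Bool × Bool)}
    (hn : i < n ∧ j < n ∧ k < n ∧ l < n)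
    (hsep : (i < k ∧ i < l ∧ j < k ∧ j < l) ∨ (k < i ∧ l < i ∧ k < j ∧ l < j))
    (hJ : Disjoint J J') (h : G.HasCycleIn (region f c (Set.uIcc i j) J))
    (h' : G.HasCycleIn (region f c (Set.uIcc k l) J')) :
    G.HasDisjointCyclesIn (region f c (Set.Iio n) Set.univ) := by
  have hI : Set.uIcc i j ⊆ Set.Iio n := by
    intro x hx
    rw [Set.mem_uIcc] at hx
    rw [Set.mem_Iio]
    omega
  have hI' : Set.uIcc k l ⊆ Set.Iio n := by
    intro x hx
    rw [Set.mem_uIcc] at hx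
    rw [Set.mem_Iio]
    omega
  refine ⟨_, _, H.disjoint_region hI hI' ?_ hJ, region_mono hI (Set.subset_univ _),
    region_mono hI' (Set.subset_univ _), h, h'⟩
  rw [Set.disjoint_left]
  intro x hx hx'
  rw [Set.mem_uIcc] at hx hx'
  omega

theorem window (H : PathQuad G f n c) {a k : ℕ} (hak : k + a ≤ n) :
    PathQuad G (fun i => f (i + a)) k (fun s => c (xor s (decide (a % 2 = 1)))) where
  injOn i hi j hj hij := by
    have := H.injOn (show i + a < n by grind) (show j + a < n by grind) hij
    omega
  adj i hi := by
    rw [add_right_comm]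
    exact H.adj (i + a) (by omega)
  quad s t u := by
    rw [Bool.not_xor]
    exact H.quad _ t u
  corner_ne s t := H.corner_ne _ t
  off i hi s t := H.off _ (by omega) _ t

variable [DecidableRel G.Adj]

/-- Whether the `i`-th path vertex is adjacent to corner `t` of the colour class
with the parity of `i`. -/
def link (G : SimpleGraph V) [DecidableRel G.Adj] (f : ℕ → V) (c : Bool → Bool → V) (i : ℕ)
    (t : Bool) : Bool :=
  decide (G.Adj (f i) (c (decide (i % 2 = 1)) t))

/-- The number of corners, among those in the colour class with the parity of `i`,
adjacent to the `i`-th path vertex. -/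
def linkCount (G : SimpleGraph V) [DecidableRel G.Adj] (f : ℕ → V) (c : Bool → Bool → V)
    (i : ℕ) : ℕ :=
  (link G f c i false).toNat + (link G f c i true).toNat

theorem adj_of_link {i j : ℕ} {t : Bool} (h : link G f c j t) (hij : i % 2 = j % 2) :
    G.Adj (f j) (c (decide (i % 2 = 1)) t) := by
  rw [hij]
  exact of_decide_eq_true h

theorem adj_of_link_of_ne {i j : ℕ} {t : Bool} (h : link G f c j t) (hij : i % 2 ≠ j % 2) :
    G.Adj (f j) (c (!decide (i % 2 = 1)) t) := by
  have : (!decide (i % 2 = 1)) = decide (j % 2 = 1) := by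
    rw [← decide_not, decide_eq_decide]
    omega
  rw [this]
  exact of_decide_eq_true h

theorem linkCount_le_two (i : ℕ) : linkCount G f c i ≤ 2 :=
  Nat.add_le_add (Bool.toNat_le _) (Bool.toNat_le _)

theorem link_of_two_le {i : ℕ} (h : 2 ≤ linkCount G f c i) (t : Bool) : link G f c i t := by
  have hf := Bool.toNat_le (link G f c i false)
  have ht := Bool.toNat_le (link G f c i true)
  unfold linkCount at h
  cases t <;> exact Bool.toNat_eq_one.mp (by omega)

theorem exists_link {i : ℕ} (h : 1 ≤ linkCount G f c i) : ∃ t, link G f c i t := by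
  by_contra! hno
  simp [linkCount, hno] at h

theorem hasDisjointCyclesIn_of_same_same (H : PathQuad G f n c) {i j k l : ℕ} {t : Bool}
    (hn : i < n ∧ j < n ∧ k < n ∧ l < n)
    (hsep : (i < k ∧ i < l ∧ j < k ∧ j < l) ∨ (k < i ∧ l < i ∧ k < j ∧ l < j))
    (hpar : i % 2 = j % 2 ∧ i % 2 = k % 2 ∧ i % 2 = l % 2 ∧ i ≠ j ∧ k ≠ l)
    (h : link G f c i t ∧ link G f c j t ∧ link G f c k (!t) ∧ link G f c l (!t)) :
    G.HasDisjointCyclesIn (region f c (Set.Iio n) Set.univ) :=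
  H.hasDisjointCyclesIn_of_region hn hsep (by simp)
    (H.hasCycleIn_one hn.1 hn.2.1 hpar.2.2.2.1 (adj_of_link h.1 rfl) (adj_of_link h.2.1 hpar.1))
    (H.hasCycleIn_one hn.2.2.1 hn.2.2.2 hpar.2.2.2.2 (adj_of_link h.2.2.1 hpar.2.1)
      (adj_of_link h.2.2.2 hpar.2.2.1))

theorem hasDisjointCyclesIn_of_same_edge (H : PathQuad G f n c) {i j k l : ℕ} {t u : Bool}
    (hn : i < n ∧ j < n ∧ k < n ∧ l < n)
    (hsep : (i < k ∧ i < l ∧ j < k ∧ j < l) ∨ (k < i ∧ l < i ∧ k < j ∧ l < j))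
    (hpar : i % 2 = j % 2 ∧ i % 2 = k % 2 ∧ i % 2 ≠ l % 2 ∧ i ≠ j)
    (h : link G f c i t ∧ link G f c j t ∧ link G f c k (!t) ∧ link G f c l u) :
    G.HasDisjointCyclesIn (region f c (Set.Iio n) Set.univ) :=
  H.hasDisjointCyclesIn_of_region hn hsep (by simp)
    (H.hasCycleIn_one hn.1 hn.2.1 hpar.2.2.2 (adj_of_link h.1 rfl) (adj_of_link h.2.1 hpar.1))
    (H.hasCycleIn_two hn.2.2.1 hn.2.2.2 (adj_of_link h.2.2.1 hpar.2.1)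
      (adj_of_link_of_ne h.2.2.2 hpar.2.2.1))

theorem hasDisjointCyclesIn_of_same_opposite (H : PathQuad G f n c) {i j k l : ℕ} {t u : Bool}
    (hn : i < n ∧ j < n ∧ k < n ∧ l < n)
    (hsep : (i < k ∧ i < l ∧ j < k ∧ j < l) ∨ (k < i ∧ l < i ∧ k < j ∧ l < j))
    (hpar : i % 2 = j % 2 ∧ i % 2 ≠ k % 2 ∧ i % 2 ≠ l % 2 ∧ i ≠ j)
    (h : link G f c i t ∧ link G f c j t ∧ link G f c k u ∧ link G f c l (!u)) :
    G.HasDisjointCyclesIn (region f c (Set.Iio n) Set.univ) :=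
  H.hasDisjointCyclesIn_of_region (J := {(decide (i % 2 = 1), t)}) hn hsep (by simp)
    (H.hasCycleIn_one hn.1 hn.2.1 hpar.2.2.2 (adj_of_link h.1 rfl) (adj_of_link h.2.1 hpar.1))
    (H.hasCycleIn_three (u := !t) hn.2.2.1 hn.2.2.2 (adj_of_link_of_ne h.2.2.1 hpar.2.1)
      (adj_of_link_of_ne h.2.2.2 hpar.2.2.1))

theorem hasDisjointCyclesIn_of_edge_edge (H : PathQuad G f n c) {i j k l : ℕ} {t u : Bool}
    (hn : i < n ∧ j < n ∧ k < n ∧ l < n)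
    (hsep : (i < k ∧ i < l ∧ j < k ∧ j < l) ∨ (k < i ∧ l < i ∧ k < j ∧ l < j))
    (hpar : i % 2 ≠ j % 2 ∧ i % 2 = k % 2 ∧ i % 2 ≠ l % 2)
    (h : link G f c i t ∧ link G f c j u ∧ link G f c k (!t) ∧ link G f c l (!u)) :
    G.HasDisjointCyclesIn (region f c (Set.Iio n) Set.univ) :=
  H.hasDisjointCyclesIn_of_region hn hsep (by simp)
    (H.hasCycleIn_two hn.1 hn.2.1 (adj_of_link h.1 rfl) (adj_of_link_of_ne h.2.1 hpar.1))
    (H.hasCycleIn_two hn.2.2.1 hn.2.2.2 (adj_of_link h.2.2.1 hpar.2.1)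
      (adj_of_link_of_ne h.2.2.2 hpar.2.2))

theorem linkCount_window (a i : ℕ) :
    linkCount G (fun i => f (i + a)) (fun s => c (xor s (decide (a % 2 = 1)))) i =
      linkCount G f c (i + a) := by
  have : xor (decide (i % 2 = 1)) (decide (a % 2 = 1)) = decide ((i + a) % 2 = 1) := by
    rcases Nat.mod_two_eq_zero_or_one i with hi | hi <;>
      rcases Nat.mod_two_eq_zero_or_one a with ha | ha <;> simp [hi, ha, Nat.add_mod]
  simp only [linkCount, link, this]

theorem region_window_subset {a k : ℕ} (hak : k + a ≤ n) :
    region (fun i => f (i + a)) (fun s => c (xor s (decide (a % 2 = 1)))) (Set.Iio k) Set.univ ⊆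
      region f c (Set.Iio n) Set.univ := by
  rintro _ (⟨i, hi, rfl⟩ | ⟨⟨s, t⟩, -, rfl⟩)
  · exact .inl ⟨i + a, by grind, rfl⟩
  · exact .inr ⟨(_, t), trivial, rfl⟩

theorem hasDisjointCyclesIn_of_six (H : PathQuad G f 6 c)
    (hsum : 7 ≤ ∑ i ∈ Finset.range 6, linkCount G f c i) :
    G.HasDisjointCyclesIn (region f c (Set.Iio 6) Set.univ) := by
  by_contra hD
  have hno : NoCrossing (link G f c 0) (link G f c 1) (link G f c 2) (link G f c 3)
      (link G f c 4) (link G f c 5) := by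
    intro t u
    refine ⟨?_, ?_, ?_, ?_, ?_, ?_, ?_, ?_, ?_, ?_, ?_, ?_, ?_, ?_, ?_, ?_, ?_⟩ <;>
      refine fun h => hD ?_
    iterate 6 exact H.hasDisjointCyclesIn_of_same_edge (by omega) (by omega) (by omega) h
    iterate 6 exact H.hasDisjointCyclesIn_of_same_opposite (by omega) (by omega) (by omega) h
    iterate 5 exact H.hasDisjointCyclesIn_of_edge_edge (by omega) (by omega) (by omega) h
  have := sum_le_six_of_noCrossing hno
  simp only [Finset.sum_range_succ, Finset.sum_range_zero, linkCount] at hsum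
  omega

theorem hasDisjointCyclesIn_of_seven (H : PathQuad G f 7 c)
    (h₀ : ∀ t, link G f c 0 t) (h₆ : ∀ t, link G f c 6 t)
    (hsum : 8 ≤ ∑ i ∈ Finset.range 7, linkCount G f c i) :
    G.HasDisjointCyclesIn (region f c (Set.Iio 7) Set.univ) := by
  by_contra hD
  have hedge {i j k l : ℕ} {t u : Bool} := fun hn hs hp h =>
    hD (H.hasDisjointCyclesIn_of_same_edge (i := i) (j := j) (k := k) (l := l) (t := t) (u := u)
      hn hs hp h)
  have hopp {i j k l : ℕ} {t u : Bool} := fun hn hs hp h =>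
    hD (H.hasDisjointCyclesIn_of_same_opposite (i := i) (j := j) (k := k) (l := l) (t := t)
      (u := u) hn hs hp h)
  have := sum_le_three_of_noCrossing (link G f c 1) (link G f c 2) (link G f c 3)
    (link G f c 4) (link G f c 5) fun t u =>
      ⟨fun h => hD (H.hasDisjointCyclesIn_of_same_same (by omega) (by omega) (by omega)
          ⟨h₀ t, h.1, h.2, h₆ _⟩),
        fun h => hedge (by omega) (by omega) (by omega) ⟨h₀ t, h.1, h₆ _, h.2⟩,
        fun h => hedge (by omega) (by omega) (by omega) ⟨h.1, h₆ t, h₀ _, h.2⟩,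
        fun h => hedge (by omega) (by omega) (by omega) ⟨h₀ t, h.1, h₆ _, h.2⟩,
        fun h => hedge (by omega) (by omega) (by omega) ⟨h.1, h₆ t, h₀ _, h.2⟩,
        fun h => hedge (by omega) (by omega) (by omega) ⟨h₀ t, h.1, h₆ _, h.2⟩,
        fun h => hedge (by omega) (by omega) (by omega) ⟨h.1, h₆ t, h₀ _, h.2⟩,
        fun h => hopp (by omega) (by omega) (by omega) ⟨h.1, h.2, h₆ true, h₆ _⟩,
        fun h => hopp (by omega) (by omega) (by omega) ⟨h.1, h.2, h₀ true, h₀ _⟩,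
        fun h => hD (H.hasDisjointCyclesIn_of_edge_edge (by omega) (by omega) (by omega)
          ⟨h₀ true, h.1, h₆ _, h.2⟩)⟩
  have hle := linkCount_le_two (G := G) (f := f) (c := c)
  simp only [Finset.sum_range_succ, Finset.sum_range_zero] at hsum
  have := hle 0
  have := hle 6
  simp only [linkCount] at *
  omega

theorem hasDisjointCyclesIn_of_lt_sum (H : PathQuad G f n c) (hn : 6 ≤ n)
    (hsum : n < ∑ i ∈ Finset.range n, linkCount G f c i) :
    G.HasDisjointCyclesIn (region f c (Set.Iio n) Set.univ) := by
  induction n using Nat.strong_induction_on generalizing f c with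
  | _ n ih =>
  by_contra hD
  have hwindow (a k : ℕ) (hk : 6 ≤ k) (hkn : k < n) (hak : k + a ≤ n) :
      ∑ i ∈ Finset.range k, linkCount G f c (i + a) ≤ k := by
    by_contra! hlt
    refine hD ((ih k hkn (H.window hak) hk ?_).mono (region_window_subset hak))
    simpa only [linkCount_window] using hlt
  have hle := linkCount_le_two (G := G) (f := f) (c := c)
  rcases hn.eq_or_lt with rfl | hn
  · exact hD (H.hasDisjointCyclesIn_of_six hsum)
  obtain ⟨m, rfl⟩ : ∃ m, n = m + 1 := ⟨n - 1, by omega⟩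
  have hfirst : ∀ t, link G f c 0 t := link_of_two_le (by
    have := hwindow 1 m (by omega) (by omega) le_rfl
    rw [Finset.sum_range_succ'] at hsum
    omega)
  have hlast : ∀ t, link G f c m t := link_of_two_le (by
    have := hwindow 0 m (by omega) (by omega) (by omega)
    rw [Finset.sum_range_succ] at hsum
    simp only [add_zero] at this
    omega)
  rcases (show 6 ≤ m by omega).eq_or_lt with rfl | hm
  · exact hD (H.hasDisjointCyclesIn_of_seven hfirst hlast hsum)
  obtain ⟨k, rfl⟩ : ∃ k, m = k + 1 := ⟨m - 1, by omega⟩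
  obtain ⟨t, ht⟩ : ∃ t, link G f c 1 t := exists_link (by
    have := hwindow 2 k (by omega) (by omega) le_rfl
    rw [Finset.sum_range_succ', Finset.sum_range_succ'] at hsum
    have := hle 0
    simp only [add_assoc, zero_add, Nat.reduceAdd] at *
    omega)
  obtain ⟨u, hu⟩ : ∃ u, link G f c k u := exists_link (by
    have := hwindow 0 k (by omega) (by omega) (by omega)
    rw [Finset.sum_range_succ, Finset.sum_range_succ] at hsum
    have := hle (k + 1)
    simp only [add_zero] at *
    omega)
  rcases Nat.mod_two_eq_zero_or_one k with hk | hk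
  · exact hD (H.hasDisjointCyclesIn_of_edge_edge (i := 0) (j := 1) (k := k) (l := k + 1)
      (by omega) (by omega) (by omega) ⟨hfirst (!u), ht, by simpa using hu, hlast _⟩)
  have hcross (t u : Bool) (ht : link G f c 1 t) (hu : link G f c k u) : u = t := by
    by_contra hne
    rw [Bool.eq_not_of_ne hne] at hu
    exact hD (H.hasDisjointCyclesIn_of_edge_edge (i := 0) (j := 1) (k := k + 1) (l := k)
      (by omega) (by omega) (by omega) ⟨hfirst true, ht, hlast _, hu⟩)
  have hone : linkCount G f c 1 ≤ 1 := by
    by_contra! h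
    have htwo := link_of_two_le h
    exact absurd ((hcross _ u (htwo false) hu).symm.trans (hcross _ u (htwo true) hu)) (by decide)
  obtain ⟨b, hb⟩ : ∃ b, link G f c 2 b := exists_link (by
    obtain ⟨l, rfl⟩ : ∃ l, k = l + 1 := ⟨k - 1, by omega⟩
    have := hwindow 3 l (by omega) (by omega) le_rfl
    rw [Finset.sum_range_succ', Finset.sum_range_succ', Finset.sum_range_succ'] at hsum
    have := hle 0
    simp only [add_assoc, zero_add, Nat.reduceAdd] at *
    omega)
  exact hD (H.hasDisjointCyclesIn_of_same_edge (i := 0) (j := 2) (k := k + 1) (l := k)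
    (by omega) (by omega) (by omega) ⟨hfirst b, hb, hlast _, hu⟩)

end PathQuad

end

theorem SimpleGraph.HasDisjointCyclesIn.exists_walks {V : Type*} {G : SimpleGraph V} {S : Set V}
    (h : G.HasDisjointCyclesIn S) :
    ∃ (u₁ u₂ : V) (c₁ : G.Walk u₁ u₁) (c₂ : G.Walk u₂ u₂), c₁.IsCycle ∧ c₂.IsCycle ∧
      (∀ x ∈ c₁.support, x ∈ S) ∧ (∀ x ∈ c₂.support, x ∈ S) ∧
      List.Disjoint c₁.support c₂.support := by
  obtain ⟨A, B, hAB, hA, hB, ⟨u₁, c₁, hc₁, h₁⟩, u₂, c₂, hc₂, h₂⟩ := h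
  exact ⟨u₁, u₂, c₁, c₂, hc₁, hc₂, fun x hx => hA (h₁ x hx), fun x hx => hB (h₂ x hx),
    fun x hx hx' => Set.disjoint_left.mp hAB (h₁ x hx) (h₂ x hx')⟩

theorem SimpleGraph.Walk.IsCycle.exists_quad {V : Type*} [DecidableEq V] {G : SimpleGraph V}
    {v : V} {c : G.Walk v v} (hc : c.IsCycle) (hlen : c.length = 4) :
    ∃ q : Bool → Bool → V, (∀ s t u, G.Adj (q s t) (q (!s) u)) ∧ (∀ s t, q s t ≠ q s (!t)) ∧
      c.support.toFinset = {q false false, q false true, q true false, q true true} := by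
  match c, hc, hlen with
  | .cons (v := w₁) h₁ (.cons (v := w₂) h₂ (.cons (v := w₃) h₃ (.cons h₄ .nil))), hc, _ =>
    have hnd := hc.support_nodup
    simp only [Walk.support_cons, Walk.support_nil, List.tail_cons, List.nodup_cons,
      List.mem_cons, List.not_mem_nil, or_false, not_or] at hnd
    refine ⟨fun s t => bif s then (bif t then w₃ else w₁) else (bif t then w₂ else v), ?_, ?_, ?_⟩
    · rintro (_ | _) (_ | _) (_ | _) <;> simp [h₁, h₂, h₃, h₄, h₁.symm, h₂.symm, h₃.symm, h₄.symm]
    · rintro (_ | _) (_ | _) <;> simp <;> grind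
    · ext x
      simp only [Walk.support_cons, Walk.support_nil, List.mem_toFinset, List.mem_cons,
        List.not_mem_nil, Finset.mem_insert, Finset.mem_singleton, cond_true, cond_false]
      tauto

/-- Lemma 2(4): a quadrilateral C and a disjoint path P on at least 6 vertices
with e(P, C) ≥ |P| + 1 yield two disjoint cycles inside V(C) ∪ V(P). -/
theorem quad_plus_long_path {V : Type*} [Fintype V] [DecidableEq V]
    (G : SimpleGraph V) [DecidableRel G.Adj]
    (X Y : Finset V)
    (hdisj : Disjoint X Y) (hcover : X ∪ Y = Finset.univ)
    (hbip : ∀ u v : V, G.Adj u v → (u ∈ X ∧ v ∈ Y) ∨ (u ∈ Y ∧ v ∈ X))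
    (v : V) (c : G.Walk v v) (hc : c.IsCycle) (hlen : c.length = 4)
    (p q : V) (P : G.Walk p q) (hP : P.IsPath) (hPlen : 6 ≤ P.support.length)
    (hPC : Disjoint P.support.toFinset c.support.toFinset)
    (he : P.support.length + 1 ≤ ∑ w ∈ P.support.toFinset,
        (c.support.toFinset.filter (fun u => G.Adj w u)).card) :
    ∃ (u₁ u₂ : V) (c₁ : G.Walk u₁ u₁) (c₂ : G.Walk u₂ u₂),
      c₁.IsCycle ∧ c₂.IsCycle ∧
      c₁.support.toFinset ⊆ P.support.toFinset ∪ c.support.toFinset ∧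
      c₂.support.toFinset ⊆ P.support.toFinset ∪ c.support.toFinset ∧
      List.Disjoint c₁.support c₂.support := by
  have hcol (x y : V) (h : G.Adj x y) : decide (x ∈ X) ≠ decide (y ∈ X) := by
    have hXY := Finset.disjoint_left.mp hdisj
    rcases hbip x y h with ⟨hx, hy⟩ | ⟨hx, hy⟩
    · simp [hx, show y ∉ X from fun h => hXY h hy]
    · simp [hy, show x ∉ X from fun h => hXY h hx]
  obtain ⟨r, hquad, hne, hsupp⟩ := hc.exists_quad hlen
  have hr (s t : Bool) : decide (r s t ∈ X) = xor s (decide (r false false ∈ X)) := by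
    have h₁ := hcol _ _ (hquad false false t)
    have h₂ := hcol _ _ (hquad true false t)
    have h₃ := hcol _ _ (hquad true false false)
    cases s <;> grind
  set b : Bool := decide (p ∈ X) == decide (r false false ∈ X) with hb
  set d : Bool → Bool → V := fun s => r (xor s b) with hd
  have hmemC (x : V) : x ∈ c.support.toFinset ↔ ∃ s t, d s t = x := by
    rw [hsupp]
    simp only [hd, Bool.exists_bool, Finset.mem_insert, Finset.mem_singleton, @eq_comm _ _ x]
    generalize b = b'
    cases b' <;> simp only [Bool.xor_false, Bool.xor_true, Bool.not_false, Bool.not_true] <;> tauto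
  have hdcol (s t : Bool) : decide (d s t ∈ X) = !(xor s (decide (p ∈ X))) := by
    rw [hd, hr, hb]
    cases s <;> cases decide (p ∈ X) <;> cases decide (r false false ∈ X) <;> rfl
  have hlenP : P.support.length = P.length + 1 := P.length_support
  have hfcol (i : ℕ) (hi : i < P.length + 1) :
      decide (P.getVert i ∈ X) = xor (decide (i % 2 = 1)) (decide (p ∈ X)) := by
    induction i with
    | zero => simp
    | succ i ih =>
      have h := hcol _ _ (P.adj_getVert_succ (show i < P.length by omega))
      rw [ih (by omega)] at h
      have hpar : decide ((i + 1) % 2 = 1) = !decide (i % 2 = 1) := by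
        rw [← decide_not, decide_eq_decide]
        omega
      rw [hpar, Bool.eq_not_of_ne h.symm, Bool.not_xor]
  have hsuppP : P.support.toFinset = (Finset.range (P.length + 1)).image P.getVert := by
    ext x
    simp only [List.mem_toFinset, Walk.mem_support_iff_exists_getVert, Finset.mem_image,
      Finset.mem_range, Nat.lt_succ_iff]
    tauto
  have hinj : Set.InjOn P.getVert (Set.Iio (P.length + 1)) := fun i hi j hj h =>
    hP.getVert_injOn (Nat.lt_succ_iff.mp hi) (Nat.lt_succ_iff.mp hj) h
  have H : PathQuad G P.getVert (P.length + 1) d :=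
    { injOn := hinj
      adj := fun i hi => P.adj_getVert_succ (by omega)
      quad := fun s t u => by
        simp only [hd, Bool.not_xor]
        exact hquad _ t u
      corner_ne := fun s t => hne _ t
      off := fun i hi s t h => Finset.disjoint_left.mp hPC
        (List.mem_toFinset.mpr (P.getVert_mem_support i)) ((hmemC _).mpr ⟨s, t, h.symm⟩) }
  have hcount (i : ℕ) (hi : i < P.length + 1) :
      (c.support.toFinset.filter (fun u => G.Adj (P.getVert i) u)).card ≤
        PathQuad.linkCount G P.getVert d i := by
    have hsub : c.support.toFinset.filter (fun u => G.Adj (P.getVert i) u) ⊆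
        ({false, true} : Finset Bool).biUnion fun t =>
          if PathQuad.link G P.getVert d i t then {d (decide (i % 2 = 1)) t} else ∅ := by
      intro x hx
      obtain ⟨hx, hadj⟩ := Finset.mem_filter.mp hx
      obtain ⟨s, t, rfl⟩ := (hmemC x).mp hx
      have h := hcol _ _ hadj
      rw [hfcol i hi, hdcol] at h
      obtain rfl : s = decide (i % 2 = 1) := by
        revert h
        cases s <;> cases decide (i % 2 = 1) <;> cases decide (p ∈ X) <;> decide
      exact Finset.mem_biUnion.mpr ⟨t, by cases t <;> simp, by simp [PathQuad.link, hadj]⟩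
    refine (Finset.card_le_card hsub).trans (Finset.card_biUnion_le.trans ?_)
    rw [Finset.sum_pair (by decide), PathQuad.linkCount]
    cases PathQuad.link G P.getVert d i false <;>
      cases PathQuad.link G P.getVert d i true <;> simp
  rw [hsuppP, Finset.sum_image (by simpa using hinj), hlenP] at he
  have hD := H.hasDisjointCyclesIn_of_lt_sum (by omega)
    (he.trans (Finset.sum_le_sum fun i hi => hcount i (Finset.mem_range.mp hi)))
  obtain ⟨u₁, u₂, c₁, c₂, hc₁, hc₂, h₁, h₂, hdis⟩ := hD.exists_walks
  have hsub (x : V) (hx : x ∈ PathQuad.region P.getVert d (Set.Iio (P.length + 1)) Set.univ) :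
      x ∈ P.support.toFinset ∪ c.support.toFinset := by
    rw [Finset.mem_union]
    rcases hx with ⟨i, -, rfl⟩ | ⟨⟨s, t⟩, -, rfl⟩
    · exact .inl (List.mem_toFinset.mpr (P.getVert_mem_support i))
    · exact .inr ((hmemC _).mpr ⟨s, t, rfl⟩)
  exact ⟨u₁, u₂, c₁, c₂, hc₁, hc₂, fun x hx => hsub x (h₁ x (List.mem_toFinset.mp hx)),
    fun x hx => hsub x (h₂ x (List.mem_toFinset.mp hx)), hdis⟩
end

section
/- Let G be a bipartite graph, C a cycle in G, and P a path of even order in G − C with endpoints x and y (in different parts of the bipartition). If the number of edges from {x, y} to C is at least |C|/2 + 1, then the induced subgraph on V(C) ∪ V(P) has a Hamiltonian cycle. -/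
namespace SimpleGraph.Walk

variable {V : Type*} {G : SimpleGraph V}

/-- Deleting a dart from a cycle leaves a path through all vertices of the cycle. -/
theorem IsCycle.exists_isPath_of_mem_darts [DecidableEq V] {v : V} {c : G.Walk v v}
    (hc : c.IsCycle) {d : G.Dart} (hd : d ∈ c.darts) :
    ∃ q : G.Walk d.snd d.fst, q.IsPath ∧ ∀ w, w ∈ q.support ↔ w ∈ c.support := by
  have hu : d.fst ∈ c.support := c.dart_fst_mem_support_of_mem_darts hd
  have hd' : d ∈ (c.rotate d.fst hu).darts := (c.rotate_darts _ hu).mem_iff.2 hd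
  have hc' := hc.rotate hu
  have hs := fun w => c.mem_support_rotate_iff (w := w) d.fst hu
  generalize c.rotate d.fst hu = r at hd' hc' hs
  obtain ⟨⟨a, b⟩, hab⟩ := d
  cases r with
  | nil => simp at hd'
  | cons h q =>
    have hq := ((cons_isCycle_iff _ _).1 hc').1
    rw [darts_cons, List.mem_cons] at hd'
    rcases hd' with hd' | hd'
    · simp only [Dart.mk.injEq, Prod.mk.injEq, true_and] at hd'
      subst hd'
      refine ⟨q, hq, fun w => ?_⟩
      rw [← hs, support_cons, List.mem_cons]
      exact ⟨Or.inr, by rintro (rfl | hw); exacts [q.end_mem_support, hw]⟩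
    · have hmem := List.mem_map_of_mem (f := fun d : G.Dart => d.fst) hd'
      have hnd := hq.support_nodup
      rw [← map_fst_darts_append, List.nodup_append] at hnd
      exact absurd rfl (hnd.2.2 _ hmem _ (List.mem_singleton_self _))

theorem IsCycle.nodup_map_fst_darts {v : V} {c : G.Walk v v} (hc : c.IsCycle) :
    (c.darts.map (·.fst)).Nodup := by
  rw [map_fst_darts]
  exact hc.nodup_dropLast_support

theorem IsCycle.nodup_map_snd_darts {v : V} {c : G.Walk v v} (hc : c.IsCycle) :
    (c.darts.map (·.snd)).Nodup := by
  rw [map_snd_darts]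
  exact hc.support_nodup

theorem IsCycle.mem_map_snd_darts {v w : V} {c : G.Walk v v} (hc : c.IsCycle) :
    w ∈ c.darts.map (·.snd) ↔ w ∈ c.support := by
  rw [map_snd_darts, ← c.cons_tail_support, List.tail_cons, List.mem_cons]
  exact ⟨Or.inr, by rintro (rfl | hw); exacts [end_mem_tail_support hc.not_nil, hw]⟩

theorem IsCycle.mem_map_fst_darts {v w : V} {c : G.Walk v v} (hc : c.IsCycle) :
    w ∈ c.darts.map (·.fst) ↔ w ∈ c.support := by
  rw [map_fst_darts, ← c.tail_support_perm_dropLast_support.mem_iff, ← map_snd_darts,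
    hc.mem_map_snd_darts]

end SimpleGraph.Walk

namespace List

theorem Nodup.card_filter_eq_countP {α β : Type*} [DecidableEq β] {l : List α} {f : α → β}
    (hl : (l.map f).Nodup) {s : Finset β} (hs : ∀ b, b ∈ l.map f ↔ b ∈ s)
    (p : β → Prop) [DecidablePred p] :
    (s.filter p).card = l.countP (fun a => p (f a)) := by
  obtain rfl : (l.map f).toFinset = s := by ext b; rw [mem_toFinset, hs]
  rw [hl.card_eq_countP, countP_map]
  rfl

theorem countP_add_countP_le {α : Type*} {l : List α} {p q r : α → Bool}
    (hp : ∀ a ∈ l, p a → r a) (hq : ∀ a ∈ l, q a → r a) (hpq : ∀ a ∈ l, p a → ¬q a) :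
    l.countP p + l.countP q ≤ l.countP r := by
  induction l with
  | nil => simp
  | cons a l ih =>
    simp only [countP_cons]
    grind

end List

/-- Deleting a dart from a cycle and joining its ends to the ends of a disjoint path gives a
cycle. -/
theorem SimpleGraph.Walk.IsCycle.exists_isCycle_of_adj_ends {V : Type*} [DecidableEq V]
    {G : SimpleGraph V} {v x y : V} {c : G.Walk v v} (hc : c.IsCycle) {P : G.Walk x y}
    (hP : P.IsPath) (hxy : x ≠ y) (hPC : P.support.Disjoint c.support) {d : G.Dart}
    (hd : d ∈ c.darts) (hx : G.Adj x d.fst) (hy : G.Adj y d.snd) :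
    ∃ (u : V) (h : G.Walk u u), h.IsCycle ∧
      h.support.toFinset = c.support.toFinset ∪ P.support.toFinset := by
  obtain ⟨q, hq, hqs⟩ := hc.exists_isPath_of_mem_darts hd
  have hfst := c.dart_fst_mem_support_of_mem_darts hd
  have hxc : x ∉ c.support := hPC P.start_mem_support
  refine ⟨_, .cons hx.symm (P.append (.cons hy q)), ?_, ?_⟩
  · rw [cons_isCycle_iff]
    constructor
    · rw [isPath_def, support_append, support_cons, List.tail_cons]
      exact List.Nodup.append hP.support_nodup hq.support_nodup
        fun w hw hw' => hPC hw ((hqs w).1 hw')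
    · rw [edges_append, edges_cons, List.mem_append, List.mem_cons]
      rintro (h | h | h)
      · exact hPC (P.fst_mem_support_of_mem_edges h) hfst
      · rcases Sym2.eq_iff.1 h with ⟨h, -⟩ | ⟨-, h⟩
        · exact hPC P.end_mem_support (h ▸ hfst)
        · exact hxy h
      · exact hxc ((hqs x).1 (q.snd_mem_support_of_mem_edges h))
  · ext w
    simp only [support_cons, support_append, List.tail_cons, List.mem_toFinset, List.mem_cons,
      List.mem_append, Finset.mem_union, hqs]
    constructor
    · rintro (rfl | h | h)
      exacts [.inl hfst, .inr h, .inl h]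
    · tauto

/-- Lemma 4(1): a cycle C and a disjoint path P of even order with endpoints
x, y in different parts, with e({x,y}, C) ≥ |C|/2 + 1, give a Hamiltonian
cycle of the induced subgraph on V(C) ∪ V(P). -/
theorem cycle_path_hamiltonian {V : Type*} [Fintype V] [DecidableEq V]
    (G : SimpleGraph V) [DecidableRel G.Adj]
    (X Y : Finset V)
    (hdisj : Disjoint X Y) (hcover : X ∪ Y = Finset.univ)
    (hbip : ∀ u v : V, G.Adj u v → (u ∈ X ∧ v ∈ Y) ∨ (u ∈ Y ∧ v ∈ X))
    (v : V) (c : G.Walk v v) (hc : c.IsCycle)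
    (x y : V) (hx : x ∈ X) (hy : y ∈ Y)
    (P : G.Walk x y) (hP : P.IsPath) (hPeven : Even P.support.length)
    (hPC : Disjoint P.support.toFinset c.support.toFinset)
    (he : c.length / 2 + 1 ≤
      (c.support.toFinset.filter (fun u => G.Adj x u)).card +
        (c.support.toFinset.filter (fun u => G.Adj y u)).card) :
    ∃ (u : V) (h : G.Walk u u), h.IsCycle ∧
      h.support.toFinset = c.support.toFinset ∪ P.support.toFinset := by
  have hXY := Finset.disjoint_left.1 hdisj
  have hfst := hc.nodup_map_fst_darts.card_filter_eq_countP
    (s := c.support.toFinset) (by simp [hc.mem_map_fst_darts, -List.mem_map])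
  have hsnd := hc.nodup_map_snd_darts.card_filter_eq_countP
    (s := c.support.toFinset) (by simp [hc.mem_map_snd_darts, -List.mem_map])
  obtain ⟨d, hd, hxd, hyd⟩ : ∃ d ∈ c.darts, G.Adj x d.fst ∧ G.Adj y d.snd := by
    by_contra! hno
    have hle : c.darts.countP (fun d => G.Adj x d.fst) + c.darts.countP (fun d => G.Adj y d.snd)
        ≤ c.darts.countP (fun d => d.snd ∈ X) := by
      refine List.countP_add_countP_le ?_ ?_ ?_ <;> intro d hd
      · have h₁ := hbip x d.fst
        have h₂ := hbip _ _ d.adj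
        grind
      · have h₁ := hbip y d.snd
        grind
      · simpa using hno d hd
    have hhalf : c.darts.countP (fun d => d.fst ∈ X) + c.darts.countP (fun d => d.snd ∈ X)
        ≤ c.darts.countP (fun _ => true) := by
      refine List.countP_add_countP_le (by simp) (by simp) fun d _ => ?_
      have h := hbip _ _ d.adj
      grind
    rw [List.countP_true, SimpleGraph.Walk.length_darts, ← hfst (· ∈ X), ← hsnd (· ∈ X)] at hhalf
    rw [← hfst, ← hsnd, ← hsnd (· ∈ X)] at hle
    have := he.trans hle
    omega
  refine hc.exists_isCycle_of_adj_ends hP (fun h => hXY hx (h ▸ hy)) ?_ hd hxd hyd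
  exact List.disjoint_toFinset_iff_disjoint.1 hPC
end

section
/- Let P be a path on an even number |P| ≥ 4 of vertices in a bipartite graph G, with endpoints x and y. If d_P(x) + d_P(y) ≥ |P|/2 + 1 (degrees counted within the induced subgraph on V(P)), then the induced subgraph G[V(P)] has a Hamiltonian cycle. -/
namespace SimpleGraph.Walk

variable {V : Type*} {G : SimpleGraph V} {x y : V}

/-- If the start `x` of a path is adjacent to its `k + 1`-st vertex and its end `y` to its `k`-th
vertex, then crossing over between the two yields a cycle on the vertices of the path. -/
theorem IsPath.exists_isCycle_of_adj_getVert {P : G.Walk x y} (hP : P.IsPath)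
    (hlen : 2 ≤ P.length) {k : ℕ} (hk : k < P.length)
    (hx : G.Adj x (P.getVert (k + 1))) (hy : G.Adj y (P.getVert k)) :
    ∃ c : G.Walk x x, c.IsCycle ∧ ∀ v, v ∈ c.support ↔ v ∈ P.support := by
  set Q : G.Walk (P.getVert (k + 1)) x :=
    (P.drop (k + 1)).append (cons hy (P.take k).reverse) with hQ
  have hperm : Q.support.Perm P.support := by
    have hs : Q.support = P.support.drop (k + 1) ++ (P.support.take (k + 1)).reverse := by
      rw [hQ, support_append, support_cons, List.tail_cons, support_reverse, support_take,
        drop_support_eq_support_drop_min, min_eq_left hk]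
    rw [hs]
    refine ((List.reverse_perm _).append_left _).trans (List.perm_append_comm.trans ?_)
    rw [List.take_append_drop]
  have hQlen : Q.length = P.length := by
    simpa using hperm.length_eq
  have hQpath : Q.IsPath := IsPath.mk' (hperm.nodup_iff.2 hP.support_nodup)
  refine ⟨cons hx Q, (cons_isCycle_iff Q hx).2 ⟨hQpath, fun he ↦ ?_⟩, fun v ↦ ?_⟩
  · have := hQpath.length_eq_one_of_mem_edges (Sym2.eq_swap ▸ he)
    omega
  · rw [support_cons, List.mem_cons, hperm.mem_iff]
    exact or_iff_right_of_imp fun h ↦ h ▸ P.start_mem_support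

/-- Along a walk, a set that every edge enters or leaves is met at alternate vertices. -/
theorem getVert_mem_iff_even {S : Set V} (hS : ∀ u v, G.Adj u v → (v ∈ S ↔ u ∉ S))
    (P : G.Walk x y) {i : ℕ} (hi : i ≤ P.length) :
    P.getVert i ∈ S ↔ (Even i ↔ x ∈ S) := by
  induction i with
  | zero => simp
  | succ i ih =>
    rw [hS _ _ (P.adj_getVert_succ hi), ih (by omega), Nat.even_add_one]
    tauto

end SimpleGraph.Walk

/-- Two subsets of `range m` with more than `m` elements in total intersect. -/
theorem Finset.exists_mem_of_lt_card_add_card {m : ℕ} {A B : Finset ℕ}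
    (hA : A ⊆ Finset.range m) (hB : B ⊆ Finset.range m) (h : m < A.card + B.card) :
    ∃ i ∈ A, i ∈ B := by
  have hU := Finset.card_le_card (Finset.union_subset hA hB)
  rw [Finset.card_range] at hU
  have hI := Finset.card_union_add_card_inter A B
  obtain ⟨i, hi⟩ := Finset.card_pos.1 (show 0 < (A ∩ B).card by omega)
  exact ⟨i, Finset.mem_inter.1 hi⟩


/-- Lemma 4(2): a path P on an even number |P| ≥ 4 of vertices whose two
endpoints x, y satisfy d_P(x) + d_P(y) ≥ |P|/2 + 1 (degrees in G[V(P)]) spans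
a Hamiltonian cycle, i.e. G[V(P)] is hamiltonian. -/
theorem path_hamiltonian {V : Type*} [Fintype V] [DecidableEq V]
    (G : SimpleGraph V) [DecidableRel G.Adj]
    (X Y : Finset V)
    (hdisj : Disjoint X Y) (hcover : X ∪ Y = Finset.univ)
    (hbip : ∀ u v : V, G.Adj u v → (u ∈ X ∧ v ∈ Y) ∨ (u ∈ Y ∧ v ∈ X))
    (x y : V) (P : G.Walk x y) (hP : P.IsPath)
    (hPeven : Even P.support.length) (hPlen : 4 ≤ P.support.length)
    (he : P.support.length / 2 + 1 ≤
      (P.support.toFinset.filter (fun u => G.Adj x u)).card +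
        (P.support.toFinset.filter (fun u => G.Adj y u)).card) :
    ∃ (u : V) (h : G.Walk u u), h.IsCycle ∧
      h.support.toFinset = P.support.toFinset := by
  obtain ⟨m, hm⟩ := hPeven
  have hlen : P.length + 1 = m + m := by rw [← hm, SimpleGraph.Walk.length_support]
  have hX : ∀ u v, G.Adj u v → (v ∈ (X : Set V) ↔ u ∉ (X : Set V)) := by
    intro u v huv
    have hu : u ∈ X → u ∉ Y := fun h ↦ Finset.disjoint_left.1 hdisj h
    have hv : v ∈ X → v ∉ Y := fun h ↦ Finset.disjoint_left.1 hdisj h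
    have := hbip u v huv
    simp only [Finset.mem_coe]
    tauto
  have hpar := fun {i : ℕ} (hi : i ≤ P.length) ↦ P.getVert_mem_iff_even hX hi
  set A := (Finset.range m).filter fun i ↦ G.Adj x (P.getVert (2 * i + 1)) with hA
  set B := (Finset.range m).filter fun i ↦ G.Adj y (P.getVert (2 * i)) with hB
  have hxA : (P.support.toFinset.filter (fun u => G.Adj x u)).card ≤ A.card := by
    refine (Finset.card_le_card fun u hu ↦ ?_).trans
      (Finset.card_image_le (s := A) (f := fun i ↦ P.getVert (2 * i + 1)))
    rw [Finset.mem_filter, List.mem_toFinset, SimpleGraph.Walk.mem_support_iff_exists_getVert] at hu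
    obtain ⟨⟨n, rfl, hn⟩, hxn⟩ := hu
    have hodd : ¬ Even n := by
      have h1 := hX _ _ hxn
      rw [hpar hn] at h1
      tauto
    obtain ⟨i, rfl⟩ := Nat.not_even_iff_odd.1 hodd
    exact Finset.mem_image.2
      ⟨i, Finset.mem_filter.2 ⟨Finset.mem_range.2 (by omega), hxn⟩, rfl⟩
  have hyB : (P.support.toFinset.filter (fun u => G.Adj y u)).card ≤ B.card := by
    refine (Finset.card_le_card fun u hu ↦ ?_).trans
      (Finset.card_image_le (s := B) (f := fun i ↦ P.getVert (2 * i)))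
    rw [Finset.mem_filter, List.mem_toFinset, SimpleGraph.Walk.mem_support_iff_exists_getVert] at hu
    obtain ⟨⟨n, rfl, hn⟩, hyn⟩ := hu
    have heven : Even n := by
      have h1 := hX _ _ hyn
      have h2 := hpar le_rfl
      have h3 : ¬ Even P.length := by
        rw [← Nat.even_add_one, hlen]
        exact ⟨m, rfl⟩
      rw [P.getVert_length] at h2
      rw [hpar hn] at h1
      tauto
    obtain ⟨i, rfl⟩ := even_iff_exists_two_mul.1 heven
    exact Finset.mem_image.2
      ⟨i, Finset.mem_filter.2 ⟨Finset.mem_range.2 (by omega), hyn⟩, rfl⟩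
  obtain ⟨i, hiA, hiB⟩ := Finset.exists_mem_of_lt_card_add_card (A := A) (B := B)
    (Finset.filter_subset _ _) (Finset.filter_subset _ _) (by omega)
  rw [hA, Finset.mem_filter, Finset.mem_range] at hiA
  obtain ⟨c, hc, hsupp⟩ := hP.exists_isCycle_of_adj_getVert (by omega)
    (k := 2 * i) (by omega) hiA.2 (Finset.mem_filter.1 hiB).2
  exact ⟨x, c, hc, by ext v; simp [hsupp]⟩
end

section
/- Let G be a balanced bipartite graph of order 2n with S ⊆ X, and suppose every nonadjacent pair x ∈ S, y ∈ Y satisfies d(x) + d(y) ≥ n+1. Let {C_1, …, C_k} be k disjoint feasible cycles forming a minimal S system of G (minimizing first total length, then total number of S-vertices covered). If G − (C_1 ∪ ⋯ ∪ C_k) is nonempty, then |S ∩ V(C_i)| = 2 for every i. -/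
/-- The four edges which turn an arc of virtual positions `i..i+a` and an arc `j..j+b`, together
with the arcs `i2..i2+a2` and `j2..j2+b2`, into two cycles. The flags say whether an arc is
reversed. -/
structure Exchange where
  i : ℕ
  a : ℕ
  i2 : ℕ
  a2 : ℕ
  j : ℕ
  b : ℕ
  j2 : ℕ
  b2 : ℕ
  o : Bool
  o2 : Bool

namespace Exchange

/-- The index of the edge between virtual position `i` and position `j` of a word of length `N`. -/
def edgeIndex (N i j : ℕ) : ℕ := 3 * (j % N) + i % 6 / 2

def ends (t : Exchange) : List (ℕ × ℕ) :=
  [(t.i, bif t.o then t.j + t.b else t.j), (t.i + t.a, bif t.o then t.j else t.j + t.b),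
    (t.i2, bif t.o2 then t.j2 + t.b2 else t.j2), (t.i2 + t.a2, bif t.o2 then t.j2 else t.j2 + t.b2)]

def edges (N : ℕ) (t : Exchange) : List ℕ := t.ends.map fun e => edgeIndex N e.1 e.2

/-- The images of an exchange under the rotations and reflections of the six virtual positions. -/
def images (t : Exchange) : List Exchange :=
  [0, 2, 4].map (fun s => { t with i := t.i + s, i2 := t.i2 + s }) ++
    [0, 2, 4].map (fun s => { t with
      i := 12 - t.i - t.a + s, i2 := 18 - t.i2 - t.a2 + s, o := !t.o, o2 := !t.o2 })

/-- Both new cycles exist, contain two marked positions each, and together miss a position. -/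
def valid (N : ℕ) (marks : List ℕ) (t : Exchange) : Bool :=
  decide (t.i + t.a < t.i2) && decide (t.i2 + t.a2 < t.i + 6) &&
  decide (t.j + t.b < t.j2) && decide (t.j2 + t.b2 < t.j + N) &&
  decide (2 ≤ t.a + t.b) && decide (2 ≤ t.a2 + t.b2) &&
  (t.ends.all fun e => (e.1 + e.2) % 2 == 1) &&
  decide (2 ≤ (List.range' t.i (t.a + 1)).countP (· % 2 == 0) +
    (List.range' t.j (t.b + 1)).countP (fun x => marks.contains (x % N))) &&
  decide (2 ≤ (List.range' t.i2 (t.a2 + 1)).countP (· % 2 == 0) +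
    (List.range' t.j2 (t.b2 + 1)).countP (fun x => marks.contains (x % N))) &&
  (decide (t.i + t.a + 1 < t.i2) || decide (t.i2 + t.a2 + 1 < t.i + 6) ||
    decide (t.j + t.b + 1 < t.j2) || decide (t.j2 + t.b2 + 1 < t.j + N))

end Exchange

/-- Bit `b` of `m` is `x`; written with the functions the kernel evaluates quickly. -/
def bitEq (m b x : ℕ) : Bool := Nat.beq (Nat.land (Nat.shiftRight m b) 1) x

/-- Try to switch off each variable of the list in turn, keeping the earlier ones switched on. -/
def splitOn (f : ℕ → ℕ → Bool) (off : ℕ) : List ℕ → ℕ → Bool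
  | [], _ => true
  | b :: l, on => (bitEq on b 1 || f (Nat.lor off (Nat.pow 2 b)) on) &&
      splitOn f off l (Nat.lor on (Nat.pow 2 b))

/-- Search for an assignment in which no list of `conf` is entirely on and the
lower bounds of `cons` on the number of variables that are on hold; `true` if there is none. -/
def refute (cons : List (List ℕ × ℕ)) (conf : List (List ℕ × ℕ)) : ℕ → ℕ → ℕ → Bool
  | 0, _, _ => false
  | fuel + 1, off, on =>
    (cons.any fun c => Nat.blt (c.1.countP fun b => bitEq off b 0) c.2) ||
    match conf.find? (fun c => Nat.beq (Nat.land off c.2) 0) with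
    | none => false
    | some c => splitOn (refute cons conf fuel) off c.1 on

theorem bitEq_one {m b : ℕ} : bitEq m b 1 = true ↔ m.testBit b = true := by
  have : Nat.land (Nat.shiftRight m b) 1 = m >>> b % 2 := Nat.and_one_is_mod _
  rw [bitEq, this, Nat.beq_eq, Nat.testBit_eq_decide_div_mod_eq, Nat.shiftRight_eq_div_pow]
  simp

theorem bitEq_zero {m b : ℕ} : bitEq m b 0 = true ↔ ¬ m.testBit b = true := by
  have : Nat.land (Nat.shiftRight m b) 1 = m >>> b % 2 := Nat.and_one_is_mod _
  rw [bitEq, this, Nat.beq_eq, Nat.testBit_eq_decide_div_mod_eq, Nat.shiftRight_eq_div_pow]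
  simp

theorem testBit_lor_two_pow {m b x : ℕ} :
    (Nat.lor m (Nat.pow 2 b)).testBit x = true ↔ m.testBit x = true ∨ b = x := by
  change (m ||| 2 ^ b).testBit x = true ↔ _
  simp [Nat.testBit_or, Nat.testBit_two_pow]

theorem splitOn_sound {f : ℕ → ℕ → Bool} {A : ℕ → Bool} {off : ℕ}
    (hoff : ∀ b, off.testBit b = true → A b = false)
    (hf : ∀ off on, f off on = true → (∀ b, off.testBit b = true → A b = false) →
      ¬ ∀ b, on.testBit b = true → A b = true)
    (l : List ℕ) (on : ℕ) (h : splitOn f off l on = true)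
    (hon : ∀ b, on.testBit b = true → A b = true) : ∀ b ∈ l, A b = true := by
  induction l generalizing on with
  | nil => simp
  | cons b l ih =>
    simp only [splitOn, Bool.and_eq_true, Bool.or_eq_true, bitEq_one] at h
    have hb : A b = true := by
      rcases h.1 with h1 | h1
      · exact hon b h1
      · by_contra hb
        refine hf _ _ h1 (fun x hx => ?_) hon
        rcases testBit_lor_two_pow.1 hx with hx | rfl
        · exact hoff x hx
        · simpa using hb
    have := ih _ h.2 fun x hx => by
      rcases testBit_lor_two_pow.1 hx with hx | rfl
      · exact hon x hx
      · exact hb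
    simpa [hb] using this

theorem refute_sound {cons : List (List ℕ × ℕ)} {conf : List (List ℕ × ℕ)} {A : ℕ → Bool}
    (hcons : ∀ c ∈ cons, c.2 ≤ c.1.countP A) (hconf : ∀ c ∈ conf, ¬ ∀ b ∈ c.1, A b = true)
    (fuel off on : ℕ) (h : refute cons conf fuel off on = true)
    (hoff : ∀ b, off.testBit b = true → A b = false) :
    ¬ ∀ b, on.testBit b = true → A b = true := by
  intro hon
  induction fuel generalizing off on with
  | zero => simp [refute] at h
  | succ fuel ih =>
    simp only [refute, Bool.or_eq_true, List.any_eq_true, Nat.blt_eq] at h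
    rcases h with ⟨c, hc, hlt⟩ | h
    · refine absurd (hcons c hc) (not_le.2 (lt_of_le_of_lt (List.countP_mono_left ?_) hlt))
      intro b _ hb
      rw [bitEq_zero]
      intro hb'
      simp [hoff b hb'] at hb
    · split at h
      · simp at h
      · rename_i c hc
        exact hconf c (List.mem_of_find?_eq_some hc)
          (splitOn_sound hoff (fun off on h hoff hon => ih off on h hoff hon) c.1 on h hon)

/-- No word of length `N` with the given marked positions, at least `tot` edges to the six
virtual positions, and at least four edges from `j, j+1` for each `j` in `pairs`, avoids all
the exchanges. -/
def wordCheck (N : ℕ) (marks : List ℕ) (tot : ℕ) (pairs : List ℕ) (ts : List Exchange) : Bool :=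
  ts.all (Exchange.valid N marks) &&
  refute ((List.range (3 * N), tot) :: pairs.map fun j => (List.range' (3 * j) 6, 4))
    (ts.map fun t =>
      (t.edges N, (t.edges N).foldr (fun b m => Nat.lor (Nat.pow 2 b) m) 0)) 40 0 0

def exchangesApAp : List Exchange :=
  [⟨0,2,3,2,3,0,6,0,false,false⟩, ⟨0,1,2,2,0,1,3,0,true,false⟩, ⟨0,1,3,2,2,1,4,0,true,false⟩,
   ⟨0,1,2,2,2,1,5,0,true,false⟩, ⟨0,1,4,1,0,1,2,1,true,true⟩, ⟨0,1,2,1,0,1,2,1,true,true⟩,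
   ⟨0,0,1,2,1,2,4,0,false,false⟩, ⟨0,1,3,2,3,1,6,0,false,false⟩, ⟨0,2,3,0,1,0,2,2,false,false⟩,
   ⟨0,1,3,2,1,1,4,0,false,false⟩]

def exchangesApApcp : List Exchange :=
  [⟨0,2,3,0,3,0,4,4,false,false⟩, ⟨0,1,2,2,5,1,9,0,false,false⟩, ⟨0,2,3,0,5,0,6,4,false,false⟩,
   ⟨0,1,2,3,2,1,4,1,true,true⟩, ⟨0,0,1,3,5,2,9,1,false,true⟩, ⟨0,1,3,1,2,1,4,3,true,false⟩,
   ⟨0,1,3,2,5,1,8,2,false,true⟩, ⟨0,0,1,3,1,2,5,1,false,true⟩, ⟨0,0,1,2,3,4,8,0,false,false⟩,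
   ⟨0,0,1,2,1,2,6,0,false,false⟩, ⟨0,2,3,2,1,2,6,0,false,false⟩, ⟨0,2,3,2,1,0,4,2,false,false⟩,
   ⟨0,1,4,1,1,1,5,1,false,false⟩]

def exchangesApcpApcp : List Exchange :=
  [⟨0,1,2,2,5,5,11,0,false,false⟩, ⟨0,0,1,2,3,2,6,4,false,false⟩, ⟨0,1,3,1,2,3,6,3,true,false⟩,
   ⟨0,1,2,3,3,3,9,1,false,false⟩, ⟨0,2,3,2,7,0,10,4,false,false⟩]

def exchangesApApcpcp : List Exchange :=
  [⟨0,0,1,4,7,4,12,0,false,false⟩, ⟨0,0,1,3,7,4,12,1,false,false⟩, ⟨0,0,1,3,7,4,13,1,false,true⟩,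
   ⟨0,1,2,2,2,1,5,2,true,false⟩, ⟨0,1,2,2,7,1,11,0,false,false⟩, ⟨0,1,2,3,2,1,4,3,true,true⟩,
   ⟨0,1,2,3,7,1,11,1,false,false⟩, ⟨0,1,2,2,1,3,7,0,false,false⟩, ⟨0,0,1,3,7,2,11,3,false,true⟩,
   ⟨0,1,3,2,2,1,4,4,true,true⟩, ⟨0,1,2,3,6,3,11,1,true,false⟩, ⟨0,1,2,2,2,1,5,2,true,true⟩,
   ⟨0,1,2,2,7,1,11,2,false,true⟩, ⟨0,0,1,4,1,2,4,0,false,false⟩, ⟨0,2,3,0,3,2,6,4,false,false⟩,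
   ⟨0,1,2,3,5,3,11,1,false,false⟩]

def exchangesApApcpcpcp : List Exchange :=
  [⟨0,0,1,3,7,6,14,1,false,false⟩, ⟨0,0,1,4,7,6,16,0,false,false⟩, ⟨0,1,2,3,8,5,16,1,true,true⟩,
   ⟨0,2,5,0,5,2,8,6,false,false⟩]

theorem wordCheck_ApAp :
    wordCheck 4 [0, 2] 7 [] (exchangesApAp.flatMap Exchange.images) = true := by
  decide +kernel

theorem wordCheck_ApApcp :
    wordCheck 6 [0, 2] 10 [3, 4] (exchangesApApcp.flatMap Exchange.images) = true := by
  decide +kernel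

theorem wordCheck_ApcpApcp :
    wordCheck 8 [0, 4] 0 [1, 2, 5, 6] (exchangesApcpApcp.flatMap Exchange.images) = true := by
  decide +kernel

theorem wordCheck_ApApcpcp :
    wordCheck 8 [0, 2] 13 [3, 4, 5, 6] (exchangesApApcpcp.flatMap Exchange.images) = true := by
  decide +kernel

theorem wordCheck_ApApcpcpcp :
    wordCheck 10 [0, 2] 0 [3, 4, 5, 6, 7, 8]
      (exchangesApApcpcpcp.flatMap Exchange.images) = true := by
  decide +kernel

/-- Adjacency `P k t` between six virtual positions `k` on one cycle and the positions `t` on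
another cycle of length `L` with marked positions `M`, when no two disjoint pairs of arcs can be
exchanged for two shorter cycles. -/
structure Unexchangeable (P : ℕ → ℕ → Bool) (M : ℕ → Bool) (L : ℕ) : Prop where
  even : Even L
  parity : ∀ k t, P k t = true → (k + t) % 2 = 1
  add_six : ∀ k t, P (k + 6) t = P k t
  add_length : ∀ k t, P k (t + L) = P k t
  mark_add_length : ∀ t, M (t + L) = M t
  no_exchange : ∀ i a i2 a2 s s' s2 s2' : ℕ, ∀ o o2 : Bool, i + a < i2 → i2 + a2 < i + 6 →
    s ≤ s' → s' < s2 → s2 ≤ s2' → s2' < s + L →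
    2 ≤ ((Finset.Icc i (i + a)).filter fun x => (x % 2 == 0) = true).card +
      ((Finset.Icc s s').filter fun x => M x = true).card →
    2 ≤ ((Finset.Icc i2 (i2 + a2)).filter fun x => (x % 2 == 0) = true).card +
      ((Finset.Icc s2 s2').filter fun x => M x = true).card →
    2 ≤ a + (s' - s) → 2 ≤ a2 + (s2' - s2) →
    (i + a + 1 < i2 ∨ i2 + a2 + 1 < i + 6 ∨ s' + 1 < s2 ∨ s2' + 1 < s + L) →
    P i (bif o then s' else s) = true → P (i + a) (bif o then s else s') = true →
    P i2 (bif o2 then s2' else s2) = true → P (i2 + a2) (bif o2 then s2 else s2') = true → False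

theorem countP_range'_le_card_filter {W : ℕ → ℕ} (hW : StrictMono W) {q M : ℕ → Bool}
    (h : ∀ x, q x = true → M (W x) = true) (j b : ℕ) :
    (List.range' j (b + 1)).countP q ≤
      ((Finset.Icc (W j) (W (j + b))).filter fun x => M x = true).card := by
  rw [List.countP_eq_length_filter,
    ← List.toFinset_card_of_nodup ((List.nodup_range' (step := 1)).filter _)]
  refine Finset.card_le_card_of_injOn W (fun x hx => ?_) hW.injective.injOn
  simp only [List.coe_toFinset, List.mem_filter, List.mem_range'_1, Set.mem_ofPred_eq] at hx
  simp only [Finset.coe_filter, Finset.mem_Icc, Set.mem_ofPred_eq]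
  exact ⟨⟨hW.monotone (by omega), hW.monotone (by omega)⟩, h x hx.2⟩

namespace Unexchangeable

variable {P : ℕ → ℕ → Bool} {M : ℕ → Bool} {L : ℕ}

/-- The number of virtual positions adjacent to position `t`. -/
def deg (P : ℕ → ℕ → Bool) (t : ℕ) : ℕ := (List.range 6).countP fun k => P k t

/-- The edge with the given index, for a word placed at the positions `W`. -/
def edgeVal (P : ℕ → ℕ → Bool) (W : ℕ → ℕ) (b : ℕ) : Bool :=
  P (2 * (b % 3) + 1 - b / 3 % 2) (W (b / 3))

theorem deg_add_length (h : Unexchangeable P M L) (t : ℕ) : deg P (t + L) = deg P t := by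
  simp [deg, h.add_length]

theorem false_of_parity (h : Unexchangeable P M L) {k t : ℕ} (hkt : (k + t) % 2 = 0) :
    P k t = false := by
  by_contra hc
  have := h.parity k t (by simpa using hc)
  omega

theorem countP_edgeVal (h : Unexchangeable P M L) {W : ℕ → ℕ}
    (hpar : ∀ j, W j % 2 = j % 2) (j : ℕ) :
    (List.range' (3 * j) 3).countP (edgeVal P W) = deg P (W j) := by
  have e0 : 3 * j / 3 = j := by omega
  have e1 : (3 * j + 1) / 3 = j := by omega
  have e2 : (3 * j + 1 + 1) / 3 = j := by omega
  have m0 : 3 * j % 3 = 0 := by omega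
  have m1 : (3 * j + 1) % 3 = 1 := by omega
  have m2 : (3 * j + 1 + 1) % 3 = 2 := by omega
  rcases Nat.mod_two_eq_zero_or_one j with ht | ht
  · have h0 := h.false_of_parity (k := 0) (t := W j) (by have := hpar j; omega)
    have h2 := h.false_of_parity (k := 2) (t := W j) (by have := hpar j; omega)
    have h4 := h.false_of_parity (k := 4) (t := W j) (by have := hpar j; omega)
    simp [deg, List.range, List.range.loop, List.countP_cons, List.range', edgeVal, e0, e1, e2,
      m0, m1, m2, h0, h2, h4, ht]
  · have h0 := h.false_of_parity (k := 1) (t := W j) (by have := hpar j; omega)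
    have h2 := h.false_of_parity (k := 3) (t := W j) (by have := hpar j; omega)
    have h4 := h.false_of_parity (k := 5) (t := W j) (by have := hpar j; omega)
    simp [deg, List.range, List.range.loop, List.countP_cons, List.range', edgeVal, e0, e1, e2,
      m0, m1, m2, h0, h2, h4, ht]

theorem countP_range_edgeVal (h : Unexchangeable P M L) {W : ℕ → ℕ}
    (hpar : ∀ j, W j % 2 = j % 2) (N : ℕ) :
    (List.range (3 * N)).countP (edgeVal P W) = ∑ j ∈ Finset.range N, deg P (W j) := by
  induction N with
  | zero => simp
  | succ N ih =>
    rw [Finset.sum_range_succ, ← ih, ← h.countP_edgeVal hpar N, List.range_eq_range',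
      List.range_eq_range', ← List.countP_append, show 3 * (N + 1) = 3 * N + 3 by ring,
      ← List.range'_append_1, zero_add]

theorem edgeVal_edgeIndex (h : Unexchangeable P M L) {W : ℕ → ℕ} {N : ℕ} (hN : Even N)
    (hper : ∀ j, W (j + N) = W j + L) {i j : ℕ} (hij : (i + j) % 2 = 1) :
    edgeVal P W (Exchange.edgeIndex N i j) = P i (W j) := by
  have h1 : Exchange.edgeIndex N i j / 3 = j % N := by unfold Exchange.edgeIndex; omega
  have h2 : Exchange.edgeIndex N i j % 3 = i % 6 / 2 := by unfold Exchange.edgeIndex; omega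
  have h3 : j % N % 2 = j % 2 := Nat.mod_mod_of_dvd _ hN.two_dvd
  rw [edgeVal, h1, h2, h3, show 2 * (i % 6 / 2) + 1 - j % 2 = i % 6 by omega,
    Function.Periodic.map_mod_nat (f := fun j => P (i % 6) (W j)) (fun j => by
      simp only [hper, h.add_length])]
  exact Function.Periodic.map_mod_nat (f := fun i => P i (W j)) (fun k => h.add_six k _) i

theorem false_of_wordCheck (h : Unexchangeable P M L) {W : ℕ → ℕ} (hW : StrictMono W)
    (hpar : ∀ j, W j % 2 = j % 2) {N : ℕ} (hN : Even N)
    (hper : ∀ j, W (j + N) = W j + L) {marks : List ℕ} (hmarks : ∀ j ∈ marks, M (W j) = true)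
    {tot : ℕ} (htot : tot ≤ ∑ j ∈ Finset.range N, deg P (W j)) {pairs : List ℕ}
    (hpairs : ∀ j ∈ pairs, 4 ≤ deg P (W j) + deg P (W (j + 1))) {ts : List Exchange}
    (hcheck : wordCheck N marks tot pairs ts = true) : False := by
  rw [wordCheck, Bool.and_eq_true] at hcheck
  refine refute_sound (A := edgeVal P W) ?_ ?_ _ _ _ hcheck.2 (by simp) (by simp)
  · intro c hc
    rcases List.mem_cons.1 hc with rfl | hc
    · rwa [h.countP_range_edgeVal hpar]
    · obtain ⟨j, hj, rfl⟩ := List.mem_map.1 hc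
      simp only
      rw [← List.range'_append_1 (s := 3 * j) (m := 3) (n := 3), List.countP_append,
        h.countP_edgeVal hpar, show 3 * j + 3 = 3 * (j + 1) by ring, h.countP_edgeVal hpar]
      exact hpairs j hj
  · intro c hc hall
    obtain ⟨t, ht, rfl⟩ := List.mem_map.1 hc
    have hv := List.all_eq_true.1 hcheck.1 t ht
    have hmark : ∀ x, marks.contains (x % N) = true → M (W x) = true := by
      intro x hx
      have h1 : M (W (x % N)) = M (W x) :=
        Function.Periodic.map_mod_nat (f := fun x => M (W x)) (fun k => by
          simp only [hper, h.mark_add_length]) x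
      rw [← h1]
      exact hmarks _ (by simpa using hx)
    simp only [Exchange.valid, Bool.and_eq_true, Bool.or_eq_true, decide_eq_true_eq,
      List.all_eq_true] at hv
    obtain ⟨⟨⟨⟨⟨⟨⟨⟨⟨v1, v2⟩, v3⟩, v4⟩, v5⟩, v6⟩, v7⟩, v8⟩, v9⟩, v10⟩ := hv
    have hadj : ∀ e ∈ t.ends, P e.1 (W e.2) = true := by
      intro e he
      rw [← h.edgeVal_edgeIndex hN hper (by simpa using v7 e he)]
      exact hall _ (List.mem_map.2 ⟨e, he, rfl⟩)
    simp only [Exchange.ends, List.forall_mem_cons] at hadj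
    obtain ⟨a1, a2, a3, a4, -⟩ := hadj
    have hgap : ∀ x y, y ≤ W (x + y) - W x := by
      intro x y
      induction y with
      | zero => simp
      | succ y ih =>
        have := hW (show x + y < x + (y + 1) by omega)
        have := hW.monotone (show x ≤ x + y by omega)
        omega
    have hlt : ∀ x y, x + 1 < y → W x + 1 < W y := by
      intro x y hxy
      have := hW (show x < x + 1 by omega)
      have := hW hxy
      omega
    have c1 := countP_range'_le_card_filter strictMono_id (q := (· % 2 == 0))
      (M := (· % 2 == 0)) (fun _ hx => hx) t.i t.a
    have c2 := countP_range'_le_card_filter strictMono_id (q := (· % 2 == 0))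
      (M := (· % 2 == 0)) (fun _ hx => hx) t.i2 t.a2
    have c3 := countP_range'_le_card_filter hW hmark t.j t.b
    have c4 := countP_range'_le_card_filter hW hmark t.j2 t.b2
    have g1 := hgap t.j t.b
    have g2 := hgap t.j2 t.b2
    refine h.no_exchange t.i t.a t.i2 t.a2 (W t.j) (W (t.j + t.b)) (W t.j2) (W (t.j2 + t.b2))
      t.o t.o2 v1 v2 (hW.monotone (by omega)) (hW v3) (hW.monotone (by omega)) ?_
      (v8.trans (add_le_add c1 c3)) (v9.trans (add_le_add c2 c4)) (by omega) (by omega) ?_ ?_ ?_ ?_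
        ?_
    · rw [← hper]; exact hW v4
    · rw [← hper]
      rcases v10 with ((v | v) | v) | v
      · exact .inl v
      · exact .inr (.inl v)
      · exact .inr (.inr (.inl (hlt _ _ v)))
      · exact .inr (.inr (.inr (hlt _ _ v)))
    · convert a1 using 1; cases t.o <;> rfl
    · convert a2 using 1; cases t.o <;> rfl
    · convert a3 using 1; cases t.o2 <;> rfl
    · convert a4 using 1; cases t.o2 <;> rfl

end Unexchangeable

/-- The parities of the entries alternate, beginning and ending with an odd entry. -/
def Alternating : List ℕ → Prop
  | [] => False
  | [p] => p % 2 = 1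
  | p :: c :: l => p % 2 = 1 ∧ c % 2 = 0 ∧ Alternating l

namespace Alternating

theorem cons_tail {p q : ℕ} {l : List ℕ} (hp : p % 2 = 1) (h : Alternating (q :: l)) :
    Alternating (p :: l) := by
  cases l with
  | nil => exact hp
  | cons c l => exact ⟨hp, h.2⟩

theorem isChain_or_exists (e : ℕ → ℕ) (l : List ℕ) (hl : Alternating l) :
    l.IsChain (fun s t => 4 ≤ e s + e t) ∨ ∃ l', l'.Sublist l ∧ Alternating l' ∧
      l.length = l'.length + 2 ∧ (l.map e).sum ≤ (l'.map e).sum + 3 := by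
  induction l using Alternating.induct with
  | case1 => exact hl.elim
  | case2 p => simp
  | case3 p c l ih =>
    obtain ⟨hp, hc, hl⟩ := hl
    by_cases h1 : e p + e c ≤ 3
    · refine .inr ⟨l, by simp, hl, by simp, ?_⟩
      simp only [List.map_cons, List.sum_cons]
      omega
    cases l with
    | nil => exact hl.elim
    | cons q l =>
      by_cases h2 : e c + e q ≤ 3
      · refine .inr ⟨p :: l, ?_, hl.cons_tail hp, by simp, ?_⟩
        · exact List.Sublist.cons_cons _ (by simp)
        · simp only [List.map_cons, List.sum_cons]
          omega
      rcases ih hl with h | ⟨l', hs, hl', hlen, hsum⟩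
      · refine .inl ?_
        simp only [List.isChain_cons_cons]
        exact ⟨by omega, by omega, h⟩
      · refine .inr ⟨p :: c :: l', by simpa using hs, ⟨hp, hc, hl'⟩, by simp [hlen], ?_⟩
        simp only [List.map_cons, List.sum_cons] at hsum ⊢
        omega

end Alternating

/-- The periodic extension of a list of positions on a cycle of length `L`. -/
def wordOf (l : List ℕ) (L j : ℕ) : ℕ := l.getD (j % l.length) 0 + L * (j / l.length)

theorem wordOf_add_length {l : List ℕ} (hl : 0 < l.length) (L j : ℕ) :
    wordOf l L (j + l.length) = wordOf l L j + L := by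
  simp only [wordOf, Nat.add_mod_right, Nat.add_div_right _ hl]
  ring

theorem wordOf_strictMono {l : List ℕ} (hl : 0 < l.length) {L : ℕ} (hs : l.Pairwise (· < ·))
    (hlast : ∀ x ∈ l, x < l.getD 0 0 + L) : StrictMono (wordOf l L) := by
  refine strictMono_nat_of_lt_succ fun j => ?_
  have hj := Nat.mod_lt j hl
  by_cases h : j % l.length + 1 < l.length
  · have h1 : (j + 1) % l.length = j % l.length + 1 := by
      rw [Nat.add_mod, Nat.mod_eq_of_lt (show 1 < l.length by omega), Nat.mod_eq_of_lt h]
    have h2 : (j + 1) / l.length = j / l.length := by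
      have e1 := Nat.div_add_mod j l.length
      have e2 := Nat.div_add_mod (j + 1) l.length
      exact Nat.eq_of_mul_eq_mul_left hl (by omega)
    simp only [wordOf, h1, h2]
    rw [List.getD_eq_getElem _ _ hj, List.getD_eq_getElem _ _ h]
    have := List.pairwise_iff_getElem.1 hs _ _ hj h (by omega)
    omega
  · have e1 := Nat.div_add_mod j l.length
    have e3 : j + 1 = l.length * (j / l.length + 1) := by rw [mul_add]; omega
    have h1 : (j + 1) % l.length = 0 := by rw [e3]; simp
    have h2 : (j + 1) / l.length = j / l.length + 1 := by
      rw [e3, Nat.mul_div_cancel_left _ hl]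
    simp only [wordOf, h1, h2]
    rw [List.getD_eq_getElem _ _ hj]
    have := hlast _ (List.getElem_mem hj)
    rw [mul_add]
    omega

theorem sum_range_add_of_periodic {f : ℕ → ℕ} {N : ℕ} (hf : ∀ j, f (j + N) = f j) (r : ℕ) :
    ∑ j ∈ Finset.range N, f (j + r) = ∑ j ∈ Finset.range N, f j := by
  induction r with
  | zero => rfl
  | succ r ih =>
    rw [← ih]
    have h1 := Finset.sum_range_succ (fun j => f (j + r)) N
    have h2 := Finset.sum_range_succ' (fun j => f (j + r)) N
    have h3 := hf r
    simp only [zero_add, add_comm N r, h3] at h1 h2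
    have h4 : ∀ j, f (j + (r + 1)) = f (j + 1 + r) := fun j => by congr 1; omega
    simp only [h4]
    omega

namespace Unexchangeable

variable {P : ℕ → ℕ → Bool} {M : ℕ → Bool} {L : ℕ}

theorem false_of_wordOf (h : Unexchangeable P M L) {l : List ℕ} (hl : 0 < l.length)
    (hs : l.Pairwise (· < ·)) (hlast : ∀ x ∈ l, x < l.getD 0 0 + L)
    (hpar : l.map (· % 2) = (List.range l.length).map (· % 2)) (hN : Even l.length) {r : ℕ}
    (hr : Even r)
    {marks : List ℕ} (hmarks : ∀ j ∈ marks, M (wordOf l L (j + r)) = true)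
    {tot : ℕ} (htot : tot ≤ (l.map (deg P)).sum) {pairs : List ℕ}
    (hpairs : ∀ j ∈ pairs, 4 ≤ deg P (wordOf l L (j + r)) + deg P (wordOf l L (j + 1 + r)))
    {ts : List Exchange} (hcheck : wordCheck l.length marks tot pairs ts = true) : False := by
  have hper : ∀ j, wordOf l L (j + l.length) = wordOf l L j + L := wordOf_add_length hl L
  refine h.false_of_wordCheck (W := fun j => wordOf l L (j + r)) ?_ ?_ hN ?_ hmarks ?_ hpairs hcheck
  · exact (wordOf_strictMono hl hs hlast).comp (fun a b hab => by simpa using hab)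
  · intro j
    have h1 : (j + r) % l.length % 2 = (j + r) % 2 := Nat.mod_mod_of_dvd _ hN.two_dvd
    have hlt := Nat.mod_lt (j + r) hl
    have h2 : l.getD ((j + r) % l.length) 0 % 2 = (j + r) % l.length % 2 := by
      have := congrArg (fun l => l[(j + r) % l.length]?) hpar
      simpa [hlt, List.getD_eq_getElem] using this
    have h3 : L * ((j + r) / l.length) % 2 = 0 :=
      Nat.even_iff.1 (h.even.mul_right _)
    have h4 := Nat.even_iff.1 hr
    simp only [wordOf]
    omega
  · intro j
    rw [← hper]
    congr 1
    omega
  · rw [sum_range_add_of_periodic (f := fun j => deg P (wordOf l L j))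
      (fun j => by simp only [hper, h.deg_add_length])]
    refine htot.trans (le_of_eq ?_)
    rw [← List.ofFn_getElem (xs := l.map (deg P)), List.sum_ofFn, Finset.sum_range]
    simp only [List.getElem_map]
    have : (l.map (deg P)).length = l.length := by simp
    refine Fintype.sum_equiv (finCongr this) _ _ fun j => ?_
    have hj : (j : ℕ) < l.length := by simpa using j.2
    simp [wordOf, Nat.mod_eq_of_lt hj, Nat.div_eq_of_lt hj, hj]

theorem sum_deg_le (h : Unexchangeable P M L) (m : ℕ) (a b : ℕ) (A B : List ℕ)
    (hm : A.length + B.length = m) (hA : Alternating A) (hB : Alternating B)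
    (ha : a % 2 = 0) (hb : b % 2 = 0) (hMa : M a = true) (hMb : M b = true)
    (hs : (a :: A ++ b :: B).Pairwise (· < ·)) (hlast : ∀ x ∈ a :: A ++ b :: B, x < a + L) :
    2 * ((a :: A ++ b :: B).map (deg P)).sum ≤ 3 * (m + 2) := by
  induction m using Nat.strong_induction_on generalizing A B with
  | _ m ih =>
  rcases hA.isChain_or_exists (deg P) with cA | ⟨A', sA, hA', lA, eA⟩
  swap
  · have hsub : (a :: A' ++ b :: B).Sublist (a :: A ++ b :: B) :=
      (sA.cons_cons _).append (List.Sublist.refl _)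
    have := ih (A'.length + B.length) (by omega) A' B rfl hA' hB (hs.sublist hsub)
      fun x hx => hlast x (hsub.subset hx)
    simp only [List.cons_append, List.map_cons, List.map_append, List.sum_cons,
      List.sum_append] at this ⊢
    omega
  rcases hB.isChain_or_exists (deg P) with cB | ⟨B', sB, hB', lB, eB⟩
  swap
  · have hsub : (a :: A ++ b :: B').Sublist (a :: A ++ b :: B) :=
      (List.Sublist.refl _).append (sB.cons_cons _)
    have := ih (A.length + B'.length) (by omega) A B' rfl hA hB' (hs.sublist hsub)
      fun x hx => hlast x (hsub.subset hx)
    simp only [List.cons_append, List.map_cons, List.map_append, List.sum_cons,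
      List.sum_append] at this ⊢
    omega
  by_contra! hlt
  match A, hA, B, hB with
  | [p], hA, [q], hB =>
    simp only [Alternating] at hA hB
    refine h.false_of_wordOf (l := [a, p, b, q]) (r := 0) (by simp) hs hlast ?_
      ⟨2, rfl⟩ (by decide) ?_ ?_ ?_ wordCheck_ApAp
    · simp [List.range, List.range.loop, *]
    · simp [wordOf, *]
    · simp at hlt hm ⊢; omega
    · simp
  | [p], hA, [q, d, q'], hB =>
    simp only [Alternating] at hA hB
    refine h.false_of_wordOf (l := [a, p, b, q, d, q']) (r := 0) (by simp) hs hlast ?_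
      ⟨3, rfl⟩ (by decide) ?_ ?_ ?_ wordCheck_ApApcp
    · simp [List.range, List.range.loop, *]
    · simp [wordOf, *]
    · simp at hlt hm ⊢; omega
    · simpa [wordOf] using cB
  | [p, c, p'], hA, [q], hB =>
    simp only [Alternating] at hA hB
    refine h.false_of_wordOf (l := [a, p, c, p', b, q]) (r := 4) (by simp) hs hlast ?_
      ⟨3, rfl⟩ (by decide) ?_ ?_ ?_ wordCheck_ApApcp
    · simp [List.range, List.range.loop, *]
    · simp [wordOf, h.mark_add_length, *]
    · simp at hlt hm ⊢; omega
    · simpa [wordOf, h.deg_add_length] using cA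
  | [p], hA, [q, d, q', d', q''], hB =>
    simp only [Alternating] at hA hB
    refine h.false_of_wordOf (l := [a, p, b, q, d, q', d', q'']) (r := 0) (by simp) hs hlast ?_
      ⟨4, rfl⟩ (by decide) ?_ ?_ ?_ wordCheck_ApApcpcp
    · simp [List.range, List.range.loop, *]
    · simp [wordOf, *]
    · simp at hlt hm ⊢; omega
    · simpa [wordOf] using cB
  | [p, c, p', c', p''], hA, [q], hB =>
    simp only [Alternating] at hA hB
    refine h.false_of_wordOf (l := [a, p, c, p', c', p'', b, q]) (r := 6) (by simp) hs hlast ?_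
      ⟨4, rfl⟩ (by decide) ?_ ?_ ?_ wordCheck_ApApcpcp
    · simp [List.range, List.range.loop, *]
    · simp [wordOf, h.mark_add_length, *]
    · simp at hlt hm ⊢; omega
    · simpa [wordOf, h.deg_add_length] using cA
  | [_, _, _, _], hA, [_], _ => simp [Alternating] at hA
  | [_, _, _, _, _, _], hA, [_], _ => simp [Alternating] at hA
  | [p], hA, q :: d :: q' :: d' :: q'' :: d'' :: r :: B, hB =>
    simp only [Alternating] at hA hB
    have hr : r % 2 = 1 := by cases B <;> simp [Alternating] at hB <;> omega
    have hsub : [a, p, b, q, d, q', d', q'', d'', r].Sublist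
        ([a, p] ++ b :: q :: d :: q' :: d' :: q'' :: d'' :: r :: B) := by simp
    refine h.false_of_wordOf (l := [a, p, b, q, d, q', d', q'', d'', r]) (r := 0) (by simp)
      (hs.sublist hsub) (fun x hx => hlast x (hsub.subset hx)) ?_
      ⟨5, rfl⟩ (by decide) ?_ (Nat.zero_le _) ?_ wordCheck_ApApcpcpcp
    · simp [List.range, List.range.loop, *]
    · simp [wordOf, *]
    · simp only [List.isChain_cons_cons] at cB
      simp [wordOf, cB]
  | p :: c :: p' :: c' :: p'' :: c'' :: r :: A, hA, [q], hB =>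
    simp only [Alternating] at hA hB
    have hr : r % 2 = 1 := by cases A <;> simp [Alternating] at hA <;> omega
    have hsub : [a, p, c, p', c', p'', c'', r, b, q].Sublist
        (a :: p :: c :: p' :: c' :: p'' :: c'' :: r :: A ++ [b, q]) := by simp
    refine h.false_of_wordOf (l := [a, p, c, p', c', p'', c'', r, b, q]) (r := 8) (by simp)
      (hs.sublist hsub) (fun x hx => hlast x (hsub.subset hx)) ?_
      ⟨5, rfl⟩ (by decide) ?_ (Nat.zero_le _) ?_ wordCheck_ApApcpcpcp
    · simp [List.range, List.range.loop, *]
    · simp [wordOf, h.mark_add_length, *]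
    · simp only [List.isChain_cons_cons] at cA
      simp [wordOf, h.deg_add_length, cA]
  | p :: c :: p' :: A, hA, q :: d :: q' :: B, hB =>
    simp only [Alternating] at hA hB
    have hp : p' % 2 = 1 := by cases A <;> simp [Alternating] at hA <;> omega
    have hq : q' % 2 = 1 := by cases B <;> simp [Alternating] at hB <;> omega
    have hsub : [a, p, c, p', b, q, d, q'].Sublist
        (a :: p :: c :: p' :: A ++ b :: q :: d :: q' :: B) := by
      simp only [List.cons_append, List.cons_sublist_cons]
      exact List.Sublist.trans (by simp) (List.sublist_append_right A _)
    refine h.false_of_wordOf (l := [a, p, c, p', b, q, d, q']) (r := 0) (by simp)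
      (hs.sublist hsub) (fun x hx => hlast x (hsub.subset hx)) ?_
      ⟨4, rfl⟩ (by decide) ?_ (Nat.zero_le _) ?_ wordCheck_ApcpApcp
    · simp [List.range, List.range.loop, *]
    · simp [wordOf, *]
    · simp only [List.isChain_cons_cons] at cA cB
      simp [wordOf, cA, cB]

theorem alternating_range' (s n : ℕ) (hs : s % 2 = 1) :
    Alternating (List.range' s (2 * n + 1)) := by
  induction n generalizing s with
  | zero => exact hs
  | succ n ih => exact ⟨hs, by omega, ih (s + 1 + 1) (by omega)⟩

/-- On average, a position is adjacent to at most half of the odd or even virtual positions. -/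
theorem two_mul_sum_deg_le (h : Unexchangeable P M L) {b : ℕ} (hb : b % 2 = 0) (hb0 : 0 < b)
    (hbL : b < L) (hM0 : M 0 = true) (hMb : M b = true) :
    2 * ∑ t ∈ Finset.range L, deg P t ≤ 3 * L := by
  have hL := Nat.even_iff.1 h.even
  have hA : Alternating (List.range' 1 (b - 1)) := by
    have := alternating_range' 1 ((b - 2) / 2) rfl
    rwa [show 2 * ((b - 2) / 2) + 1 = b - 1 by omega] at this
  have hB : Alternating (List.range' (b + 1) (L - b - 1)) := by
    have := alternating_range' (b + 1) ((L - b - 2) / 2) (by omega)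
    rwa [show 2 * ((L - b - 2) / 2) + 1 = L - b - 1 by omega] at this
  have hl : 0 :: List.range' 1 (b - 1) ++ b :: List.range' (b + 1) (L - b - 1) =
      List.range' 0 L := by
    have h0 : 0 :: List.range' 1 (b - 1) = List.range' 0 b := by
      rw [show List.range' 0 b = List.range' 0 (b - 1 + 1) by congr 1; omega, List.range'_succ]
    have h1 : b :: List.range' (b + 1) (L - b - 1) = List.range' b (L - b) := by
      rw [← List.range'_succ, show L - b - 1 + 1 = L - b by omega]
    have := List.range'_append_1 (s := 0) (m := b) (n := L - b)
    rwa [zero_add, show b + (L - b) = L by omega, ← h0, ← h1] at this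
  have := h.sum_deg_le (L - 2) 0 b (List.range' 1 (b - 1)) (List.range' (b + 1) (L - b - 1))
    (by simp; omega) hA hB rfl hb hM0 hMb (by rw [hl]; exact List.pairwise_lt_range')
    (by rw [hl]; simp)
  rw [hl, ← List.range_eq_range', show L - 2 + 2 = L by omega] at this
  rwa [← List.sum_toFinset _ List.nodup_range, List.toFinset_range] at this

end Unexchangeable

section Params

variable {V : Type*} {G : SimpleGraph V}

/-- `f` runs periodically around a cycle of length `L` with vertex set `A`. -/
structure IsCycleParam (G : SimpleGraph V) (A : Finset V) (L : ℕ) (f : ℕ → V) : Prop where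
  pos : 0 < L
  add_length : ∀ t, f (t + L) = f t
  adj : ∀ t, G.Adj (f t) (f (t + 1))
  inj : ∀ s t, f s = f t → s ≡ t [MOD L]
  mem : ∀ x, x ∈ A ↔ ∃ t < L, f t = x

theorem isChain_map_range' {f : ℕ → V} (hf : ∀ t, G.Adj (f t) (f (t + 1))) (s n : ℕ) :
    ((List.range' s n).map f).IsChain G.Adj := by
  rw [List.isChain_map]
  exact (List.isChain_range' s n 1).imp fun a b hab => by subst hab; exact hf a

namespace IsCycleParam

variable {A : Finset V} {L : ℕ} {f : ℕ → V}

theorem injOn (h : IsCycleParam G A L f) {s s' : ℕ} (hs : s' < s + L) :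
    Set.InjOn f (Finset.Icc s s') := by
  intro a ha b hb hab
  simp only [Finset.coe_Icc, Set.mem_Icc] at ha hb
  have := h.inj a b hab
  rcases le_total a b with hle | hle
  · exact this.eq_of_abs_lt (by rw [abs_lt]; omega)
  · exact this.eq_of_abs_lt (by rw [abs_lt]; omega)

theorem mem_apply (h : IsCycleParam G A L f) (t : ℕ) : f t ∈ A := by
  rw [h.mem]
  exact ⟨t % L, Nat.mod_lt _ h.pos, Function.Periodic.map_mod_nat h.add_length t⟩

theorem exists_mem_Ico (h : IsCycleParam G A L f) (s : ℕ) {x : V} (hx : x ∈ A) :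
    ∃ t, s ≤ t ∧ t < s + L ∧ f t = x := by
  obtain ⟨t, ht, rfl⟩ := (h.mem x).1 hx
  have hmod := Function.Periodic.map_mod_nat h.add_length
  have hpos := h.pos
  have h1 := Nat.mod_lt (t + L * s - s) hpos
  refine ⟨s + (t + L * s - s) % L, by omega, by omega, ?_⟩
  have hle : s ≤ L * s := Nat.le_mul_of_pos_left s hpos
  rw [← hmod (s + _), Nat.add_mod_mod, show s + (t + L * s - s) = t + L * s by omega,
    Nat.add_mul_mod_self_left, hmod]

theorem nodup_map_range' (h : IsCycleParam G A L f) {s n : ℕ} (hn : n < L) :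
    ((List.range' s (n + 1)).map f).Nodup := by
  refine List.Nodup.map_on (fun x hx y hy hxy => ?_) (List.nodup_range' (step := 1))
  simp only [List.mem_range'_1] at hx hy
  exact h.injOn (s := s) (s' := s + n) (by omega) (by simp; omega) (by simp; omega) hxy

end IsCycleParam

end Params

section Cycles

variable {V : Type*} [DecidableEq V] {G : SimpleGraph V}

/-- `A` is the vertex set of a cycle of `G`. -/
def IsCycleSet (G : SimpleGraph V) (A : Finset V) : Prop :=
  ∃ (v : V) (c : G.Walk v v), c.IsCycle ∧ c.support.toFinset = A

theorem SimpleGraph.Walk.IsCycle.card_toFinset_support {v : V} {c : G.Walk v v} (hc : c.IsCycle) :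
    c.support.toFinset.card = c.length := by
  have h : c.support.toFinset = c.support.tail.toFinset := by
    ext x
    rw [List.mem_toFinset, List.mem_toFinset, c.mem_support_iff]
    refine ⟨?_, .inr⟩
    rintro (rfl | h)
    · exact c.end_mem_tail_support hc.not_nil
    · exact h
  rw [h, List.toFinset_card_of_nodup hc.support_nodup, List.length_tail, c.length_support]
  rfl

theorem isCycleSet_of_isChain {l : List V} (hl : 3 ≤ l.length) (hchain : l.IsChain G.Adj)
    (hnodup : l.Nodup) (hne : l ≠ []) (hclose : G.Adj (l.getLast hne) (l.head hne)) :
    IsCycleSet G l.toFinset := by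
  refine ⟨_, SimpleGraph.Walk.cons hclose (SimpleGraph.Walk.ofSupport l hne hchain), ?_, ?_⟩
  · rw [SimpleGraph.Walk.isCycle_iff_isPath_tail_and_le_length]
    refine ⟨?_, ?_⟩
    · rw [SimpleGraph.Walk.isPath_def]
      simpa using hnodup
    · simp
      omega
  · simp

theorem IsCycleSet.exists_param {A : Finset V} (hA : IsCycleSet G A) {x : V} (hx : x ∈ A) :
    ∃ f, IsCycleParam G A A.card f ∧ f 0 = x := by
  obtain ⟨v, c, hc, rfl⟩ := hA
  rw [hc.card_toFinset_support]
  have hx' : x ∈ c.support := by simpa using hx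
  have hd : (c.rotate x hx').IsCycle := hc.rotate hx'
  have hlen : (c.rotate x hx').length = c.length := by simp
  have hmem : ∀ y, y ∈ (c.rotate x hx').support ↔ y ∈ c.support :=
    fun y => SimpleGraph.Walk.mem_support_rotate_iff c x hx'
  generalize c.rotate x hx' = d at hd hlen hmem
  rw [← hlen]
  have h3 := hd.three_le_length
  refine ⟨fun t => d.getVert (t % d.length), ⟨by omega, by simp, fun t => ?_, ?_, ?_⟩, by simp⟩
  · have ht := Nat.mod_lt t (show 0 < d.length by omega)
    have hadj := d.adj_getVert_succ ht
    by_cases h : t % d.length + 1 < d.length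
    · have : (t + 1) % d.length = t % d.length + 1 := by
        rw [Nat.add_mod, Nat.mod_eq_of_lt (show 1 < d.length by omega), Nat.mod_eq_of_lt h]
      simpa [this] using hadj
    · have e : t % d.length + 1 = d.length := by omega
      have : (t + 1) % d.length = 0 := by
        rw [Nat.add_mod, Nat.mod_eq_of_lt (show 1 < d.length by omega), e, Nat.mod_self]
      rw [e, d.getVert_length] at hadj
      simpa [this] using hadj
  · intro s t hst
    have hs := Nat.mod_lt s (show 0 < d.length by omega)
    have ht := Nat.mod_lt t (show 0 < d.length by omega)
    exact hd.getVert_injOn' (by simp; omega) (by simp; omega) hst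
  · intro y
    rw [List.mem_toFinset, ← hmem, SimpleGraph.Walk.mem_support_iff_exists_getVert]
    constructor
    · rintro ⟨n, rfl, hn⟩
      rcases hn.lt_or_eq with h | h
      · exact ⟨n, h, by simp [Nat.mod_eq_of_lt h]⟩
      · exact ⟨0, by omega, by simp [h]⟩
    · rintro ⟨t, ht, rfl⟩
      exact ⟨t, by simp [Nat.mod_eq_of_lt ht], ht.le⟩

/-- The vertices at positions `s, …, s'`. -/
def arc (f : ℕ → V) (s s' : ℕ) : Finset V := (Finset.Icc s s').image f

theorem toFinset_map_range' (f : ℕ → V) (s n : ℕ) :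
    ((List.range' s (n + 1)).map f).toFinset = arc f s (s + n) := by
  ext x
  simp only [arc, List.mem_toFinset, List.mem_map, List.mem_range'_1, Finset.mem_image,
    Finset.mem_Icc]
  grind

namespace IsCycleParam

variable {A D : Finset V} {L Ld : ℕ} {f g : ℕ → V}

theorem arc_subset (h : IsCycleParam G A L f) (s s' : ℕ) : arc f s s' ⊆ A := by
  intro x hx
  obtain ⟨t, -, rfl⟩ := Finset.mem_image.1 hx
  exact h.mem_apply t

theorem card_arc (h : IsCycleParam G A L f) {s s' : ℕ} (hs : s' < s + L) :
    (arc f s s').card = s' + 1 - s := by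
  rw [arc, Finset.card_image_of_injOn (h.injOn hs), Nat.card_Icc]

theorem card_eq (h : IsCycleParam G A L f) : A.card = L := by
  have : A = arc f 0 (L - 1) := by
    ext x
    have := h.pos
    simp only [h.mem, arc, Finset.mem_image, Finset.mem_Icc]
    grind
  rw [this, h.card_arc (by have := h.pos; omega)]
  have := h.pos
  omega

theorem disjoint_arc (h : IsCycleParam G A L f) {s s' t t' : ℕ} (h1 : s' < t) (h2 : t' < s + L) :
    Disjoint (arc f s s') (arc f t t') := by
  rw [Finset.disjoint_left]
  intro x hx hy
  obtain ⟨a, ha, rfl⟩ := Finset.mem_image.1 hx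
  obtain ⟨b, hb, hab⟩ := Finset.mem_image.1 hy
  simp only [Finset.mem_Icc] at ha hb
  have := (h.inj b a hab).eq_of_abs_lt (by rw [abs_lt]; omega)
  omega

theorem isCycleSet_arc (h : IsCycleParam G A L f) {s s' : ℕ} (h1 : s + 2 ≤ s') (h2 : s' < s + L)
    (hadj : G.Adj (f s) (f s')) : IsCycleSet G (arc f s s') := by
  obtain ⟨n, rfl⟩ := Nat.exists_eq_add_of_le (show s ≤ s' by omega)
  rw [← toFinset_map_range']
  refine isCycleSet_of_isChain (by simp; omega) (isChain_map_range' h.adj _ _)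
    (h.nodup_map_range' (by omega)) (by simp) ?_
  simp only [List.getLast_map, List.head_map, List.head_range', List.getLast_range']
  simpa using hadj.symm

theorem isCycleSet_insert_arc (h : IsCycleParam G A L f) {s s' : ℕ} (h1 : s < s') (h2 : s' < s + L)
    {v : V} (hv : v ∉ A) (hs : G.Adj v (f s)) (hs' : G.Adj v (f s')) :
    IsCycleSet G (insert v (arc f s s')) := by
  obtain ⟨n, rfl⟩ := Nat.exists_eq_add_of_le h1.le
  rw [← toFinset_map_range', ← List.toFinset_cons]
  refine isCycleSet_of_isChain (by simp; omega) ?_ ?_ (by simp) ?_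
  · rw [List.isChain_cons]
    refine ⟨?_, isChain_map_range' h.adj _ _⟩
    simpa [List.range'_succ] using hs
  · refine List.nodup_cons.2 ⟨fun hc => hv ?_, h.nodup_map_range' (by omega)⟩
    obtain ⟨t, -, rfl⟩ := List.mem_map.1 hc
    exact h.mem_apply t
  · rw [List.getLast_cons (by simp), List.getLast_map, List.getLast_range']
    simpa using hs'.symm

theorem isCycleSet_arc_union_arc (h : IsCycleParam G A L f) (h' : IsCycleParam G D Ld g)
    (hd : Disjoint A D) {s n t m : ℕ} (hn : n < L) (hm : m < Ld) (hnm : 1 ≤ n + m) (o : Bool)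
    (h1 : G.Adj (f s) (g (bif o then t + m else t)))
    (h2 : G.Adj (f (s + n)) (g (bif o then t else t + m))) :
    IsCycleSet G (arc f s (s + n) ∪ arc g t (t + m)) := by
  have hdis : ∀ x ∈ (List.range' s (n + 1)).map f, ∀ y ∈ (List.range' t (m + 1)).map g, x ≠ y := by
    intro x hx y hy
    obtain ⟨a, -, rfl⟩ := List.mem_map.1 hx
    obtain ⟨b, -, rfl⟩ := List.mem_map.1 hy
    exact Finset.disjoint_left.1 hd (h.mem_apply a) |> fun hne heq => hne (heq ▸ h'.mem_apply b)
  rw [← toFinset_map_range', ← toFinset_map_range']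
  cases o with
  | true =>
    rw [← List.toFinset_append]
    refine isCycleSet_of_isChain (by simp; omega) ?_ ?_ (by simp) ?_
    · refine List.isChain_append.2 ⟨isChain_map_range' h.adj _ _, isChain_map_range' h'.adj _ _, ?_⟩
      intro x hx y hy
      simp only [List.getLast?_map, List.getLast?_range', List.head?_map, List.head?_range']
        at hx hy
      simp at hx hy
      subst hx hy
      exact h2
    · exact List.nodup_append.2 ⟨h.nodup_map_range' hn, h'.nodup_map_range' hm, hdis⟩
    · rw [List.getLast_append_of_right_ne_nil _ _ (by simp), List.head_append_of_ne_nil (by simp)]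
      simp only [List.getLast_map, List.head_map, List.head_range', List.getLast_range']
      exact h1.symm
  | false =>
    rw [← List.toFinset_reverse (l := (List.range' t (m + 1)).map g), ← List.toFinset_append]
    refine isCycleSet_of_isChain (by simp; omega) ?_ ?_ (by simp) ?_
    · refine List.isChain_append.2 ⟨isChain_map_range' h.adj _ _, ?_, ?_⟩
      · rw [List.isChain_reverse]
        exact (isChain_map_range' h'.adj _ _).imp fun _ _ h => h.symm
      intro x hx y hy
      simp only [List.getLast?_map, List.getLast?_range', List.head?_reverse] at hx hy
      simp at hx hy
      subst hx hy
      exact h2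
    · exact List.nodup_append.2 ⟨h.nodup_map_range' hn,
        List.nodup_reverse.2 (h'.nodup_map_range' hm),
        fun x hx y hy => hdis x hx y (List.mem_reverse.1 hy)⟩
    · rw [List.getLast_append_of_right_ne_nil _ _ (by simp), List.head_append_of_ne_nil (by simp)]
      simp only [List.head_map, List.head_range', List.getLast_reverse]
      exact h1.symm

end IsCycleParam

end Cycles

theorem sum_update_add {ι α : Type*} [Fintype ι] [DecidableEq ι] {A : ι → α} (i : ι) (b : α)
    (F : α → ℕ) : ∑ j, F (Function.update A i b j) + F (A i) = ∑ j, F (A j) + F b := by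
  rw [← Finset.add_sum_erase _ _ (Finset.mem_univ i),
    ← Finset.add_sum_erase _ (fun j => F (A j)) (Finset.mem_univ i), Function.update_self,
    Finset.sum_congr rfl fun j hj => by rw [Function.update_of_ne (Finset.ne_of_mem_erase hj)]]
  ring

section Systems

variable {V ι : Type*} [DecidableEq V] {G : SimpleGraph V} {S : Finset V}

theorem IsCycleParam.card_filter_le {A : Finset V} {L : ℕ} {f : ℕ → V} (h : IsCycleParam G A L f)
    {W : ℕ → ℕ} (hW : StrictMono W) {i i' : ℕ} (hi : W i' < W i + L) {q : ℕ → Bool}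
    (hq : ∀ x, q x = true → f (W x) ∈ S) :
    ((Finset.Icc i i').filter fun x => q x = true).card ≤ (S ∩ arc f (W i) (W i')).card := by
  have hmem : ∀ x ∈ Finset.Icc i i', W x ∈ Finset.Icc (W i) (W i') := fun x hx => by
    rw [Finset.mem_Icc] at hx ⊢
    exact ⟨hW.monotone hx.1, hW.monotone hx.2⟩
  refine Finset.card_le_card_of_injOn (fun x => f (W x)) (fun x hx => ?_) fun x hx y hy hxy => ?_
  · simp only [Finset.coe_filter, Set.mem_ofPred_eq] at hx
    simp only [Finset.coe_inter, Set.mem_inter_iff, Finset.mem_coe]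
    exact ⟨hq x hx.2, Finset.mem_image_of_mem f (hmem x hx.1)⟩
  · simp only [Finset.coe_filter, Set.mem_ofPred_eq] at hx hy
    exact hW.injective (h.injOn hi (hmem x hx.1) (hmem y hy.1) hxy)

/-- A family of vertex sets of disjoint cycles, each with two vertices of `S`. -/
structure IsFeasibleSystem (G : SimpleGraph V) (S : Finset V) (A : ι → Finset V) : Prop where
  cycle : ∀ i, IsCycleSet G (A i)
  feasible : ∀ i, 2 ≤ (S ∩ A i).card
  disjoint : ∀ i j, i ≠ j → Disjoint (A i) (A j)

/-- A feasible system of least order, covering the fewest vertices of `S` among those. -/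
structure IsMinimalSSystem [Fintype ι] (G : SimpleGraph V) (S : Finset V) (A : ι → Finset V) : Prop
    extends IsFeasibleSystem G S A where
  order_le : ∀ B : ι → Finset V, IsFeasibleSystem G S B → ∑ i, (A i).card ≤ ∑ i, (B i).card
  cover_le : ∀ B : ι → Finset V, IsFeasibleSystem G S B → ∑ i, (B i).card = ∑ i, (A i).card →
    ∑ i, (S ∩ A i).card ≤ ∑ i, (S ∩ B i).card

namespace IsFeasibleSystem

variable [DecidableEq ι] {A : ι → Finset V}

theorem update (h : IsFeasibleSystem G S A) (i : ι) {B : Finset V} (hB : IsCycleSet G B)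
    (hf : 2 ≤ (S ∩ B).card) (hd : ∀ j, j ≠ i → Disjoint B (A j)) :
    IsFeasibleSystem G S (Function.update A i B) := by
  refine ⟨fun j => ?_, fun j => ?_, fun j l hjl => ?_⟩
  · by_cases hj : j = i
    · subst hj; simpa using hB
    · simpa [hj] using h.cycle j
  · by_cases hj : j = i
    · subst hj; simpa using hf
    · simpa [hj] using h.feasible j
  · by_cases hj : j = i
    · subst hj
      simpa [hjl.symm] using hd l hjl.symm
    · by_cases hl : l = i
      · subst hl
        simpa [hj] using (hd j hj).symm
      · simpa [hj, hl] using h.disjoint j l hjl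

end IsFeasibleSystem

namespace IsMinimalSSystem

variable [Fintype ι] [DecidableEq ι] {A : ι → Finset V}

theorem card_le_of_replace (h : IsMinimalSSystem G S A) (i : ι) {B : Finset V}
    (hB : IsCycleSet G B) (hf : 2 ≤ (S ∩ B).card) (hd : ∀ j, j ≠ i → Disjoint B (A j)) :
    (A i).card ≤ B.card := by
  have h1 := h.order_le _ (h.update i hB hf hd)
  have h2 := sum_update_add (A := A) i B Finset.card
  omega

theorem card_inter_le_of_replace (h : IsMinimalSSystem G S A) (i : ι) {B : Finset V}
    (hB : IsCycleSet G B) (hf : 2 ≤ (S ∩ B).card) (hd : ∀ j, j ≠ i → Disjoint B (A j))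
    (hcard : B.card = (A i).card) : (S ∩ A i).card ≤ (S ∩ B).card := by
  have h2 := sum_update_add (A := A) i B Finset.card
  have h1 := h.cover_le _ (h.update i hB hf hd) (by omega)
  have h3 := sum_update_add (A := A) i B fun X => (S ∩ X).card
  omega

theorem card_add_card_le_of_replace (h : IsMinimalSSystem G S A) {i j : ι} (hij : i ≠ j)
    {B B' : Finset V} (hB : IsCycleSet G B) (hB' : IsCycleSet G B') (hf : 2 ≤ (S ∩ B).card)
    (hf' : 2 ≤ (S ∩ B').card) (hd : Disjoint B B') (hsub : B ⊆ A i ∪ A j)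
    (hsub' : B' ⊆ A i ∪ A j) : (A i).card + (A j).card ≤ B.card + B'.card := by
  have hdis : ∀ l, l ≠ i → l ≠ j → Disjoint (A i ∪ A j) (A l) := fun l hi hj =>
    Finset.disjoint_union_left.2 ⟨h.disjoint i l hi.symm, h.disjoint j l hj.symm⟩
  have key : IsFeasibleSystem G S (Function.update (Function.update A i B) j B') := by
    refine ⟨fun l => ?_, fun l => ?_, ?_⟩
    · by_cases hj : l = j
      · subst hj; simpa using hB'
      · by_cases hi : l = i
        · subst hi; simpa [hj] using hB
        · simpa [hi, hj] using h.cycle l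
    · by_cases hj : l = j
      · subst hj; simpa using hf'
      · by_cases hi : l = i
        · subst hi; simpa [hj] using hf
        · simpa [hi, hj] using h.feasible l
    · intro l m hlm
      wlog hle : m = j ∨ (m = i ∧ l ≠ j) ∨ (m ≠ i ∧ m ≠ j ∧ l ≠ i ∧ l ≠ j) generalizing l m
      · exact (this m l hlm.symm (by grind)).symm
      rcases hle with rfl | ⟨rfl, hl⟩ | ⟨h1, h2, h3, h4⟩
      · rw [Function.update_self, Function.update_of_ne hlm]
        by_cases hi : l = i
        · subst hi; simpa using hd
        · rw [Function.update_of_ne hi]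
          exact ((hdis l hi hlm).mono_left hsub').symm
      · rw [Function.update_of_ne hl, Function.update_of_ne hij, Function.update_self,
          Function.update_of_ne hlm]
        exact ((hdis l hlm hl).mono_left hsub).symm
      · simpa [h1, h2, h3, h4] using h.disjoint l m hlm
  have h1 := h.order_le _ key
  have h2 := sum_update_add (A := A) i B Finset.card
  have h3 := sum_update_add (A := Function.update A i B) j B' Finset.card
  rw [Function.update_of_ne hij.symm] at h3
  omega

/-- A cycle with three vertices of `S` has no chord. -/
theorem not_adj_of_three_le (h : IsMinimalSSystem G S A) {i : ι} (h3 : 3 ≤ (S ∩ A i).card)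
    {L : ℕ} {f : ℕ → V} (hf : IsCycleParam G (A i) L f) {s t : ℕ} (hst : s + 2 ≤ t)
    (hts : t + 2 ≤ s + L) : ¬ G.Adj (f s) (f t) := by
  intro hadj
  have hcard := hf.card_eq
  have hcov : S ∩ A i ⊆ (S ∩ arc f s t) ∪ (S ∩ arc f t (s + L)) := by
    intro x hx
    rw [Finset.mem_inter] at hx
    obtain ⟨r, h1, h2, rfl⟩ := hf.exists_mem_Ico s hx.2
    rcases le_total r t with hr | hr
    · exact Finset.mem_union_left _ (Finset.mem_inter.2
        ⟨hx.1, Finset.mem_image_of_mem f (Finset.mem_Icc.2 ⟨h1, hr⟩)⟩)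
    · exact Finset.mem_union_right _ (Finset.mem_inter.2
        ⟨hx.1, Finset.mem_image_of_mem f (Finset.mem_Icc.2 ⟨hr, h2.le⟩)⟩)
  have hle := (Finset.card_le_card hcov).trans (Finset.card_union_le _ _)
  have hdis : ∀ s t, ∀ j, j ≠ i → Disjoint (arc f s t) (A j) := fun s t j hj =>
    (h.disjoint i j hj.symm).mono_left (hf.arc_subset s t)
  by_cases h2 : 2 ≤ (S ∩ arc f s t).card
  · have := h.card_le_of_replace i (hf.isCycleSet_arc hst (by omega) hadj) h2 (hdis _ _)
    rw [hf.card_arc (by omega)] at this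
    omega
  · have hadj' : G.Adj (f t) (f (s + L)) := by rw [hf.add_length]; exact hadj.symm
    have := h.card_le_of_replace i (hf.isCycleSet_arc hts (by omega) hadj') (by omega) (hdis _ _)
    rw [hf.card_arc (by omega)] at this
    omega

theorem exists_eq_add_one_of_adj (h : IsMinimalSSystem G S A) {i : ι} (h3 : 3 ≤ (S ∩ A i).card)
    {L : ℕ} {f : ℕ → V} (hf : IsCycleParam G (A i) L f) (s : ℕ) {x : V} (hx : x ∈ A i)
    (hadj : G.Adj (f s) x) : x = f (s + 1) ∨ x = f (s + (L - 1)) := by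
  obtain ⟨t, h1, h2, rfl⟩ := hf.exists_mem_Ico s hx
  by_cases ht : s + 2 ≤ t ∧ t + 2 ≤ s + L
  · exact absurd hadj (h.not_adj_of_three_le h3 hf ht.1 ht.2)
  · have : t ≠ s := fun h => G.loopless.irrefl _ (h ▸ hadj)
    rcases (by omega : t = s + 1 ∨ t = s + (L - 1)) with rfl | rfl <;> simp

end IsMinimalSSystem

end Systems

section Parity

variable {V : Type*} {G : SimpleGraph V} {X Y S : Finset V}

theorem IsCycleParam.mem_of_mod_two {A : Finset V} {L : ℕ} {f : ℕ → V} (hf : IsCycleParam G A L f)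
    (hdisj : Disjoint X Y) (hbip : ∀ u v, G.Adj u v → (u ∈ X ∧ v ∈ Y) ∨ (u ∈ Y ∧ v ∈ X))
    (h0 : f 0 ∈ X) (t : ℕ) : (t % 2 = 0 → f t ∈ X) ∧ (t % 2 = 1 → f t ∈ Y) := by
  induction t with
  | zero => exact ⟨fun _ => h0, by simp⟩
  | succ t ih =>
    have hXY := Finset.disjoint_left.1 hdisj
    refine ⟨fun ht => ?_, fun ht => ?_⟩
    · have := ih.2 (by omega)
      rcases hbip _ _ (hf.adj t) with h | h
      · exact (hXY h.1 this).elim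
      · exact h.2
    · have := ih.1 (by omega)
      rcases hbip _ _ (hf.adj t) with h | h
      · exact h.2
      · exact (hXY this h.1).elim

theorem IsCycleParam.even {A : Finset V} {L : ℕ} {f : ℕ → V} (hf : IsCycleParam G A L f)
    (hdisj : Disjoint X Y) (hbip : ∀ u v, G.Adj u v → (u ∈ X ∧ v ∈ Y) ∨ (u ∈ Y ∧ v ∈ X))
    (h0 : f 0 ∈ X) : Even L := by
  rw [Nat.even_iff]
  by_contra hL
  have h1 := (hf.mem_of_mod_two hdisj hbip h0 L).2 (by omega)
  have h2 := hf.add_length 0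
  rw [zero_add] at h2
  rw [h2] at h1
  exact Finset.disjoint_left.1 hdisj h0 h1

/-- Six positions per turn on a cycle of length `L`, of alternating parity; those with even index
carry vertices of `S`. -/
structure IsVirtual (S : Finset V) (f : ℕ → V) (L : ℕ) (u : ℕ → ℕ) : Prop where
  strictMono : StrictMono u
  add_six : ∀ k, u (k + 6) = u k + L
  mod_two : ∀ k, u k % 2 = k % 2
  mem : ∀ k, k % 2 = 0 → f (u k) ∈ S

theorem IsVirtual.add_le {f : ℕ → V} {L : ℕ} {u : ℕ → ℕ} (hu : IsVirtual S f L u) (k m : ℕ) :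
    u k + m ≤ u (k + m) := by
  induction m with
  | zero => simp
  | succ m ih =>
    have := hu.strictMono (show k + m < k + (m + 1) by omega)
    omega

end Parity

section Bipartite

variable {V ι : Type*} [DecidableEq V] {G : SimpleGraph V} {X Y S : Finset V}

theorem IsCycleParam.exists_isVirtual {A : Finset V} {L : ℕ} {f : ℕ → V}
    (hf : IsCycleParam G A L f) (hdisj : Disjoint X Y)
    (hbip : ∀ u v, G.Adj u v → (u ∈ X ∧ v ∈ Y) ∨ (u ∈ Y ∧ v ∈ X)) (hSX : S ⊆ X)
    (h0 : f 0 ∈ S) (h3 : 3 ≤ (S ∩ A).card) : ∃ u, IsVirtual S f L u := by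
  have hpar := hf.mem_of_mod_two hdisj hbip (hSX h0)
  have hL := Nat.even_iff.1 (hf.even hdisj hbip (hSX h0))
  have hS : ∀ t, f t ∈ S → t % 2 = 0 := fun t ht => by
    by_contra hodd
    exact Finset.disjoint_left.1 hdisj (hSX ht) ((hpar t).2 (by omega))
  have hcard : 1 < ((S ∩ A).erase (f 0)).card := by
    have := Finset.pred_card_le_card_erase (s := S ∩ A) (a := f 0)
    omega
  obtain ⟨x, hx, y, hy, hxy⟩ := Finset.one_lt_card.1 hcard
  simp only [Finset.mem_erase, Finset.mem_inter, hf.mem] at hx hy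
  obtain ⟨hx0, hxS, s, hs, rfl⟩ := hx
  obtain ⟨hy0, hyS, t, ht, rfl⟩ := hy
  wlog hst : s < t generalizing s t
  · have hne : s ≠ t := fun h => hxy (h ▸ rfl)
    exact this t ht hy0 hyS s hs hxy.symm hx0 hxS (by omega)
  have e1 := hS s hxS
  have e2 := hS t hyS
  have hs0 : s ≠ 0 := fun h => hx0 (h ▸ rfl)
  have hper : ∀ k, wordOf [0, 1, s, s + 1, t, t + 1] L (k + 6) =
      wordOf [0, 1, s, s + 1, t, t + 1] L k + L :=
    wordOf_add_length (l := [0, 1, s, s + 1, t, t + 1]) (by simp) L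
  refine ⟨wordOf [0, 1, s, s + 1, t, t + 1] L, ⟨wordOf_strictMono (by simp) ?_ ?_, hper, ?_, ?_⟩⟩
  · simp
    omega
  · simp
    omega
  · have hbase : ∀ k < 6, wordOf [0, 1, s, s + 1, t, t + 1] L k % 2 = k % 2 := by
      intro k hk
      interval_cases k <;> simp [wordOf] <;> omega
    intro k
    induction k using Nat.strong_induction_on with
    | _ k ih =>
      by_cases hk : k < 6
      · exact hbase k hk
      · obtain ⟨k, rfl⟩ := Nat.exists_eq_add_of_le' (show 6 ≤ k by omega)
        have := ih k (by omega)
        rw [hper]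
        omega
  · have hbase : ∀ k < 6, k % 2 = 0 → f (wordOf [0, 1, s, s + 1, t, t + 1] L k) ∈ S := by
      intro k hk hk2
      interval_cases k <;> simp [wordOf, *] at hk2 ⊢
    intro k hk
    rw [← Function.Periodic.map_mod_nat (f := fun k => f (wordOf [0, 1, s, s + 1, t, t + 1] L k))
      (show Function.Periodic (fun k => f (wordOf [0, 1, s, s + 1, t, t + 1] L k)) 6 from
        fun k => by simp only [hper, hf.add_length]) k]
    exact hbase _ (Nat.mod_lt _ (by norm_num)) (by omega)

variable [Fintype ι] [DecidableEq ι] {A : ι → Finset V}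

theorem IsMinimalSSystem.unexchangeable (h : IsMinimalSSystem G S A) [DecidableRel G.Adj]
    (hdisj : Disjoint X Y) (hbip : ∀ u v, G.Adj u v → (u ∈ X ∧ v ∈ Y) ∨ (u ∈ Y ∧ v ∈ X))
    (hSX : S ⊆ X) {i j : ι} (hij : i ≠ j) {L Ld : ℕ} {f g : ℕ → V}
    (hf : IsCycleParam G (A i) L f) (hf0 : f 0 ∈ S) {u : ℕ → ℕ} (hu : IsVirtual S f L u)
    (hg : IsCycleParam G (A j) Ld g) (hg0 : g 0 ∈ S) :
    Unexchangeable (fun k t => decide (G.Adj (f (u k)) (g t))) (fun t => decide (g t ∈ S)) Ld where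
  even := hg.even hdisj hbip (hSX hg0)
  parity k t hkt := by
    have hadj : G.Adj (f (u k)) (g t) := by simpa using hkt
    have h1 := hf.mem_of_mod_two hdisj hbip (hSX hf0) (u k)
    have h2 := hg.mem_of_mod_two hdisj hbip (hSX hg0) t
    have h3 := hu.mod_two k
    have hXY := Finset.disjoint_left.1 hdisj
    by_contra hne
    rcases Nat.mod_two_eq_zero_or_one t with ht | ht
    · rcases hbip _ _ hadj with hc | hc
      · exact hXY (h2.1 ht) hc.2
      · exact hXY (h1.1 (by omega)) hc.1
    · rcases hbip _ _ hadj with hc | hc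
      · exact hXY hc.1 (h1.2 (by omega))
      · exact hXY hc.2 (h2.2 ht)
  add_six k t := by simp only [hu.add_six, hf.add_length]
  add_length k t := by simp only [hg.add_length]
  mark_add_length t := by simp only [hg.add_length]
  no_exchange := by
    intro k a k2 a2 s s' s2 s2' o o2 hk hk2 hs hss hs2 hs2' hc hc2 hl hl2 hmiss p1 p2 p3 p4
    simp only [decide_eq_true_eq] at p1 p2 p3 p4
    have hdAB := h.disjoint i j hij
    have hgap : ∀ k m, k ≤ m → u k + (m - k) ≤ u m := fun k m hkm => by
      have := hu.add_le k (m - k)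
      rwa [Nat.add_sub_cancel' hkm] at this
    have g1 := hgap k (k + a) (by omega)
    have g2 := hgap (k + a) k2 (by omega)
    have g3 := hgap k2 (k2 + a2) (by omega)
    have g4 := hgap (k2 + a2) (k + 6) (by omega)
    rw [hu.add_six] at g4
    have hcycle : ∀ k a s s' o, u k ≤ u (k + a) → u (k + a) < u k + L → s ≤ s' → s' < s + Ld →
        1 ≤ (u (k + a) - u k) + (s' - s) →
        G.Adj (f (u k)) (g (bif o then s' else s)) →
        G.Adj (f (u (k + a))) (g (bif o then s else s')) →
        IsCycleSet G (arc f (u k) (u (k + a)) ∪ arc g s s') := by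
      intro k a s s' o h1 h2 h3 h4 h5 h6 h7
      have := hf.isCycleSet_arc_union_arc hg hdAB (s := u k) (n := u (k + a) - u k) (t := s)
        (m := s' - s) (by omega) (by omega) h5 o
      rw [Nat.add_sub_cancel' h1, Nat.add_sub_cancel' h3] at this
      exact this h6 h7
    have hcount : ∀ k a s s', u (k + a) < u k + L → s' < s + Ld →
        2 ≤ ((Finset.Icc k (k + a)).filter fun x => (x % 2 == 0) = true).card +
          ((Finset.Icc s s').filter fun x => decide (g x ∈ S) = true).card →
        2 ≤ (S ∩ (arc f (u k) (u (k + a)) ∪ arc g s s')).card := by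
      intro k a s s' h1 h2 h3
      have e1 := hf.card_filter_le (S := S) hu.strictMono (i := k) (i' := k + a) h1
        (q := (· % 2 == 0)) (fun x hx => hu.mem x (by simpa using hx))
      have e2 := hg.card_filter_le (S := S) strictMono_id (i := s) (i' := s') h2
        (q := fun x => decide (g x ∈ S)) (fun x hx => by simpa using hx)
      rw [Finset.inter_union_distrib_left, Finset.card_union_of_disjoint]
      · exact h3.trans (add_le_add e1 e2)
      · exact (hdAB.mono (hf.arc_subset _ _) (hg.arc_subset _ _)).mono Finset.inter_subset_right
          Finset.inter_subset_right
    have hcard : ∀ k a s s', u (k + a) < u k + L → s' < s + Ld →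
        (arc f (u k) (u (k + a)) ∪ arc g s s').card = (u (k + a) + 1 - u k) + (s' + 1 - s) := by
      intro k a s s' h1 h2
      rw [Finset.card_union_of_disjoint (hdAB.mono (hf.arc_subset _ _) (hg.arc_subset _ _)),
        hf.card_arc h1, hg.card_arc h2]
    have hdd : Disjoint (arc f (u k) (u (k + a)) ∪ arc g s s')
        (arc f (u k2) (u (k2 + a2)) ∪ arc g s2 s2') := by
      rw [Finset.disjoint_union_left, Finset.disjoint_union_right, Finset.disjoint_union_right]
      exact ⟨⟨hf.disjoint_arc (by omega) (by omega),
          hdAB.mono (hf.arc_subset _ _) (hg.arc_subset _ _)⟩,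
        hdAB.symm.mono (hg.arc_subset _ _) (hf.arc_subset _ _),
        hg.disjoint_arc (by omega) (by omega)⟩
    have hle := h.card_add_card_le_of_replace hij
      (hcycle k a s s' o (by omega) (by omega) hs (by omega) (by omega) p1 p2)
      (hcycle k2 a2 s2 s2' o2 (by omega) (by omega) hs2 (by omega) (by omega) p3 p4)
      (hcount k a s s' (by omega) (by omega) hc) (hcount k2 a2 s2 s2' (by omega) (by omega) hc2) hdd
      (Finset.union_subset_union (hf.arc_subset _ _) (hg.arc_subset _ _))
      (Finset.union_subset_union (hf.arc_subset _ _) (hg.arc_subset _ _))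
    rw [hcard _ _ _ _ (by omega) (by omega), hcard _ _ _ _ (by omega) (by omega), hf.card_eq,
      hg.card_eq] at hle
    omega

/-- A vertex outside the system is adjacent to at most one virtual position. -/
theorem IsMinimalSSystem.eq_of_adj_virtual (h : IsMinimalSSystem G S A)
    (hdisj : Disjoint X Y) (hbip : ∀ u v, G.Adj u v → (u ∈ X ∧ v ∈ Y) ∨ (u ∈ Y ∧ v ∈ X))
    (hSX : S ⊆ X) {i : ι} {L : ℕ} {f : ℕ → V} (hf : IsCycleParam G (A i) L f) (hf0 : f 0 ∈ S)
    {u : ℕ → ℕ} (hu : IsVirtual S f L u) {x : V} (hx : ∀ j, x ∉ A j) {k m : ℕ} (hk : k < 6)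
    (hm : m < 6) (hkx : G.Adj x (f (u k))) (hmx : G.Adj x (f (u m))) : k = m := by
  have hXY := Finset.disjoint_left.1 hdisj
  have hpar := hf.mem_of_mod_two hdisj hbip (hSX hf0)
  have hins : ∀ s t j, j ≠ i → Disjoint (insert x (arc f s t)) (A j) := fun s t j hj =>
    Finset.disjoint_insert_left.2 ⟨hx j, (h.disjoint i j hj.symm).mono_left (hf.arc_subset s t)⟩
  have hcard : ∀ s t, t < s + L → (insert x (arc f s t)).card = t + 1 - s + 1 := fun s t hst => by
    rw [Finset.card_insert_of_notMem fun hc => hx i (hf.arc_subset s t hc), hf.card_arc hst]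
  have key : ∀ k, G.Adj x (f (u k)) → ¬ G.Adj x (f (u (k + 2))) := by
    intro k h1 h2
    have l1 := hu.add_le k 2
    have l2 := hu.add_le (k + 2) 4
    rw [show k + 2 + 4 = k + 6 by ring, hu.add_six] at l2
    have hcyc := hf.isCycleSet_insert_arc (s := u k) (s' := u (k + 2)) (by omega) (by omega) (hx i)
      h1 h2
    have hcyc' := hf.isCycleSet_insert_arc (s := u (k + 2)) (s' := u k + L) (by omega) (by omega)
      (hx i) h2 (by rwa [hf.add_length])
    have hshort : ¬ 2 ≤ (S ∩ insert x (arc f (u k) (u (k + 2)))).card := fun h2 => by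
      have := h.card_le_of_replace i hcyc h2 (hins _ _)
      rw [hcard _ _ (by omega), hf.card_eq] at this
      omega
    have hmem : ∀ m, k ≤ m → m ≤ k + 2 → m % 2 = 0 →
        f (u m) ∈ S ∩ insert x (arc f (u k) (u (k + 2))) :=
      fun m hm hm' hm2 => Finset.mem_inter.2 ⟨hu.mem m hm2, Finset.mem_insert_of_mem
        (Finset.mem_image_of_mem f (Finset.mem_Icc.2
          ⟨hu.strictMono.monotone hm, hu.strictMono.monotone hm'⟩))⟩
    rcases Nat.mod_two_eq_zero_or_one k with hk | hk
    · refine hshort (Finset.one_lt_card.2 ⟨_, hmem k le_rfl (by omega) hk, _,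
        hmem (k + 2) (by omega) le_rfl (by omega), fun heq => ?_⟩)
      have := hf.injOn (s := u k) (s' := u (k + 2)) (by omega) (by simp; omega) (by simp; omega) heq
      omega
    · have hxS : x ∉ S := fun hxS => hshort (Finset.one_lt_card.2 ⟨x, by simp [hxS], _,
        hmem (k + 1) (by omega) (by omega) (by omega), fun heq => hx i (heq ▸ hf.mem_apply _)⟩)
      have hlong : 2 ≤ (S ∩ insert x (arc f (u (k + 2)) (u k + L))).card := by
        have := hf.card_filter_le (S := S) hu.strictMono (i := k + 2) (i' := k + 6)
          (by rw [hu.add_six]; omega) (q := (· % 2 == 0)) (fun x hx => hu.mem x (by simpa using hx))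
        rw [hu.add_six] at this
        refine le_trans ?_ (this.trans (Finset.card_le_card
          (Finset.inter_subset_inter_left (Finset.subset_insert _ _))))
        exact Finset.one_lt_card.2 ⟨k + 3, by simp; omega, k + 5, by simp; omega, by omega⟩
      have hle := h.card_le_of_replace i hcyc' hlong (hins _ _)
      have hc := hcard (u (k + 2)) (u k + L) (by omega)
      have hle2 := h.card_inter_le_of_replace i hcyc' hlong (hins _ _)
        (by rw [hf.card_eq] at hle ⊢; omega)
      have hlt1 := hu.strictMono (show k < k + 1 by omega)
      have hlt2 := hu.strictMono (show k + 1 < k + 2 by omega)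
      have hnot : f (u (k + 1)) ∉ arc f (u (k + 2)) (u k + L) := fun hmem =>
        Finset.disjoint_left.1 (hf.disjoint_arc (s := u (k + 1)) (s' := u (k + 1))
          (t := u (k + 2)) (t' := u k + L) (by omega) (by omega)) (by simp [arc]) hmem
      have hss : S ∩ insert x (arc f (u (k + 2)) (u k + L)) ⊂ S ∩ A i := by
        rw [Finset.ssubset_iff_of_subset]
        · refine ⟨f (u (k + 1)), Finset.mem_inter.2 ⟨hu.mem _ (by omega), hf.mem_apply _⟩, ?_⟩
          rw [Finset.mem_inter, Finset.mem_insert]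
          rintro ⟨-, heq | hmem⟩
          · exact hx i (heq ▸ hf.mem_apply _)
          · exact hnot hmem
        · intro y hy
          rw [Finset.mem_inter, Finset.mem_insert] at hy
          rcases hy.2 with rfl | hmem
          · exact (hxS hy.1).elim
          · exact Finset.mem_inter.2 ⟨hy.1, hf.arc_subset _ _ hmem⟩
      exact absurd (Finset.card_lt_card hss) (by omega)
  have hmod : k % 2 = m % 2 := by
    have h1 := hpar (u k)
    have h2 := hpar (u m)
    have h3 := hu.mod_two k
    have h4 := hu.mod_two m
    by_contra hne
    rcases hbip _ _ hkx with hc | hc <;> rcases hbip _ _ hmx with hc' | hc' <;>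
      grind
  wlog hlt : k ≤ m generalizing k m
  · exact (this hm hk hmx hkx hmod.symm (by omega)).symm
  by_contra hne
  rcases (by omega : m = k + 2 ∨ m = k + 4) with rfl | rfl
  · exact key k hkx hmx
  · refine key (k + 4) hmx ?_
    rwa [show k + 4 + 2 = k + 6 by ring, hu.add_six, hf.add_length]

end Bipartite

theorem degree_eq_card_filter_add_sum {V ι : Type*} [DecidableEq V] [Fintype V] [Fintype ι]
    {G : SimpleGraph V} [DecidableRel G.Adj] {A : ι → Finset V}
    (hA : ∀ i j, i ≠ j → Disjoint (A i) (A j)) (x : V) :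
    G.degree x = ((Finset.univ \ Finset.univ.biUnion A).filter (G.Adj x)).card +
      ∑ j, ((A j).filter (G.Adj x)).card := by
  rw [← Finset.card_biUnion fun i _ j _ hij => Finset.disjoint_filter_filter (hA i j hij),
    ← Finset.filter_biUnion, ← SimpleGraph.card_neighborFinset_eq_degree,
    SimpleGraph.neighborFinset_eq_filter, ← Finset.card_union_of_disjoint
      (Finset.disjoint_filter_filter Finset.sdiff_disjoint), ← Finset.filter_union,
    Finset.sdiff_union_of_subset (Finset.subset_univ _)]

theorem IsCycleParam.card_filter {V : Type*} [DecidableEq V] {G : SimpleGraph V} {D : Finset V}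
    {L : ℕ} {g : ℕ → V} (hg : IsCycleParam G D L g) (p : V → Prop) [DecidablePred p] :
    (D.filter p).card = ∑ t ∈ Finset.range L, if p (g t) then 1 else 0 := by
  have hinj : Set.InjOn g (Finset.range L) := by
    have := hg.pos
    refine (hg.injOn (s := 0) (s' := L - 1) (by omega)).mono fun t ht => ?_
    simp at ht ⊢
    omega
  have himage : D = (Finset.range L).image g := by
    ext x
    simp [hg.mem]
  rw [himage, Finset.card_filter, Finset.sum_image hinj]

section Counting

variable {V ι : Type*} [DecidableEq V] [Fintype ι] [DecidableEq ι] {G : SimpleGraph V}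
  [DecidableRel G.Adj] {X Y S : Finset V} {A : ι → Finset V}

theorem IsMinimalSSystem.two_mul_sum_card_le (h : IsMinimalSSystem G S A)
    (hdisj : Disjoint X Y) (hbip : ∀ u v, G.Adj u v → (u ∈ X ∧ v ∈ Y) ∨ (u ∈ Y ∧ v ∈ X))
    (hSX : S ⊆ X) {i j : ι} (hij : i ≠ j) {L : ℕ} {f : ℕ → V}
    (hf : IsCycleParam G (A i) L f) (hf0 : f 0 ∈ S) {u : ℕ → ℕ} (hu : IsVirtual S f L u) :
    2 * ∑ k ∈ Finset.range 6, ((A j).filter (G.Adj (f (u k)))).card ≤ 3 * (A j).card := by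
  obtain ⟨x, hx, y, hy, hxy⟩ := Finset.one_lt_card.1 (h.feasible j)
  rw [Finset.mem_inter] at hx hy
  obtain ⟨g, hg, rfl⟩ := (h.cycle j).exists_param hx.2
  obtain ⟨b, hb, rfl⟩ := (hg.mem y).1 hy.2
  have hb0 : b ≠ 0 := fun hb => hxy (hb ▸ rfl)
  have hb2 : b % 2 = 0 := by
    by_contra hodd
    exact Finset.disjoint_left.1 hdisj (hSX hy.1)
      ((hg.mem_of_mod_two hdisj hbip (hSX hx.1) b).2 (by omega))
  have key := (h.unexchangeable hdisj hbip hSX hij hf hf0 hu hg hx.1).two_mul_sum_deg_le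
    hb2 (by omega) hb (by simpa using hx.1) (by simpa using hy.1)
  convert key using 2
  rw [Finset.sum_congr rfl fun k _ => hg.card_filter (G.Adj (f (u k))), Finset.sum_comm]
  refine Finset.sum_congr rfl fun t _ => ?_
  simp only [Finset.sum_range_succ, Finset.sum_range_zero]
  simp [Unexchangeable.deg, List.range_succ, List.countP_cons]
  ring

theorem IsMinimalSSystem.card_filter_adj_le (h : IsMinimalSSystem G S A) {i : ι}
    (h3 : 3 ≤ (S ∩ A i).card) {L : ℕ} {f : ℕ → V} (hf : IsCycleParam G (A i) L f) (s : ℕ) :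
    ((A i).filter (G.Adj (f s))).card ≤ 2 := by
  refine (Finset.card_le_card (t := {f (s + 1), f (s + (L - 1))}) fun x hx => ?_).trans
    Finset.card_le_two
  rw [Finset.mem_filter] at hx
  simpa using h.exists_eq_add_one_of_adj h3 hf s hx.1 hx.2

theorem IsMinimalSSystem.sum_card_filter_le (h : IsMinimalSSystem G S A)
    (hdisj : Disjoint X Y) (hbip : ∀ u v, G.Adj u v → (u ∈ X ∧ v ∈ Y) ∨ (u ∈ Y ∧ v ∈ X))
    (hSX : S ⊆ X) {i : ι} {L : ℕ} {f : ℕ → V} (hf : IsCycleParam G (A i) L f) (hf0 : f 0 ∈ S)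
    {u : ℕ → ℕ} (hu : IsVirtual S f L u) {H : Finset V} (hH : ∀ j, Disjoint H (A j)) :
    ∑ k ∈ Finset.range 6, (H.filter (G.Adj (f (u k)))).card ≤ H.card := by
  rw [← Finset.card_biUnion]
  · exact Finset.card_le_card (Finset.biUnion_subset.2 fun k _ => Finset.filter_subset _ _)
  · intro k hk m hm hkm
    refine Finset.disjoint_left.2 fun x hx hx' => hkm ?_
    rw [Finset.mem_filter] at hx hx'
    exact h.eq_of_adj_virtual hdisj hbip hSX hf hf0 hu
      (fun j => Finset.disjoint_left.1 (hH j) hx.1) (by simpa using hk) (by simpa using hm)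
      hx.2.symm hx'.2.symm

variable [Fintype V]

theorem IsMinimalSSystem.card_inter_eq_two (h : IsMinimalSSystem G S A)
    (hdisj : Disjoint X Y) (hcover : X ∪ Y = Finset.univ) (hXY : X.card = Y.card)
    (hbip : ∀ u v, G.Adj u v → (u ∈ X ∧ v ∈ Y) ∨ (u ∈ Y ∧ v ∈ X)) (hSX : S ⊆ X)
    (hdeg : ∀ x ∈ S, ∀ y ∈ Y, ¬ G.Adj x y → X.card + 1 ≤ G.degree x + G.degree y)
    (hH : (Finset.univ \ Finset.univ.biUnion A).Nonempty) (i : ι) : (S ∩ A i).card = 2 := by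
  by_contra hne
  have h3 : 3 ≤ (S ∩ A i).card := by
    have := h.feasible i
    omega
  obtain ⟨x, hx⟩ := Finset.card_pos.1 (show 0 < (S ∩ A i).card by omega)
  rw [Finset.mem_inter] at hx
  obtain ⟨f, hf, rfl⟩ := (h.cycle i).exists_param hx.2
  obtain ⟨u, hu⟩ := hf.exists_isVirtual hdisj hbip hSX hx.1 h3
  have hmemY : ∀ k, k % 2 = 1 → f (u k) ∈ Y := fun k hk =>
    (hf.mem_of_mod_two hdisj hbip (hSX hx.1) (u k)).2 ((hu.mod_two k).trans hk)
  have hpair : ∀ k, ¬ G.Adj (f (u k)) (f (u (k + 3))) := fun k => by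
    have h1 := hu.add_le k 3
    have h2 := hu.add_le (k + 3) 3
    rw [add_assoc, hu.add_six] at h2
    exact h.not_adj_of_three_le h3 hf (by omega) (by omega)
  have hlong : 6 ≤ (A i).card := by
    have h1 := hu.add_le 0 6
    rw [hu.add_six] at h1
    omega
  have d0 := hdeg _ (hu.mem 0 rfl) _ (hmemY 3 rfl) (hpair 0)
  have d2 := hdeg _ (hu.mem 2 rfl) _ (hmemY 5 rfl) (hpair 2)
  have d4 := hdeg _ (hu.mem 4 rfl) _ (hmemY 1 rfl) fun hadj => hpair 1 hadj.symm
  have hsum : ∑ k ∈ Finset.range 6, G.degree (f (u k)) =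
      ∑ k ∈ Finset.range 6,
        ((Finset.univ \ Finset.univ.biUnion A).filter (G.Adj (f (u k)))).card +
      ∑ j, ∑ k ∈ Finset.range 6, ((A j).filter (G.Adj (f (u k)))).card := by
    rw [Finset.sum_comm, ← Finset.sum_add_distrib]
    exact Finset.sum_congr rfl fun k _ => degree_eq_card_filter_add_sum h.disjoint _
  have hdegs : 3 * (X.card + 1) ≤ ∑ k ∈ Finset.range 6, G.degree (f (u k)) := by
    simp only [Finset.sum_range_succ, Finset.sum_range_zero]
    omega
  have hout := h.sum_card_filter_le hdisj hbip hSX hf hx.1 hu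
    (H := Finset.univ \ Finset.univ.biUnion A) fun j =>
      Finset.sdiff_disjoint.mono_right (Finset.subset_biUnion_of_mem A (Finset.mem_univ j))
  have hself : ∑ k ∈ Finset.range 6, ((A i).filter (G.Adj (f (u k)))).card ≤ 12 :=
    (Finset.sum_le_card_nsmul _ _ 2 fun k _ => h.card_filter_adj_le h3 hf (u k)).trans_eq (by simp)
  have hothers : 2 * ∑ j ∈ Finset.univ.erase i,
      ∑ k ∈ Finset.range 6, ((A j).filter (G.Adj (f (u k)))).card ≤
        3 * ∑ j ∈ Finset.univ.erase i, (A j).card := by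
    rw [Finset.mul_sum, Finset.mul_sum]
    exact Finset.sum_le_sum fun j hj =>
      h.two_mul_sum_card_le hdisj hbip hSX (Finset.ne_of_mem_erase hj).symm hf hx.1 hu
  have htotal : X.card + Y.card = (Finset.univ \ Finset.univ.biUnion A).card + ∑ j, (A j).card := by
    rw [← Finset.card_biUnion fun i _ j _ hij => h.disjoint i j hij,
      ← Finset.card_union_of_disjoint hdisj, hcover,
      Finset.card_sdiff_add_card_eq_card (Finset.subset_univ _)]
  rw [← Finset.add_sum_erase _ _ (Finset.mem_univ i)] at hsum htotal
  have := hH.card_pos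
  omega

end Counting
/-- Lemma 3.1: if {C₁, …, C_k} is a minimal S system of G, σ₁,₁(S) ≥ n+1 and
G − ⋃ Cᵢ is nonempty, then |S ∩ V(Cᵢ)| = 2 for each i. -/
theorem minimal_S_system_two {V : Type*} [Fintype V] [DecidableEq V]
    (G : SimpleGraph V) [DecidableRel G.Adj]
    (X Y S : Finset V) (n k : ℕ) (hk : 0 < k)
    (hdisj : Disjoint X Y) (hcover : X ∪ Y = Finset.univ)
    (hX : X.card = n) (hY : Y.card = n)
    (hbip : ∀ u v : V, G.Adj u v → (u ∈ X ∧ v ∈ Y) ∨ (u ∈ Y ∧ v ∈ X))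
    (hSX : S ⊆ X)
    (hdeg : ∀ x ∈ S, ∀ y ∈ Y, ¬ G.Adj x y → n + 1 ≤ G.degree x + G.degree y)
    (v : Fin k → V) (c : ∀ i, G.Walk (v i) (v i))
    (hcyc : ∀ i, (c i).IsCycle)
    (hfeas : ∀ i, 2 ≤ (S ∩ (c i).support.toFinset).card)
    (hdisjc : ∀ i j, i ≠ j → Disjoint (c i).support.toFinset (c j).support.toFinset)
    -- minimal system: no k disjoint feasible cycles of smaller total order
    (hmin : ∀ (w : Fin k → V) (d : ∀ i, G.Walk (w i) (w i)),
      (∀ i, (d i).IsCycle) → (∀ i, 2 ≤ (S ∩ (d i).support.toFinset).card) →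
      (∀ i j, i ≠ j → Disjoint (d i).support.toFinset (d j).support.toFinset) →
      ∑ i, (c i).length ≤ ∑ i, (d i).length)
    -- minimal S system: among systems of the same total order, the total
    -- number of covered S-vertices is minimum
    (hminS : ∀ (w : Fin k → V) (d : ∀ i, G.Walk (w i) (w i)),
      (∀ i, (d i).IsCycle) → (∀ i, 2 ≤ (S ∩ (d i).support.toFinset).card) →
      (∀ i j, i ≠ j → Disjoint (d i).support.toFinset (d j).support.toFinset) →
      ∑ i, (d i).length = ∑ i, (c i).length →
      ∑ i, (S ∩ (c i).support.toFinset).card ≤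
        ∑ i, (S ∩ (d i).support.toFinset).card)
    (hH : (Finset.univ \ Finset.univ.biUnion
      (fun i => (c i).support.toFinset)).Nonempty) :
    ∀ i, (S ∩ (c i).support.toFinset).card = 2 := by
  have hset : ∀ B : Fin k → Finset V, IsFeasibleSystem G S B →
      ∃ (w : Fin k → V) (d : ∀ i, G.Walk (w i) (w i)), (∀ i, (d i).IsCycle) ∧
        ∀ i, (d i).support.toFinset = B i := fun B hB => by
    choose w d hd hdB using hB.cycle
    exact ⟨w, d, hd, hdB⟩
  have h : IsMinimalSSystem G S fun i => (c i).support.toFinset := by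
    refine ⟨⟨fun i => ⟨v i, c i, hcyc i, rfl⟩, hfeas, hdisjc⟩, fun B hB => ?_, fun B hB hBc => ?_⟩
    · obtain ⟨w, d, hd, hdB⟩ := hset B hB
      obtain rfl : (fun i => (d i).support.toFinset) = B := funext hdB
      simp only [(hcyc _).card_toFinset_support, (hd _).card_toFinset_support]
      exact hmin w d hd hB.feasible hB.disjoint
    · obtain ⟨w, d, hd, hdB⟩ := hset B hB
      obtain rfl : (fun i => (d i).support.toFinset) = B := funext hdB
      simp only [(hcyc _).card_toFinset_support, (hd _).card_toFinset_support] at hBc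
      exact hminS w d hd hB.feasible hB.disjoint hBc
  exact h.card_inter_eq_two hdisj hcover (hX.trans hY.symm) hbip hSX (hX ▸ hdeg) hH
end

section
/- Let G be a balanced bipartite graph of order 2n with S ⊆ X such that every nonadjacent pair x ∈ S, y ∈ Y satisfies d(x) + d(y) ≥ n. Let {C_1, …, C_k} be a minimal system of k disjoint feasible cycles (k ≥ 0). Then G contains a minimal system {C_1', …, C_k'} with |C_i'| = |C_i| and |S ∩ V(C_i')| = |S ∩ V(C_i)| for all i, such that H' = G − (C_1' ∪ ⋯ ∪ C_k') has a matching M with all M-edges having their X-endpoint in S and with M covering every vertex of S ∩ V(H'). -/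
namespace SimpleGraph

variable {V : Type*} {G : SimpleGraph V}

theorem Walk.IsPath.exists_isCycle_insert [DecidableEq V] {u v z : V} {p : G.Walk u v}
    (hp : p.IsPath) (huv : u ≠ v) (hz : z ∉ p.support) (hzu : G.Adj z u) (hzv : G.Adj z v) :
    ∃ w : G.Walk z z, w.IsCycle ∧ w.length = p.length + 2 ∧
      w.support.toFinset = insert z p.support.toFinset := by
  refine ⟨.cons hzu (p.concat hzv.symm), ?_, by simp, ?_⟩
  · rw [Walk.cons_isCycle_iff]
    refine ⟨hp.concat hz hzv.symm, ?_⟩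
    rw [Walk.edges_concat, List.concat_eq_append, List.mem_append]
    rintro (h | h)
    · exact hz (p.fst_mem_support_of_mem_edges h)
    · simp only [List.mem_singleton, Sym2.eq_iff] at h
      rcases h with ⟨h, -⟩ | ⟨-, h⟩
      · exact hz (h ▸ p.end_mem_support)
      · exact huv h
  · ext t
    simp [Walk.support_concat]

/-- A closed sequence traversing a cycle of length `L` over and over. -/
structure IsCyclicSeq (G : SimpleGraph V) (c : ℕ → V) (L : ℕ) : Prop where
  adj : ∀ i, G.Adj (c i) (c (i + 1))
  periodic : ∀ i, c (i + L) = c i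
  inj : ∀ i j, c i = c j → i % L = j % L

theorem exists_walk_support_eq_map_range {c : ℕ → V} (hc : ∀ i, G.Adj (c i) (c (i + 1)))
    (i p : ℕ) : ∃ w : G.Walk (c i) (c (i + p)),
      w.support = (List.range (p + 1)).map (fun j => c (i + j)) := by
  induction p with
  | zero => exact ⟨.nil, by simp⟩
  | succ p ih =>
    obtain ⟨w, hw⟩ := ih
    refine ⟨w.concat (hc (i + p)), ?_⟩
    rw [Walk.support_concat, hw, List.range_succ (n := p + 1)]
    simp

namespace IsCyclicSeq

variable {c : ℕ → V} {L : ℕ}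

theorem shift (hc : G.IsCyclicSeq c L) (k : ℕ) : G.IsCyclicSeq (fun i => c (i + k)) L where
  adj i := by simpa [add_right_comm] using hc.adj (i + k)
  periodic i := by simpa [add_right_comm] using hc.periodic (i + k)
  inj i j h := Nat.ModEq.add_right_cancel' k (hc.inj _ _ h)

theorem apply_mod (hc : G.IsCyclicSeq c L) (i : ℕ) : c (i % L) = c i :=
  Function.Periodic.map_mod_nat hc.periodic i

variable [DecidableEq V]

theorem apply_mem_image_range (hc : G.IsCyclicSeq c L) (hL : 0 < L) (i : ℕ) :
    c i ∈ (Finset.range L).image c :=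
  Finset.mem_image.2 ⟨i % L, Finset.mem_range.2 (Nat.mod_lt _ hL), hc.apply_mod i⟩

theorem image_range_shift (hc : G.IsCyclicSeq c L) (hL : 0 < L) (k : ℕ) :
    (Finset.range L).image (fun i => c (i + k)) = (Finset.range L).image c := by
  apply subset_antisymm
  · intro t ht
    obtain ⟨i, -, rfl⟩ := Finset.mem_image.1 ht
    exact hc.apply_mem_image_range hL _
  · intro t ht
    obtain ⟨i, -, rfl⟩ := Finset.mem_image.1 ht
    have h := (hc.shift k).apply_mem_image_range hL (i + k * L - k)
    have hk : k ≤ k * L := Nat.le_mul_of_pos_right k hL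
    have e : i + k * L - k + k = i + k * L := by omega
    have e2 : c (i + k * L) = c i := by
      rw [← hc.apply_mod (i + k * L), Nat.add_mul_mod_self_right, hc.apply_mod]
    simpa only [e, e2] using h

theorem exists_isCycle_arc (hc : G.IsCyclicSeq c L) {i p : ℕ} (hp : 1 ≤ p) (hpL : p < L) {z : V}
    (hz : ∀ j, z ≠ c j) (hi : G.Adj z (c i)) (hip : G.Adj z (c (i + p))) :
    ∃ w : G.Walk z z, w.IsCycle ∧ w.length = p + 2 ∧
      w.support.toFinset = insert z ((Finset.Icc i (i + p)).image c) := by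
  have key : ∀ j k, j ≤ p → k ≤ p → c (i + j) = c (i + k) → j = k := by
    intro j k hj hk h
    have h1 : j % L = k % L := Nat.ModEq.add_left_cancel' i (hc.inj _ _ h)
    rwa [Nat.mod_eq_of_lt (by omega), Nat.mod_eq_of_lt (by omega)] at h1
  obtain ⟨q, hq⟩ := exists_walk_support_eq_map_range hc.adj i p
  have hlen : q.length = p := by
    have := q.length_support
    rw [hq] at this
    simpa using this.symm
  have hpath : q.IsPath := by
    rw [Walk.isPath_def, hq]
    refine List.Nodup.map_on ?_ List.nodup_range
    intro j hj k hk h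
    rw [List.mem_range] at hj hk
    exact key j k (by omega) (by omega) h
  have hne : c i ≠ c (i + p) := by
    intro h
    have := key 0 p (by omega) le_rfl h
    omega
  obtain ⟨w, hw, hwl, hws⟩ := hpath.exists_isCycle_insert hne
    (by rw [hq]; simp only [List.mem_map, not_exists, not_and]; intro j _ h; exact hz _ h.symm)
    hi hip
  refine ⟨w, hw, by omega, ?_⟩
  rw [hws, hq]
  congr 1
  ext t
  simp only [List.mem_toFinset, List.mem_map, List.mem_range, Finset.mem_image, Finset.mem_Icc]
  constructor
  · rintro ⟨j, hj, rfl⟩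
    exact ⟨i + j, by omega, rfl⟩
  · rintro ⟨j, hj, rfl⟩
    exact ⟨j - i, by omega, by congr 1; omega⟩

theorem exists_isCycle_replace (hc : G.IsCyclicSeq c L) (hL : 3 ≤ L) {i : ℕ} {z : V}
    (hz : ∀ j, z ≠ c j) (hi : G.Adj z (c (i + 1))) (hi' : G.Adj z (c (i + (L - 1)))) :
    ∃ w : G.Walk z z, w.IsCycle ∧ w.length = L ∧
      w.support.toFinset = insert z (((Finset.range L).image c).erase (c i)) := by
  obtain ⟨w, hw, hwl, hws⟩ := hc.exists_isCycle_arc (i := i + 1) (p := L - 2) (by omega) (by omega)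
    hz hi (by convert hi' using 2; omega)
  refine ⟨w, hw, by omega, ?_⟩
  rw [hws, ← hc.image_range_shift (by omega) i]
  congr 1
  ext t
  simp only [Finset.mem_image, Finset.mem_Icc, Finset.mem_erase, Finset.mem_range]
  constructor
  · rintro ⟨j, hj, rfl⟩
    refine ⟨fun h => ?_, j - i, by omega, by congr 1; omega⟩
    have h1 : (j - i) % L = 0 % L := by
      refine Nat.ModEq.add_right_cancel' i ?_
      rw [Nat.sub_add_cancel (by omega), zero_add]
      exact hc.inj _ _ h
    rw [Nat.mod_eq_of_lt (by omega)] at h1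
    simp at h1
    omega
  · rintro ⟨h, j, hj, rfl⟩
    have : j ≠ 0 := by rintro rfl; simp at h
    exact ⟨j + i, by omega, rfl⟩

end IsCyclicSeq

theorem exists_isCycle_of_hexagon [DecidableEq V] {u₁ u₂ u₃ u₄ u₅ u₆ : V}
    (hnd : [u₁, u₂, u₃, u₄, u₅, u₆].Nodup)
    (h₁ : G.Adj u₁ u₂) (h₂ : G.Adj u₂ u₃) (h₃ : G.Adj u₃ u₄) (h₄ : G.Adj u₄ u₅)
    (h₅ : G.Adj u₅ u₆) (h₆ : G.Adj u₁ u₆) :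
    ∃ w : G.Walk u₁ u₁, w.IsCycle ∧ w.length = 6 ∧
      w.support.toFinset = {u₁, u₂, u₃, u₄, u₅, u₆} := by
  have hp : (Walk.cons h₂ (.cons h₃ (.cons h₄ (.cons h₅ .nil)))).IsPath := by
    rw [Walk.isPath_def]
    simpa using (List.nodup_cons.1 hnd).2
  obtain ⟨w, hw, hl, hs⟩ := hp.exists_isCycle_insert (z := u₁) (by rintro rfl; simp at hnd)
    (by simpa using (List.nodup_cons.1 hnd).1) h₁ h₆
  exact ⟨w, hw, by simpa using hl, by simpa using hs⟩

theorem Walk.IsCycle.exists_isCyclicSeq [DecidableEq V] {u : V} {w : G.Walk u u} (hw : w.IsCycle) :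
    ∃ c, G.IsCyclicSeq c w.length ∧
      w.support.toFinset = (Finset.range w.length).image c := by
  have hL := hw.three_le_length
  have h0 : w.getVert w.length = w.getVert 0 := by simp
  refine ⟨fun i => w.getVert (i % w.length), ⟨fun i => ?_, fun i => ?_, fun i j h => ?_⟩, ?_⟩
  · have hlt := Nat.mod_lt i (show 0 < w.length by omega)
    have h := w.adj_getVert_succ hlt
    rcases Nat.lt_or_ge (i % w.length + 1) w.length with h1 | h1
    · have : (i + 1) % w.length = i % w.length + 1 := by
        rw [Nat.add_mod, Nat.mod_eq_of_lt (show 1 < w.length by omega), Nat.mod_eq_of_lt h1]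
      rwa [this]
    · have e : i % w.length + 1 = w.length := by omega
      have : (i + 1) % w.length = 0 := by
        rw [Nat.add_mod, Nat.mod_eq_of_lt (show 1 < w.length by omega), e, Nat.mod_self]
      rw [this, ← h0, ← e]
      simpa [e] using h
  · simp
  · have hi := Nat.mod_lt i (show 0 < w.length by omega)
    have hj := Nat.mod_lt j (show 0 < w.length by omega)
    exact hw.getVert_injOn' (by simp; omega) (by simp; omega) h
  · ext t
    simp only [List.mem_toFinset, Walk.mem_support_iff_exists_getVert, Finset.mem_image,
      Finset.mem_range]
    constructor
    · rintro ⟨i, rfl, hi⟩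
      rcases hi.lt_or_eq with h | rfl
      · exact ⟨i, h, by rw [Nat.mod_eq_of_lt h]⟩
      · exact ⟨0, by omega, by rw [Nat.zero_mod, h0]⟩
    · rintro ⟨i, hi, rfl⟩
      exact ⟨i, by rw [Nat.mod_eq_of_lt hi], hi.le⟩

theorem Walk.IsCycle.exists_isCyclicSeq_of_bipartite [DecidableEq V] {X Y : Finset V}
    (hdisj : Disjoint X Y)
    (hbip : ∀ u v : V, G.Adj u v → (u ∈ X ∧ v ∈ Y) ∨ (u ∈ Y ∧ v ∈ X))
    {u : V} {w : G.Walk u u} (hw : w.IsCycle) :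
    ∃ c l, 2 ≤ l ∧ w.length = 2 * l ∧ G.IsCyclicSeq c (2 * l) ∧
      w.support.toFinset = (Finset.range (2 * l)).image c ∧
      (∀ i, c (2 * i) ∈ X) ∧ ∀ i, c (2 * i + 1) ∈ Y := by
  have hL := hw.three_le_length
  have hXY : ∀ t, t ∈ X → t ∉ Y := fun t h1 h2 => Finset.disjoint_left.1 hdisj h1 h2
  obtain ⟨c, hc, hs, h0⟩ : ∃ c, G.IsCyclicSeq c w.length ∧
      w.support.toFinset = (Finset.range w.length).image c ∧ c 0 ∈ X := by
    obtain ⟨c, hc, hs⟩ := hw.exists_isCyclicSeq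
    rcases hbip _ _ (hc.adj 0) with h | h
    · exact ⟨c, hc, hs, h.1⟩
    · exact ⟨_, hc.shift 1, hs.trans (hc.image_range_shift (by omega) 1).symm, h.2⟩
  have hX : ∀ i, c (2 * i) ∈ X ∧ c (2 * i + 1) ∈ Y := by
    intro i
    induction i with
    | zero => exact ⟨h0, by grind [hc.adj 0]⟩
    | succ i ih =>
      have h1 : c (2 * (i + 1)) ∈ X := by grind [hc.adj (2 * i + 1)]
      exact ⟨h1, by grind [hc.adj (2 * (i + 1))]⟩
  obtain ⟨l, hl | hl⟩ := Nat.even_or_odd' w.length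
  · rw [hl] at hc hs
    exact ⟨c, l, by omega, hl, hc, hs, fun i => (hX i).1, fun i => (hX i).2⟩
  · have := hc.periodic 0
    rw [zero_add, hl] at this
    exact absurd (this ▸ (hX l).2) (hXY _ h0)


/-- One can trade `x` and `y` for adjacent vertices of `C`, with the remaining vertices spanning a
cycle of length `L`. -/
def Exchangeable [DecidableEq V] (G : SimpleGraph V) (S C : Finset V) (x y : V) (L : ℕ) : Prop :=
  ∃ (u : V) (w : G.Walk u u) (x' y' : V), w.IsCycle ∧ w.length = L ∧ G.Adj x' y' ∧ x' ∈ S ∧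
    x' ∉ w.support.toFinset ∧ y' ∉ w.support.toFinset ∧
    insert x' (insert y' w.support.toFinset) = insert x (insert y C)

namespace IsCyclicSeq

variable {c : ℕ → V} {l : ℕ} {S : Finset V} {x y : V}

theorem apply_two_mul_eq_iff (hc : G.IsCyclicSeq c (2 * l)) {i j : ℕ} (hi : i < l) (hj : j < l) :
    c (2 * i) = c (2 * j) ↔ i = j := by
  refine ⟨fun h => ?_, fun h => by rw [h]⟩
  have := hc.inj _ _ h
  rw [Nat.mod_eq_of_lt (by omega), Nat.mod_eq_of_lt (by omega)] at this
  omega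

variable [DecidableEq V]

theorem exists_two_mem (hodd : ∀ i, c (2 * i + 1) ∉ S)
    (hS : 2 ≤ (S ∩ (Finset.range (2 * l)).image c).card) :
    ∃ j k, j < k ∧ k < l ∧ c (2 * j) ∈ S ∧ c (2 * k) ∈ S := by
  have key : ∀ t ∈ S ∩ (Finset.range (2 * l)).image c, ∃ j < l, c (2 * j) = t := by
    intro t ht
    obtain ⟨htS, ht⟩ := Finset.mem_inter.1 ht
    obtain ⟨i, hi, rfl⟩ := Finset.mem_image.1 ht
    rw [Finset.mem_range] at hi
    obtain ⟨j, rfl | rfl⟩ := Nat.even_or_odd' i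
    · exact ⟨j, by omega, rfl⟩
    · exact absurd htS (hodd j)
  obtain ⟨s, hs, t, ht, hne⟩ := Finset.one_lt_card.1 hS
  obtain ⟨j, hj, rfl⟩ := key s hs
  obtain ⟨k, hk, rfl⟩ := key t ht
  have hs := (Finset.mem_inter.1 hs).1
  have ht := (Finset.mem_inter.1 ht).1
  rcases lt_trichotomy j k with h | rfl | h
  · exact ⟨j, k, h, hk, hs, ht⟩
  · exact absurd rfl hne
  · exact ⟨k, j, h, hj, ht, hs⟩

theorem two_le_card_inter {D : Finset V} {s t : V} (hs : s ∈ S) (ht : t ∈ S) (hst : s ≠ t)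
    (hs' : s ∈ D) (ht' : t ∈ D) : 2 ≤ (S ∩ D).card :=
  Finset.one_lt_card.2 ⟨s, by simp [*], t, by simp [*], hst⟩

theorem image_Icc_subset (hc : G.IsCyclicSeq c (2 * l)) (hl : 2 ≤ l) (i j : ℕ) :
    (Finset.Icc i j).image c ⊆ (Finset.range (2 * l)).image c := by
  intro t ht
  obtain ⟨k, -, rfl⟩ := Finset.mem_image.1 ht
  exact hc.apply_mem_image_range (by omega) k

theorem le_of_adj_even (hc : G.IsCyclicSeq c (2 * l)) (hl : 2 ≤ l) (hy : ∀ j, y ≠ c j)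
    (hmin : ∀ (u : V) (w : G.Walk u u), w.IsCycle →
      w.support.toFinset ⊆ insert x (insert y ((Finset.range (2 * l)).image c)) →
      2 ≤ (S ∩ w.support.toFinset).card → 2 * l ≤ w.length)
    {i p j k : ℕ} (hp : 1 ≤ p) (hpl : p < l) (hi : G.Adj y (c (2 * i)))
    (hip : G.Adj y (c (2 * (i + p)))) (hij : i ≤ j) (hjk : j < k) (hk : k ≤ i + p)
    (hjS : c (2 * j) ∈ S) (hkS : c (2 * k) ∈ S) : l ≤ p + 1 := by
  obtain ⟨w, hw, hwl, hws⟩ := hc.exists_isCycle_arc (i := 2 * i) (p := 2 * p) (by omega) (by omega)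
    hy hi (by convert hip using 2; ring)
  have hne : c (2 * j) ≠ c (2 * k) := by
    intro h
    have h1 := hc.inj _ _ h
    have h2 := (Nat.modEq_iff_dvd' (by omega)).1 h1
    have := Nat.le_of_dvd (by omega) h2
    omega
  have h := hmin _ w hw
    (by
      rw [hws]
      exact (Finset.insert_subset_insert _ (hc.image_Icc_subset hl _ _)).trans
        (Finset.subset_insert _ _))
    (two_le_card_inter hjS hkS hne
      (by
        rw [hws]
        exact Finset.mem_insert_of_mem
          (Finset.mem_image_of_mem _ (Finset.mem_Icc.2 ⟨by omega, by omega⟩)))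
      (by
        rw [hws]
        exact Finset.mem_insert_of_mem
          (Finset.mem_image_of_mem _ (Finset.mem_Icc.2 ⟨by omega, by omega⟩))))
  omega

theorem le_of_adj_odd (hc : G.IsCyclicSeq c (2 * l)) (hl : 2 ≤ l) (hx : ∀ j, x ≠ c j)
    (hxS : x ∈ S)
    (hmin : ∀ (u : V) (w : G.Walk u u), w.IsCycle →
      w.support.toFinset ⊆ insert x (insert y ((Finset.range (2 * l)).image c)) →
      2 ≤ (S ∩ w.support.toFinset).card → 2 * l ≤ w.length)
    {i p j : ℕ} (hp : 1 ≤ p) (hpl : p < l) (hi : G.Adj x (c (2 * i + 1)))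
    (hip : G.Adj x (c (2 * (i + p) + 1))) (hij : i < j) (hjp : j ≤ i + p)
    (hjS : c (2 * j) ∈ S) : l ≤ p + 1 := by
  obtain ⟨w, hw, hwl, hws⟩ := hc.exists_isCycle_arc (i := 2 * i + 1) (p := 2 * p) (by omega)
    (by omega) hx hi (by convert hip using 2; ring)
  have h := hmin _ w hw
    (by
      rw [hws]
      exact Finset.insert_subset_insert _ ((hc.image_Icc_subset hl _ _).trans
        (Finset.subset_insert _ _)))
    (two_le_card_inter hxS hjS (hx _) (by simp)
      (by
        rw [hws]
        exact Finset.mem_insert_of_mem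
          (Finset.mem_image_of_mem _ (Finset.mem_Icc.2 ⟨by omega, by omega⟩))))
  omega

theorem exchangeable_of_adj_around_zero (hc : G.IsCyclicSeq c (2 * l)) (hl : 3 ≤ l)
    (hx : ∀ j, x ≠ c j) (hy : ∀ j, y ≠ c j) (hxy : x ≠ y) (hxS : x ∈ S)
    (hodd : ∀ i, c (2 * i + 1) ∉ S)
    (hS : 2 ≤ (S ∩ (Finset.range (2 * l)).image c).card)
    (hmin : ∀ (u : V) (w : G.Walk u u), w.IsCycle →
      w.support.toFinset ⊆ insert x (insert y ((Finset.range (2 * l)).image c)) →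
      2 ≤ (S ∩ w.support.toFinset).card → 2 * l ≤ w.length)
    (h0 : c 0 ∉ S) (hx1 : G.Adj x (c 1)) (hxl : G.Adj x (c (2 * l - 1)))
    (hyc : ∀ i j, c (2 * i) ≠ c (2 * j) → G.Adj y (c (2 * i)) ∨ G.Adj y (c (2 * j))) :
    Exchangeable G S ((Finset.range (2 * l)).image c) x y (2 * l) := by
  obtain ⟨j, k, hjk, hk, hjS, hkS⟩ := exists_two_mem hodd hS
  have hj0 : j ≠ 0 := by rintro rfl; exact h0 hjS
  have hmem := hc.apply_mem_image_range (by omega)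
  have hinj : ∀ i j, i < 2 * l → j < 2 * l → i ≠ j → c i ≠ c j := by
    intro i j hi hj hij h
    have := hc.inj _ _ h
    rw [Nat.mod_eq_of_lt hi, Nat.mod_eq_of_lt hj] at this
    exact hij this
  have hlast : c (2 * l) = c 0 := by simpa using hc.periodic 0
  have hC : l = 3 → (Finset.range (2 * l)).image c = {c 0, c 1, c 2, c 3, c 4, c 5} := by
    rintro rfl
    rw [show Finset.range (2 * 3) = {0, 1, 2, 3, 4, 5} from rfl]
    simp
  by_cases hyk : G.Adj y (c (2 * k))
  · by_cases hyj : G.Adj y (c (2 * j))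
    · have := hc.le_of_adj_even (by omega) hy hmin (i := j) (p := k - j) (j := j) (k := k)
        (by omega) (by omega) hyj (by convert hyk using 3; omega) le_rfl hjk (by omega) hjS hkS
      omega
    have hy0 : G.Adj y (c 0) :=
      (hyc 0 j ((hc.apply_two_mul_eq_iff (by omega) (by omega)).not.2 hj0.symm)).resolve_right hyj
    have h1 := hc.le_of_adj_even (by omega) hy hmin (i := 0) (p := k) (j := j) (k := k)
      (by omega) (by omega) hy0 (by simpa using hyk) (by omega) hjk (by omega) hjS hkS
    obtain rfl : l = k + 1 := by omega
    have hadj := hc.adj (2 * k)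
    rw [show 2 * (k + 1) - 1 = 2 * k + 1 by omega] at hxl
    obtain ⟨w, hw, hwl, hws⟩ := exists_isCycle_of_hexagon
      (u₁ := y) (u₂ := c (2 * k)) (u₃ := c (2 * k + 1)) (u₄ := x) (u₅ := c 1) (u₆ := c 0)
      (by
        have e1 := hinj (2 * k) (2 * k + 1) (by omega) (by omega) (by omega)
        have e2 := hinj (2 * k) 1 (by omega) (by omega) (by omega)
        have e3 := hinj (2 * k) 0 (by omega) (by omega) (by omega)
        have e4 := hinj (2 * k + 1) 1 (by omega) (by omega) (by omega)
        have e5 := hinj (2 * k + 1) 0 (by omega) (by omega) (by omega)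
        have e6 := hinj 1 0 (by omega) (by omega) (by omega)
        simp [hx, hy, hxy.symm, e1, e2, e3, e4, e5, e6, fun j => (hx j).symm])
      hyk hadj hxl.symm hx1 (hc.adj 0).symm hy0
    have h3 := hmin _ w hw
      (by rw [hws]; intro t; simp only [Finset.mem_insert, Finset.mem_singleton]; grind)
      (two_le_card_inter hxS hkS (hx _) (by simp [hws]) (by simp [hws]))
    obtain rfl : k = 2 := by omega
    obtain rfl : j = 1 := by omega
    refine ⟨_, w, c 2, c 3, hw, by omega, hc.adj 2, hjS, ?_, ?_, ?_⟩
    · rw [hws]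
      have e1 := fun i => hinj 2 i (by omega)
      have e2 := fun i => (hx i).symm
      have e3 := fun i => (hy i).symm
      simp [e1, e2, e3]
    · rw [hws]
      have e1 := fun i => hinj 3 i (by omega)
      have e2 := fun i => (hx i).symm
      have e3 := fun i => (hy i).symm
      simp [e1, e2, e3]
    · rw [hws, hC rfl]
      ext t
      simp only [Finset.mem_insert, Finset.mem_singleton]
      grind
  · have hyj : G.Adj y (c (2 * j)) :=
      (hyc j k ((hc.apply_two_mul_eq_iff (by omega) (by omega)).not.2 hjk.ne)).resolve_right hyk
    have hy0 : G.Adj y (c 0) :=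
      (hyc 0 k ((hc.apply_two_mul_eq_iff (by omega) (by omega)).not.2 (by omega))).resolve_right hyk
    have h1 := hc.le_of_adj_even (by omega) hy hmin (i := j) (p := l - j) (j := j) (k := k)
      (by omega) (by omega) hyj
      (by rw [show 2 * (j + (l - j)) = 2 * l by omega, hlast]; exact hy0)
      le_rfl hjk (by omega) hjS hkS
    obtain rfl : j = 1 := by omega
    have hadj : G.Adj (c (2 * l - 1)) (c 0) := by
      have := hc.adj (2 * l - 1)
      rwa [show 2 * l - 1 + 1 = 2 * l by omega, hlast] at this
    obtain ⟨w, hw, hwl, hws⟩ := exists_isCycle_of_hexagon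
      (u₁ := y) (u₂ := c (2 * 1)) (u₃ := c 1) (u₄ := x) (u₅ := c (2 * l - 1)) (u₆ := c 0)
      (by
        have e1 := hinj (2 * 1) 1 (by omega) (by omega) (by omega)
        have e2 := hinj (2 * 1) (2 * l - 1) (by omega) (by omega) (by omega)
        have e3 := hinj (2 * 1) 0 (by omega) (by omega) (by omega)
        have e4 := hinj 1 (2 * l - 1) (by omega) (by omega) (by omega)
        have e5 := hinj 1 0 (by omega) (by omega) (by omega)
        have e6 := hinj (2 * l - 1) 0 (by omega) (by omega) (by omega)
        simp at e1 e2 e3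
        simp [hx, hy, hxy.symm, e1, e2, e3, e4, e5, e6, fun j => (hx j).symm])
      hyj (hc.adj 1).symm hx1.symm hxl hadj hy0
    have h3 := hmin _ w hw
      (by rw [hws]; intro t; simp only [Finset.mem_insert, Finset.mem_singleton]; grind)
      (two_le_card_inter hxS hjS (hx _) (by simp [hws]) (by simp [hws]))
    obtain rfl : l = 3 := by omega
    obtain rfl : k = 2 := by omega
    refine ⟨_, w, c 4, c 3, hw, by omega, (hc.adj 3).symm, hkS, ?_, ?_, ?_⟩
    · rw [hws]
      have e1 := fun i => hinj 4 i (by omega)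
      have e2 := fun i => (hx i).symm
      have e3 := fun i => (hy i).symm
      simp [e1, e2, e3]
    · rw [hws]
      have e1 := fun i => hinj 3 i (by omega)
      have e2 := fun i => (hx i).symm
      have e3 := fun i => (hy i).symm
      simp [e1, e2, e3]
    · rw [hws, hC rfl]
      ext t
      simp only [Finset.mem_insert, Finset.mem_singleton]
      grind

theorem exchangeable_of_replace (hc : G.IsCyclicSeq c (2 * l)) (hl : 2 ≤ l) {z x' y' : V} {i : ℕ}
    (hx : ∀ j, x ≠ c j) (hy : ∀ j, y ≠ c j) (hxy : x ≠ y)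
    (hz : G.Adj z (c (i + 1))) (hz' : G.Adj z (c (i + (2 * l - 1))))
    (hadj : G.Adj x' y') (hx'S : x' ∈ S)
    (h : (z = x ∧ x' = c i ∧ y' = y) ∨ (z = y ∧ x' = x ∧ y' = c i)) :
    Exchangeable G S ((Finset.range (2 * l)).image c) x y (2 * l) := by
  have hmem := hc.apply_mem_image_range (by omega)
  obtain ⟨w, hw, hwl, hws⟩ := hc.exists_isCycle_replace (by omega) (i := i) (z := z)
    (by rcases h with ⟨rfl, -⟩ | ⟨rfl, -⟩ <;> assumption) hz hz'
  have hxC : x ∉ (Finset.range (2 * l)).image c := by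
    simp only [Finset.mem_image, not_exists, not_and]
    exact fun j _ h => hx j h.symm
  have hyC : y ∉ (Finset.range (2 * l)).image c := by
    simp only [Finset.mem_image, not_exists, not_and]
    exact fun j _ h => hy j h.symm
  have hi := hmem i
  refine ⟨_, w, x', y', hw, hwl, hadj, hx'S, ?_, ?_, ?_⟩ <;> rw [hws]
  · grind
  · grind
  · ext t
    simp only [Finset.mem_insert, Finset.mem_erase]
    grind

theorem exchangeable [DecidableRel G.Adj] (hc : G.IsCyclicSeq c (2 * l)) (hl : 2 ≤ l)
    (hx : ∀ j, x ≠ c j) (hy : ∀ j, y ≠ c j) (hxy : x ≠ y) (hxS : x ∈ S)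
    (hodd : ∀ i, c (2 * i + 1) ∉ S)
    (hS : 2 ≤ (S ∩ (Finset.range (2 * l)).image c).card)
    (hmin : ∀ (u : V) (w : G.Walk u u), w.IsCycle →
      w.support.toFinset ⊆ insert x (insert y ((Finset.range (2 * l)).image c)) →
      2 ≤ (S ∩ w.support.toFinset).card → 2 * l ≤ w.length)
    (hdeg : l + 1 ≤ ((Finset.range l).filter fun i => G.Adj x (c (2 * i + 1))).card +
      ((Finset.range l).filter fun i => G.Adj y (c (2 * i))).card) :
    Exchangeable G S ((Finset.range (2 * l)).image c) x y (2 * l) := by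
  obtain ⟨j, k, hjk, hk, hjS, hkS⟩ := exists_two_mem hodd hS
  set A := (Finset.range l).filter fun i => G.Adj x (c (2 * i + 1)) with hA
  set B := (Finset.range l).filter fun i => G.Adj y (c (2 * i)) with hB
  have hAl : A.card ≤ l := (Finset.card_filter_le _ _).trans (Finset.card_range l).le
  have hBl : B.card ≤ l := (Finset.card_filter_le _ _).trans (Finset.card_range l).le
  have hper : ∀ i m, m = i + 2 * l → c m = c i := by rintro i m rfl; exact hc.periodic i
  have hfull : B.card = l → ∀ i < l, G.Adj y (c (2 * i)) := by
    intro h i hi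
    have : B = Finset.range l :=
      Finset.eq_of_subset_of_card_le (Finset.filter_subset _ _) (by simp [h])
    have hi' : i ∈ B := by rw [this]; exact Finset.mem_range.2 hi
    exact (Finset.mem_filter.1 hi').2
  have hA2 : 2 ≤ A.card → ∃ i m, i < m ∧ m < l ∧ G.Adj x (c (2 * i + 1)) ∧
      G.Adj x (c (2 * m + 1)) := by
    intro h
    obtain ⟨i, hi, m, hm, hne⟩ := Finset.one_lt_card.1 h
    simp only [hA, Finset.mem_filter, Finset.mem_range] at hi hm
    rcases lt_or_gt_of_ne hne with h | h
    · exact ⟨i, m, h, hm.1, hi.2, hm.2⟩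
    · exact ⟨m, i, h, hi.1, hm.2, hi.2⟩
  rcases hl.eq_or_lt with rfl | hl
  · obtain rfl : k = 1 := by omega
    obtain rfl : j = 0 := by omega
    rcases Nat.lt_or_ge A.card 2 with h | h
    · have hall := hfull (by omega)
      obtain ⟨i, hi⟩ := Finset.card_pos.1 (show 0 < A.card by omega)
      simp only [hA, Finset.mem_filter, Finset.mem_range] at hi
      have hy0 := hall 0 (by omega)
      have hy1 := hall 1 (by omega)
      refine hc.exchangeable_of_replace le_rfl (z := y) (i := 2 * i + 1) hx hy hxy ?_ ?_ hi.2 hxS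
        (.inr ⟨rfl, rfl, rfl⟩)
      · obtain ⟨h, -⟩ := hi
        interval_cases i
        · exact hy1
        · rw [hper 0 _ (by omega)]; exact hy0
      · obtain ⟨h, -⟩ := hi
        interval_cases i
        · rw [hper 0 _ (by omega)]; exact hy0
        · rw [hper 2 _ (by omega)]; exact hy1
    · obtain ⟨i, m, him, hm, hxi, hxm⟩ := hA2 h
      obtain rfl : m = 1 := by omega
      obtain rfl : i = 0 := by omega
      obtain ⟨i, hi⟩ := Finset.card_pos.1 (show 0 < B.card by omega)
      simp only [hB, Finset.mem_filter, Finset.mem_range] at hi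
      obtain ⟨hi, hyi⟩ := hi
      refine hc.exchangeable_of_replace le_rfl (z := x) (i := 2 * i) hx hy hxy ?_ ?_ hyi.symm ?_
        (.inl ⟨rfl, rfl, rfl⟩)
      · interval_cases i <;> assumption
      · interval_cases i
        · exact hxm
        · rw [hper 1 _ (by omega)]; exact hxi
      · interval_cases i <;> assumption
  have hxarc : ∀ i p m, 1 ≤ p → p + 1 < l → G.Adj x (c (2 * i + 1)) →
      G.Adj x (c (2 * (i + p) + 1)) → i < m → m ≤ i + p → c (2 * m) ∉ S := by
    intro i p m hp hpl hi hip him hmp hmS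
    have := hc.le_of_adj_odd hl.le hx hxS hmin hp (by omega) hi hip him hmp hmS
    omega
  have hBl' : B.card ≠ l := by
    intro h
    have hall := hfull h
    have h1 := hc.le_of_adj_even hl.le hy hmin (i := j) (p := k - j) (j := j) (k := k)
      (by omega) (by omega) (hall j (by omega))
      (by rw [show j + (k - j) = k by omega]; exact hall k hk) le_rfl hjk (by omega) hjS hkS
    have e : c (2 * (j + l)) = c (2 * j) := hper _ _ (by ring)
    have h2 := hc.le_of_adj_even hl.le hy hmin (i := k) (p := j + l - k) (j := k) (k := j + l)
      (by omega) (by omega) (hall k hk)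
      (by rw [show k + (j + l - k) = j + l by omega, e]; exact hall j (by omega))
      le_rfl (by omega) (by omega) hkS (by rwa [e])
    omega
  have hgap : ∀ i m r, i < m → m < r → r < l → G.Adj x (c (2 * i + 1)) →
      G.Adj x (c (2 * m + 1)) → G.Adj x (c (2 * r + 1)) → False := by
    intro i m r him hmr hr hxi hxm hxr
    have e : c (2 * (j + l)) = c (2 * j) := hper _ _ (by ring)
    have e' : c (2 * (i + l) + 1) = c (2 * i + 1) := hper _ _ (by ring)
    have a1 := hxarc i (m - i) j (by omega) (by omega) hxi
      (by rw [show i + (m - i) = m by omega]; exact hxm)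
    have a2 := hxarc m (r - m) j (by omega) (by omega) hxm
      (by rw [show m + (r - m) = r by omega]; exact hxr)
    have a3 := hxarc r (i + l - r) j (by omega) (by omega) hxr
      (by rw [show r + (i + l - r) = i + l by omega, e']; exact hxi)
    have a4 := hxarc r (i + l - r) (j + l) (by omega) (by omega) hxr
      (by rw [show r + (i + l - r) = i + l by omega, e']; exact hxi)
    rw [e] at a4
    have b1 : ¬ (i < j ∧ j ≤ i + (m - i)) := fun h => a1 h.1 h.2 hjS
    have b2 : ¬ (m < j ∧ j ≤ m + (r - m)) := fun h => a2 h.1 h.2 hjS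
    have b3 : ¬ (r < j ∧ j ≤ r + (i + l - r)) := fun h => a3 h.1 h.2 hjS
    have b4 : ¬ (r < j + l ∧ j + l ≤ r + (i + l - r)) := fun h => a4 h.1 h.2 hjS
    omega
  have hA3 : A.card ≤ 2 := by
    by_contra! h
    obtain ⟨i, m, r, hi, hm, hr, h1, h2, h3⟩ := Finset.two_lt_card.1 h
    simp only [hA, Finset.mem_filter, Finset.mem_range] at hi hm hr
    rcases lt_or_gt_of_ne h1 with h1 | h1 <;> rcases lt_or_gt_of_ne h2 with h2 | h2 <;>
      rcases lt_or_gt_of_ne h3 with h3 | h3 <;> grind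
  have hyc : ∀ i m, c (2 * i) ≠ c (2 * m) → G.Adj y (c (2 * i)) ∨ G.Adj y (c (2 * m)) := by
    have hmod : ∀ i, c (2 * (i % l)) = c (2 * i) := by
      intro i
      rw [← Nat.mul_mod_mul_left, hc.apply_mod]
    intro i m hne
    by_contra! hcon
    rw [← hmod i, ← hmod m] at hcon hne
    have hi := Nat.mod_lt i (show 0 < l by omega)
    have hm := Nat.mod_lt m (show 0 < l by omega)
    have hsub : B ⊆ ((Finset.range l).erase (i % l)).erase (m % l) := by
      intro t ht
      simp only [hB, Finset.mem_filter, Finset.mem_range, Finset.mem_erase] at ht ⊢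
      refine ⟨?_, ?_, ht.1⟩
      · rintro rfl; exact hcon.2 ht.2
      · rintro rfl; exact hcon.1 ht.2
    have hcard := Finset.card_le_card hsub
    rw [Finset.card_erase_of_mem, Finset.card_erase_of_mem, Finset.card_range] at hcard
    · omega
    · simpa using hi
    · simp only [Finset.mem_erase, Finset.mem_range]
      exact ⟨fun h => hne (by rw [h]), hm⟩
  obtain ⟨s, hxs, hxs', hsS⟩ : ∃ s, G.Adj x (c (1 + 2 * s)) ∧ G.Adj x (c (2 * l - 1 + 2 * s)) ∧
      c (0 + 2 * s) ∉ S := by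
    obtain ⟨i, m, him, hm, hxi, hxm⟩ := hA2 (by omega)
    have e' : c (2 * (i + l) + 1) = c (2 * i + 1) := hper _ _ (by ring)
    have e : c (2 * (j + l)) = c (2 * j) := hper _ _ (by ring)
    have a1 := fun t ht => hxarc i (m - i) t (by omega) ht hxi
      (by rw [show i + (m - i) = m by omega]; exact hxm)
    have a2 := fun t ht => hxarc m (i + l - m) t (by omega) ht hxm
      (by rw [show m + (i + l - m) = i + l by omega, e']; exact hxi)
    by_cases h1 : m = i + 1
    · subst h1
      refine ⟨i + 1, by convert hxm using 2; ring, ?_, ?_⟩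
      · rw [hper (2 * i + 1) _ (by omega)]; exact hxi
      · rw [zero_add]; exact a1 (i + 1) (by omega) (by omega) (by omega)
    by_cases h2 : m - i + 1 = l
    · obtain rfl : i = 0 := by omega
      obtain rfl : l = m + 1 := by omega
      refine ⟨0, hxi, by convert hxm using 2; omega, ?_⟩
      have h := a2 (m + 1) (by omega) (by omega) (by omega)
      rwa [hper 0 _ (by omega)] at h
    · exfalso
      have b1 : ¬ (i < j ∧ j ≤ i + (m - i)) := fun h => a1 j (by omega) h.1 h.2 hjS
      have b2 : ¬ (m < j ∧ j ≤ m + (i + l - m)) := fun h => a2 j (by omega) h.1 h.2 hjS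
      have b3 : ¬ (m < j + l ∧ j + l ≤ m + (i + l - m)) :=
        fun h => a2 (j + l) (by omega) h.1 h.2 (e ▸ hjS)
      omega
  have himg := hc.image_range_shift (by omega) (2 * s)
  have := (hc.shift (2 * s)).exchangeable_of_adj_around_zero (x := x) (y := y) (S := S) (by omega)
    (fun j => hx _) (fun j => hy _) hxy hxS
    (fun i => by rw [show 2 * i + 1 + 2 * s = 2 * (i + s) + 1 by ring]; exact hodd _)
    (by rwa [himg]) (by rwa [himg]) hsS hxs hxs'
    (fun i m h => by
      simp only [← mul_add] at h ⊢
      exact hyc _ _ h)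
  rwa [himg] at this

end IsCyclicSeq

theorem Walk.IsCycle.two_mul_card_inter [DecidableEq V] {X Y : Finset V} (hdisj : Disjoint X Y)
    (hbip : ∀ u v : V, G.Adj u v → (u ∈ X ∧ v ∈ Y) ∨ (u ∈ Y ∧ v ∈ X))
    {u : V} {w : G.Walk u u} (hw : w.IsCycle) :
    2 * (X ∩ w.support.toFinset).card = w.length := by
  obtain ⟨c, l, hl, hwl, hc, hs, hcX, hcY⟩ := hw.exists_isCyclicSeq_of_bipartite hdisj hbip
  have : X ∩ w.support.toFinset = (Finset.range l).image fun i => c (2 * i) := by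
    ext t
    simp only [hs, Finset.mem_inter, Finset.mem_image, Finset.mem_range]
    constructor
    · rintro ⟨ht, i, hi, rfl⟩
      obtain ⟨j, rfl | rfl⟩ := Nat.even_or_odd' i
      · exact ⟨j, by omega, rfl⟩
      · exact absurd (hcY j) (Finset.disjoint_left.1 hdisj ht)
    · rintro ⟨j, hj, rfl⟩
      exact ⟨hcX j, _, by omega, rfl⟩
  rw [this, Finset.card_image_of_injOn, Finset.card_range, hwl]
  intro i hi j hj h
  exact (hc.apply_two_mul_eq_iff (by simpa using hi) (by simpa using hj)).1 h

theorem Walk.IsCycle.exchangeable [DecidableEq V] [DecidableRel G.Adj] {X Y S : Finset V}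
    (hdisj : Disjoint X Y)
    (hbip : ∀ u v : V, G.Adj u v → (u ∈ X ∧ v ∈ Y) ∨ (u ∈ Y ∧ v ∈ X)) (hSX : S ⊆ X)
    {u : V} {w : G.Walk u u} (hw : w.IsCycle) {x y : V} (hxS : x ∈ S) (hyY : y ∈ Y)
    (hx : x ∉ w.support.toFinset) (hy : y ∉ w.support.toFinset)
    (hS : 2 ≤ (S ∩ w.support.toFinset).card)
    (hmin : ∀ (u' : V) (w' : G.Walk u' u'), w'.IsCycle →
      w'.support.toFinset ⊆ insert x (insert y w.support.toFinset) →
      2 ≤ (S ∩ w'.support.toFinset).card → w.length ≤ w'.length)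
    (hdeg : (X ∩ w.support.toFinset).card < (w.support.toFinset.filter (G.Adj x)).card +
      (w.support.toFinset.filter (G.Adj y)).card) :
    Exchangeable G S w.support.toFinset x y w.length := by
  have hcard := hw.two_mul_card_inter hdisj hbip
  obtain ⟨c, l, hl, hwl, hc, hs, hcX, hcY⟩ := hw.exists_isCyclicSeq_of_bipartite hdisj hbip
  have hXY : ∀ {t}, t ∈ X → t ∉ Y := @(Finset.disjoint_left.1 hdisj)
  have hmem := hc.apply_mem_image_range (by omega)
  rw [hs] at hx hy hS hmin hdeg hcard ⊢
  rw [hwl] at hmin hcard ⊢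
  refine hc.exchangeable hl (fun j h => hx (h ▸ hmem j)) (fun j h => hy (h ▸ hmem j))
    (by rintro rfl; exact hXY (hSX hxS) hyY) hxS (fun i h => hXY (hSX h) (hcY i)) hS hmin ?_
  have h1 : (((Finset.range (2 * l)).image c).filter (G.Adj x)).card ≤
      ((Finset.range l).filter fun i => G.Adj x (c (2 * i + 1))).card := by
    refine (Finset.card_le_card (fun t ht => ?_)).trans
      (Finset.card_image_le (f := fun i => c (2 * i + 1)))
    simp only [Finset.mem_filter, Finset.mem_image, Finset.mem_range] at ht ⊢
    obtain ⟨⟨i, hi, rfl⟩, ht⟩ := ht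
    obtain ⟨j, rfl | rfl⟩ := Nat.even_or_odd' i
    · exfalso
      grind [hbip _ _ ht, hcX j]
    · exact ⟨j, ⟨by omega, ht⟩, rfl⟩
  have h2 : (((Finset.range (2 * l)).image c).filter (G.Adj y)).card ≤
      ((Finset.range l).filter fun i => G.Adj y (c (2 * i))).card := by
    refine (Finset.card_le_card (fun t ht => ?_)).trans
      (Finset.card_image_le (f := fun i => c (2 * i)))
    simp only [Finset.mem_filter, Finset.mem_image, Finset.mem_range] at ht ⊢
    obtain ⟨⟨i, hi, rfl⟩, ht⟩ := ht
    obtain ⟨j, rfl | rfl⟩ := Nat.even_or_odd' i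
    · exact ⟨j, ⟨by omega, ht⟩, rfl⟩
    · exfalso
      grind [hbip _ _ ht, hcY j]
  omega

end SimpleGraph

open SimpleGraph

theorem Finset.exists_injOn_of_forall_card_le_card_biUnion {α : Type*} [DecidableEq α]
    (T : Finset α) (t : α → Finset α) (h : ∀ A ⊆ T, A.card ≤ (A.biUnion t).card) :
    ∃ f : α → α, Set.InjOn f T ∧ ∀ x ∈ T, f x ∈ t x := by
  have := (Finset.all_card_le_biUnion_card_iff_exists_injective
    (fun x : T => t x)).1 (by
      intro A
      have := h (A.map (Function.Embedding.subtype _)) (by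
        intro a ha
        simp only [Finset.mem_map, Function.Embedding.subtype_apply] at ha
        obtain ⟨b, -, rfl⟩ := ha
        exact b.2)
      rw [Finset.card_map] at this
      refine this.trans (Finset.card_le_card ?_)
      intro b hb
      simp only [Finset.mem_biUnion, Finset.mem_map, Function.Embedding.subtype_apply] at hb ⊢
      obtain ⟨_, ⟨a, ha, rfl⟩, hb⟩ := hb
      exact ⟨a, ha, hb⟩)
  obtain ⟨f, hf, hft⟩ := this
  refine ⟨fun x => if hx : x ∈ T then f ⟨x, hx⟩ else x, ?_, ?_⟩
  · intro a ha b hb hab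
    have ha : a ∈ T := ha
    have hb : b ∈ T := hb
    simp only [ha, hb, dite_true] at hab
    simpa using hf hab
  · intro a ha
    simp only [ha, dite_true]
    exact hft ⟨a, ha⟩

theorem Finset.card_filter_eq_add_sum_of_pairwiseDisjoint {V ι : Type*} [Fintype V] [DecidableEq V]
    [Fintype ι] (F : ι → Finset V) (hF : ∀ i j, i ≠ j → Disjoint (F i) (F j))
    (p : V → Prop) [DecidablePred p] :
    (univ.filter p).card =
      ((univ \ univ.biUnion F).filter p).card + ∑ i, ((F i).filter p).card := by
  rw [← card_biUnion (fun i _ j _ hij => disjoint_filter_filter (hF i j hij)), ← filter_biUnion,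
    ← card_union_of_disjoint (disjoint_filter_filter sdiff_disjoint), ← filter_union,
    sdiff_union_of_subset (subset_univ _)]

section Exchange

variable {V ι : Type*} [DecidableEq V] {G : SimpleGraph V}

/-- The set of vertices lying on a family of closed walks. -/
def walkVerts [Fintype ι] (D : ι → Σ u, G.Walk u u) : Finset V :=
  Finset.univ.biUnion fun i => (D i).2.support.toFinset

/-- A family of disjoint cycles, each with at least two vertices in `S`. -/
structure IsFeasibleSystem_s13 (S : Finset V) (D : ι → Σ u, G.Walk u u) : Prop where
  isCycle : ∀ i, (D i).2.IsCycle
  feasible : ∀ i, 2 ≤ (S ∩ (D i).2.support.toFinset).card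
  disjoint : ∀ i j, i ≠ j → Disjoint (D i).2.support.toFinset (D j).2.support.toFinset

/-- `f` maps `T` injectively to neighbours outside `U`. -/
structure IsMatchingOutside (G : SimpleGraph V) (S U T : Finset V) (f : V → V) : Prop where
  subset : T ⊆ S \ U
  adj : ∀ x ∈ T, G.Adj x (f x)
  notMem : ∀ x ∈ T, f x ∉ U
  injOn : Set.InjOn f T

theorem IsMatchingOutside.exists_violator [Fintype V] [DecidableRel G.Adj] {S U T : Finset V}
    {f : V → V} {x : V}
    (hf : IsMatchingOutside G S U T f) (hxS : x ∈ S \ U)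
    (hmax : ∀ g, ¬ IsMatchingOutside G S U (insert x T) g) :
    ∃ A ⊆ insert x T, x ∈ A ∧
      (A.biUnion fun a => (Finset.univ \ U).filter (G.Adj a)) = (A.erase x).image f ∧
      (A.biUnion fun a => (Finset.univ \ U).filter (G.Adj a)).card < A.card := by
  set N : V → Finset V := fun a => (Finset.univ \ U).filter (G.Adj a) with hN
  have hNf : ∀ t ∈ T, f t ∈ N t := fun t ht => by simp [hN, hf.adj t ht, hf.notMem t ht]
  obtain ⟨A, hA, hAc⟩ : ∃ A ⊆ insert x T, (A.biUnion N).card < A.card := by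
    by_contra! h
    obtain ⟨g, hg, hgN⟩ := Finset.exists_injOn_of_forall_card_le_card_biUnion _ N h
    refine hmax g ⟨Finset.insert_subset hxS hf.subset, fun t ht => ?_, fun t ht => ?_, hg⟩
    · exact (Finset.mem_filter.1 (hgN t ht)).2
    · exact (Finset.mem_sdiff.1 (Finset.mem_filter.1 (hgN t ht)).1).2
  have hAT : ∀ a ∈ A, a ≠ x → a ∈ T := fun a ha hax =>
    (Finset.mem_insert.1 (hA ha)).resolve_left hax
  have hsub : (A.erase x).image f ⊆ A.biUnion N := by
    intro t ht
    obtain ⟨a, ha, rfl⟩ := Finset.mem_image.1 ht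
    rw [Finset.mem_erase] at ha
    exact Finset.mem_biUnion.2 ⟨a, ha.2, hNf a (hAT a ha.2 ha.1)⟩
  have himg : ((A.erase x).image f).card = (A.erase x).card := by
    refine Finset.card_image_of_injOn (hf.injOn.mono fun a ha => ?_)
    have ha := Finset.mem_erase.1 (Finset.mem_coe.1 ha)
    exact hAT a ha.2 ha.1
  have hle := Finset.card_le_card hsub
  have hxA : x ∈ A := by
    by_contra hxA
    rw [himg, Finset.erase_eq_of_notMem hxA] at hle
    omega
  refine ⟨A, hA, hxA, (Finset.eq_of_subset_of_card_le hsub ?_).symm, hAc⟩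
  rw [himg, Finset.card_erase_of_mem hxA]
  omega

theorem IsFeasibleSystem_s13.update [DecidableEq ι] {S : Finset V} {D : ι → Σ u, G.Walk u u}
    (hD : IsFeasibleSystem_s13 S D) (i : ι) {u : V} {w : G.Walk u u} (hw : w.IsCycle)
    (hS : 2 ≤ (S ∩ w.support.toFinset).card)
    (hdisj : ∀ j ≠ i, Disjoint w.support.toFinset (D j).2.support.toFinset) :
    IsFeasibleSystem_s13 S (Function.update D i ⟨u, w⟩) where
  isCycle j := by
    by_cases h : j = i
    · subst h; rw [Function.update_self]; exact hw
    · rw [Function.update_of_ne h]; exact hD.isCycle j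
  feasible j := by
    by_cases h : j = i
    · subst h; rw [Function.update_self]; exact hS
    · rw [Function.update_of_ne h]; exact hD.feasible j
  disjoint j m hjm := by
    by_cases h : j = i
    · subst h
      rw [Function.update_self, Function.update_of_ne hjm.symm]
      exact hdisj m hjm.symm
    · rw [Function.update_of_ne h]
      by_cases h' : m = i
      · subst h'; rw [Function.update_self]; exact (hdisj j h).symm
      · rw [Function.update_of_ne h']; exact hD.disjoint j m hjm

theorem IsFeasibleSystem_s13.exists_larger_matching [Fintype V] [Fintype ι] [DecidableRel G.Adj]
    {X Y S : Finset V} {n : ℕ}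
    (hdisj : Disjoint X Y) (hX : X.card = n) (hY : Y.card = n)
    (hbip : ∀ u v : V, G.Adj u v → (u ∈ X ∧ v ∈ Y) ∨ (u ∈ Y ∧ v ∈ X)) (hSX : S ⊆ X)
    (hdeg : ∀ x ∈ S, ∀ y ∈ Y, ¬ G.Adj x y → n ≤ G.degree x + G.degree y)
    {D : ι → Σ u, G.Walk u u} (hD : IsFeasibleSystem_s13 S D)
    (hmin : ∀ D' : ι → Σ u, G.Walk u u, IsFeasibleSystem_s13 S D' →
      ∑ i, (D i).2.length ≤ ∑ i, (D' i).2.length)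
    {T : Finset V} {f : V → V} (hf : IsMatchingOutside G S (walkVerts D) T f)
    (hT : T ≠ S \ walkVerts D) :
    ∃ (D' : ι → Σ u, G.Walk u u) (T' : Finset V) (f' : V → V), IsFeasibleSystem_s13 S D' ∧
      (∀ i, (D' i).2.length = (D i).2.length) ∧
      (∀ i, (S ∩ (D' i).2.support.toFinset).card = (S ∩ (D i).2.support.toFinset).card) ∧
      IsMatchingOutside G S (walkVerts D') T' f' ∧ T'.card = T.card + 1 := by
  classical
  have hXY : ∀ {t}, t ∈ X → t ∉ Y := @(Finset.disjoint_left.1 hdisj)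
  obtain ⟨x, hx, hxT⟩ : ∃ x ∈ S \ walkVerts D, x ∉ T := by
    by_contra! h
    exact hT (hf.subset.antisymm h)
  obtain ⟨hxS, hxU⟩ := Finset.mem_sdiff.1 hx
  by_cases hmax : ∃ g, IsMatchingOutside G S (walkVerts D) (insert x T) g
  · obtain ⟨g, hg⟩ := hmax
    exact ⟨D, _, g, hD, fun _ => rfl, fun _ => rfl, hg, Finset.card_insert_of_notMem hxT⟩
  obtain ⟨A, hA, hxA, hN, hNA⟩ := hf.exists_violator hx (not_exists.1 hmax)
  set U := walkVerts D with hU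
  have hcount := fun (p : V → Prop) [DecidablePred p] =>
    Finset.card_filter_eq_add_sum_of_pairwiseDisjoint
      (fun i => (D i).2.support.toFinset) hD.disjoint p
  change ∀ (p : V → Prop) [DecidablePred p], _ = ((Finset.univ \ U).filter p).card + _ at hcount
  have hcX := hcount (· ∈ X)
  have hcY := hcount (· ∈ Y)
  have hcirc : ∀ i, ((D i).2.support.toFinset.filter (· ∈ X)).card =
      ((D i).2.support.toFinset.filter (· ∈ Y)).card := by
    intro i
    have h1 := (hD.isCycle i).two_mul_card_inter hdisj hbip
    have h2 := (hD.isCycle i).two_mul_card_inter hdisj.symm fun u v h => (hbip u v h).symm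
    rw [Finset.filter_mem_eq_inter, Finset.filter_mem_eq_inter, Finset.inter_comm,
      Finset.inter_comm _ Y]
    omega
  rw [← Finset.sum_congr rfl fun i _ => hcirc i] at hcY
  simp only [Finset.filter_univ_mem, hX, hY] at hcX hcY
  obtain ⟨y, hyY, hyU, hyT⟩ : ∃ y ∈ Y, y ∉ U ∧ y ∉ T.image f := by
    by_contra! h
    have h1 : ((Finset.univ \ U).filter (· ∈ Y)).card ≤ T.card := by
      refine (Finset.card_le_card fun t ht => ?_).trans (Finset.card_image_le (s := T) (f := f))
      simp only [Finset.mem_filter, Finset.mem_sdiff] at ht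
      exact h t ht.2 ht.1.2
    have h2 : T.card < ((Finset.univ \ U).filter (· ∈ X)).card := by
      rw [← Nat.succ_le_iff, Nat.succ_eq_add_one, ← Finset.card_insert_of_notMem hxT]
      refine Finset.card_le_card fun t ht => ?_
      have ht : t ∈ S \ U := Finset.insert_subset hx hf.subset ht
      rw [Finset.mem_sdiff] at ht
      simp [ht.2, hSX ht.1]
    omega
  have hAsub : A ⊆ (Finset.univ \ U).filter (· ∈ X) := by
    intro t ht
    have ht : t ∈ S \ U := Finset.insert_subset hx hf.subset (hA ht)
    rw [Finset.mem_sdiff] at ht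
    simp [ht.2, hSX ht.1]
  have hyA : ∀ a ∈ A, ¬ G.Adj a y := by
    intro a ha hay
    have : y ∈ (A.erase x).image f := by
      rw [← hN]
      exact Finset.mem_biUnion.2 ⟨a, ha, by simp [hyU, hay]⟩
    obtain ⟨t, ht, rfl⟩ := Finset.mem_image.1 this
    rw [Finset.mem_erase] at ht
    exact hyT (Finset.mem_image_of_mem f ((Finset.mem_insert.1 (hA ht.2)).resolve_left ht.1))
  have hdx : ((Finset.univ \ U).filter (G.Adj x)).card < A.card :=
    (Finset.card_le_card (Finset.subset_biUnion_of_mem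
      (fun a => (Finset.univ \ U).filter (G.Adj a)) hxA)).trans_lt hNA
  have hdy : ((Finset.univ \ U).filter (G.Adj y)).card + A.card ≤
      ((Finset.univ \ U).filter (· ∈ X)).card := by
    rw [← Finset.card_union_of_disjoint]
    · refine Finset.card_le_card (Finset.union_subset (fun t ht => ?_) hAsub)
      simp only [Finset.mem_filter] at ht ⊢
      exact ⟨ht.1, by grind [hbip _ _ ht.2]⟩
    · rw [Finset.disjoint_left]
      intro t ht htA
      exact hyA t htA (Finset.mem_filter.1 ht).2.symm
  have hxy := hdeg x hxS y hyY (hyA x hxA)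
  have hdegree : ∀ t, G.degree t = (Finset.univ.filter (G.Adj t)).card := by
    intro t
    rw [← G.card_neighborFinset_eq_degree, G.neighborFinset_eq_filter]
  rw [hdegree, hdegree, hcount (G.Adj x), hcount (G.Adj y)] at hxy
  obtain ⟨i, hi⟩ : ∃ i, ((D i).2.support.toFinset.filter (· ∈ X)).card <
      ((D i).2.support.toFinset.filter (G.Adj x)).card +
        ((D i).2.support.toFinset.filter (G.Adj y)).card := by
    by_contra! h
    have := Finset.sum_le_sum fun i (_ : i ∈ Finset.univ) => h i
    rw [Finset.sum_add_distrib] at this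
    omega
  rw [Finset.filter_mem_eq_inter, Finset.inter_comm] at hi
  have hDU : ∀ i t, t ∈ (D i).2.support.toFinset → t ∈ U := fun i t ht =>
    Finset.mem_biUnion.2 ⟨i, Finset.mem_univ _, ht⟩
  have hdisj' : ∀ {u : V} {w : G.Walk u u},
      w.support.toFinset ⊆ insert x (insert y (D i).2.support.toFinset) →
      ∀ j ≠ i, Disjoint w.support.toFinset (D j).2.support.toFinset := by
    intro u w hw j hj
    rw [Finset.disjoint_left]
    intro t ht htj
    rcases Finset.mem_insert.1 (hw ht) with rfl | ht
    · exact hxU (hDU j _ htj)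
    rcases Finset.mem_insert.1 ht with rfl | ht
    · exact hyU (hDU j _ htj)
    · exact Finset.disjoint_left.1 (hD.disjoint i j hj.symm) ht htj
  obtain ⟨u, w, x', y', hw, hwl, hadj, hx'S, hx'w, hy'w, heq⟩ :=
    (hD.isCycle i).exchangeable hdisj hbip hSX hxS hyY (fun h => hxU (hDU i _ h))
      (fun h => hyU (hDU i _ h)) (hD.feasible i)
      (by
        intro u w hw hsub hS
        have h := hmin _ (hD.update i hw hS (hdisj' hsub))
        rw [← Finset.add_sum_erase _ _ (Finset.mem_univ i),
          ← Finset.add_sum_erase _ _ (Finset.mem_univ i), Function.update_self,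
          Finset.sum_congr rfl (f := fun j => (Function.update D i ⟨u, w⟩ j).2.length)
            (g := fun j => (D j).2.length) fun j hj => by
              rw [Function.update_of_ne (Finset.ne_of_mem_erase hj)]] at h
        exact Nat.le_of_add_le_add_right h) hi
  have hmemEq := fun t => Finset.ext_iff.1 heq t
  simp only [Finset.mem_insert] at hmemEq
  have hyS : y ∉ S := fun h => hXY (hSX h) hyY
  have hy'S : y' ∉ S := fun h => by grind [hbip _ _ hadj]
  have hxD : x ∉ (D i).2.support.toFinset := fun h => hxU (hDU i _ h)
  have hcardS : (S ∩ w.support.toFinset).card = (S ∩ (D i).2.support.toFinset).card := by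
    have h : insert x' (S ∩ w.support.toFinset) = insert x (S ∩ (D i).2.support.toFinset) := by
      ext t
      have := hmemEq t
      simp only [Finset.mem_insert, Finset.mem_inter]
      grind
    have h := congrArg Finset.card h
    rw [Finset.card_insert_of_notMem (fun h => hx'w (Finset.mem_inter.1 h).2),
      Finset.card_insert_of_notMem (fun h => hxD (Finset.mem_inter.1 h).2)] at h
    omega
  have hwsub : w.support.toFinset ⊆ insert x (insert y (D i).2.support.toFinset) := by
    rw [← heq]
    exact (Finset.subset_insert _ _).trans (Finset.subset_insert _ _)
  have hD' := hD.update i hw (hcardS ▸ hD.feasible i) (hdisj' hwsub)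
  have hU' : ∀ t, t ∈ walkVerts (Function.update D i ⟨u, w⟩) ↔
      t ∈ w.support.toFinset ∨ ∃ j ≠ i, t ∈ (D j).2.support.toFinset := by
    intro t
    simp only [walkVerts, Finset.mem_biUnion, Finset.mem_univ, true_and]
    constructor
    · rintro ⟨j, hj⟩
      by_cases h : j = i
      · subst h; rw [Function.update_self] at hj; exact .inl hj
      · rw [Function.update_of_ne h] at hj; exact .inr ⟨j, h, hj⟩
    · rintro (h | ⟨j, h, hj⟩)
      · exact ⟨i, by rw [Function.update_self]; exact h⟩
      · exact ⟨j, by rw [Function.update_of_ne h]; exact hj⟩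
  have hnew : ∀ t, t = x ∨ t = y ∨ t ∈ (D i).2.support.toFinset → t ∉ w.support.toFinset →
      t ∉ walkVerts (Function.update D i ⟨u, w⟩) := by
    intro t ht htw htU
    obtain ⟨j, hj, htj⟩ := ((hU' t).1 htU).resolve_left htw
    rcases ht with rfl | rfl | ht
    · exact hxU (hDU j _ htj)
    · exact hyU (hDU j _ htj)
    · exact Finset.disjoint_left.1 (hD.disjoint i j hj.symm) ht htj
  have hold : ∀ t, t ∉ U → t ≠ x → t ≠ y → t ∉ walkVerts (Function.update D i ⟨u, w⟩) := by
    intro t ht htx hty htU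
    rcases (hU' t).1 htU with h | ⟨j, -, h⟩
    · rcases Finset.mem_insert.1 (hwsub h) with h | h
      · exact htx h
      rcases Finset.mem_insert.1 h with h | h
      · exact hty h
      · exact ht (hDU i _ h)
    · exact ht (hDU j _ h)
  have hTS : ∀ t ∈ T, t ∈ S ∧ t ∉ U := fun t ht => Finset.mem_sdiff.1 (hf.subset ht)
  have hTx : ∀ t ∈ T, t ≠ x := fun t ht h => hxT (h ▸ ht)
  have hfx : ∀ t ∈ T, f t ≠ x := by
    intro t ht h
    have h1 := hSX (hTS t ht).1
    have h2 := hSX hxS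
    rw [← h] at h2
    grind [hbip _ _ (hf.adj t ht)]
  have hfy : ∀ t ∈ T, f t ≠ y := fun t ht h => hyT (h ▸ Finset.mem_image_of_mem f ht)
  have hx'm := (hmemEq x').1 (.inl rfl)
  have hy'm := (hmemEq y').1 (.inr (.inl rfl))
  have hx'T : x' ∉ T := by
    intro h
    rcases hx'm with h' | h' | h'
    · exact hTx _ h h'
    · exact hyS (h' ▸ hx'S)
    · exact (hTS _ h).2 (hDU i _ h')
  have hfy' : ∀ t ∈ T, f t ≠ y' := by
    intro t ht h
    rcases hy'm with h' | h' | h'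
    · exact hfx t ht (h.trans h')
    · exact hfy t ht (h.trans h')
    · exact hf.notMem t ht (h ▸ hDU i _ h')
  have hup : ∀ t ∈ T, Function.update f x' y' t = f t := fun t ht =>
    Function.update_of_ne (by rintro rfl; exact hx'T ht) _ _
  refine ⟨_, insert x' T, Function.update f x' y', hD', ?_, ?_, ⟨?_, ?_, ?_, ?_⟩,
    Finset.card_insert_of_notMem hx'T⟩
  · intro j
    by_cases h : j = i
    · subst h; rw [Function.update_self]; exact hwl
    · rw [Function.update_of_ne h]
  · intro j
    by_cases h : j = i
    · subst h; rw [Function.update_self]; exact hcardS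
    · rw [Function.update_of_ne h]
  · refine Finset.insert_subset (Finset.mem_sdiff.2 ⟨hx'S, hnew _ hx'm hx'w⟩) fun t ht => ?_
    exact Finset.mem_sdiff.2 ⟨(hTS t ht).1, hold t (hTS t ht).2 (hTx t ht)
      (fun h => hyS (h ▸ (hTS t ht).1))⟩
  · intro t ht
    rcases Finset.mem_insert.1 ht with rfl | ht
    · rwa [Function.update_self]
    · rw [hup t ht]; exact hf.adj t ht
  · intro t ht
    rcases Finset.mem_insert.1 ht with rfl | ht
    · rw [Function.update_self]; exact hnew _ hy'm hy'w
    · rw [hup t ht]; exact hold _ (hf.notMem t ht) (hfx t ht) (hfy t ht)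
  · rw [Finset.coe_insert, Set.injOn_insert (by simpa using hx'T), Function.update_self]
    refine ⟨hf.injOn.congr fun t ht => (hup t ht).symm, ?_⟩
    rintro ⟨t, ht, h⟩
    rw [hup t ht] at h
    exact hfy' t ht h

end Exchange


/-- Lemma 3.2(1): if σ₁,₁(S) ≥ n and {C₁, …, C_k} is a minimal system, then G
contains a minimal system {C₁', …, C_k'} with |Cᵢ'| = |Cᵢ| and
|S ∩ V(Cᵢ')| = |S ∩ V(Cᵢ)| such that H' = G − ⋃ Cᵢ' has an S-matching
covering all vertices of S ∩ V(H'). -/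
theorem minimal_system_matching {V : Type*} [Fintype V] [DecidableEq V]
    (G : SimpleGraph V) [DecidableRel G.Adj]
    (X Y S : Finset V) (n k : ℕ)
    (hdisj : Disjoint X Y) (hcover : X ∪ Y = Finset.univ)
    (hX : X.card = n) (hY : Y.card = n)
    (hbip : ∀ u v : V, G.Adj u v → (u ∈ X ∧ v ∈ Y) ∨ (u ∈ Y ∧ v ∈ X))
    (hSX : S ⊆ X)
    (hdeg : ∀ x ∈ S, ∀ y ∈ Y, ¬ G.Adj x y → n ≤ G.degree x + G.degree y)
    (v : Fin k → V) (c : ∀ i, G.Walk (v i) (v i))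
    (hcyc : ∀ i, (c i).IsCycle)
    (hfeas : ∀ i, 2 ≤ (S ∩ (c i).support.toFinset).card)
    (hdisjc : ∀ i j, i ≠ j → Disjoint (c i).support.toFinset (c j).support.toFinset)
    (hmin : ∀ (w : Fin k → V) (d : ∀ i, G.Walk (w i) (w i)),
      (∀ i, (d i).IsCycle) → (∀ i, 2 ≤ (S ∩ (d i).support.toFinset).card) →
      (∀ i j, i ≠ j → Disjoint (d i).support.toFinset (d j).support.toFinset) →
      ∑ i, (c i).length ≤ ∑ i, (d i).length) :
    ∃ (w : Fin k → V) (d : ∀ i, G.Walk (w i) (w i)),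
      (∀ i, (d i).IsCycle) ∧
      (∀ i, 2 ≤ (S ∩ (d i).support.toFinset).card) ∧
      (∀ i j, i ≠ j → Disjoint (d i).support.toFinset (d j).support.toFinset) ∧
      (∀ i, (d i).length = (c i).length) ∧
      (∀ i, (S ∩ (d i).support.toFinset).card = (S ∩ (c i).support.toFinset).card) ∧
      -- an S-matching of H' covering every vertex of S ∩ V(H')
      (∃ f : V → V,
        (∀ x ∈ S \ Finset.univ.biUnion (fun i => (d i).support.toFinset),
          G.Adj x (f x) ∧
          f x ∉ Finset.univ.biUnion (fun i => (d i).support.toFinset)) ∧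
        Set.InjOn f
          ↑(S \ Finset.univ.biUnion (fun i => (d i).support.toFinset))) := by
  let C : Fin k → Σ u, G.Walk u u := fun i => ⟨v i, c i⟩
  have hC : IsFeasibleSystem_s13 S C := ⟨hcyc, hfeas, hdisjc⟩
  by_contra hno
  have step : ∀ m, ∃ (D : Fin k → Σ u, G.Walk u u) (T : Finset V) (f : V → V),
      IsFeasibleSystem_s13 S D ∧ (∀ i, (D i).2.length = (c i).length) ∧
      (∀ i, (S ∩ (D i).2.support.toFinset).card = (S ∩ (c i).support.toFinset).card) ∧
      IsMatchingOutside G S (walkVerts D) T f ∧ T.card = m := by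
    intro m
    induction m with
    | zero =>
      exact ⟨C, ∅, id, hC, fun _ => rfl, fun _ => rfl,
        ⟨by simp, by simp, by simp, by simp⟩, rfl⟩
    | succ m ih =>
      obtain ⟨D, T, f, hD, hlen, hcard, hf, rfl⟩ := ih
      by_cases hT : T = S \ walkVerts D
      · subst hT
        exact absurd ⟨fun i => (D i).1, fun i => (D i).2, hD.isCycle, hD.feasible, hD.disjoint,
          hlen, hcard, f, fun x hx => ⟨hf.adj x hx, hf.notMem x hx⟩, hf.injOn⟩ hno
      · obtain ⟨D', T', f', hD', hlen', hcard', hf', hT'⟩ :=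
          hD.exists_larger_matching hdisj hX hY hbip hSX hdeg
            (fun D' hD' => by
              simp only [hlen]
              exact hmin (fun i => (D' i).1) (fun i => (D' i).2) hD'.isCycle hD'.feasible
                hD'.disjoint) hf hT
        exact ⟨D', T', f', hD', fun i => (hlen' i).trans (hlen i),
          fun i => (hcard' i).trans (hcard i), hf', hT'⟩
  obtain ⟨D, T, f, -, -, -, hf, hT⟩ := step (S.card + 1)
  have := Finset.card_le_card (hf.subset.trans Finset.sdiff_subset)
  omega
end
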